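/- arXiv:1711.00429 — 6 statements merged into one kernel-verified Lean document; each statement's English description precedes it below -/
import Mathlib

section
/- For all sufficiently large n (in particular there exists N such that for all n ≥ N), there exists an n×n array filled with the symbols 1, …, n in which each symbol occurs exactly n times, and which has no partial transversal of size larger than n − (1/42)·ln n. -/
/-- Choosing disjoint subsets of prescribed sizes, as a partial labelling. -/
theorem exists_label {α ι : Type*} [DecidableEq α] [Fintype ι] [DecidableEq ι]
    (D : Finset α) (c : ι → ℕ) (h : ∑ i, c i ≤ D.card) :
    ∃ f : α → Option ι, ∀ i, (D.filter (fun x => f x = some i)).card = c i := by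
  classical
  have : Nonempty ((Σ i, Fin (c i)) ↪ D) := by
    apply Function.Embedding.nonempty_of_card_le
    simpa using h
  obtain ⟨e⟩ := this
  have inj : Function.Injective (fun p => (e p : α)) := 
    Subtype.val_injective.comp e.injective
  refine ⟨Function.extend (fun p => (e p : α)) (fun p => some p.1) (fun _ => none), fun i => ?_⟩
  have : D.filter (fun x => Function.extend (fun p => (e p : α)) (fun p => some p.1)
      (fun _ => none) x = some i) = Finset.univ.image (fun m : Fin (c i) => (e ⟨i, m⟩ : α)) := by
    ext x
    simp only [Finset.mem_filter, Finset.mem_image, Finset.mem_univ, true_and]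
    constructor
    · rintro ⟨_, hx⟩
      by_cases hp : ∃ p, (e p : α) = x
      · obtain ⟨⟨j, m⟩, rfl⟩ := hp
        rw [inj.extend_apply] at hx
        simp only [Option.some.injEq] at hx
        subst hx
        exact ⟨m, rfl⟩
      · rw [Function.extend_apply' _ _ _ hp] at hx
        simp at hx
    · rintro ⟨m, rfl⟩
      refine ⟨(e _).2, ?_⟩
      rw [inj.extend_apply]
  rw [this, Finset.card_image_of_injective]
  · simp
  · intro m m' hm
    have := inj hm
    simpa using this

/-- Completing a partial filling. -/
theorem exists_completion {α Y : Type*} [Fintype α] [DecidableEq α] [Fintype Y] [DecidableEq Y]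
    (n : ℕ) (hα : Fintype.card α = Fintype.card Y * n) (Φ : α → Option Y)
    (hΦ : ∀ s, (Finset.univ.filter (fun p => Φ p = some s)).card ≤ n) :
    ∃ S : α → Y, (∀ p s, Φ p = some s → S p = s) ∧
      ∀ s, (Finset.univ.filter (fun p => S p = s)).card = n := by
  classical
  set F : Finset α := Finset.univ.filter (fun p => Φ p = none) with hF
  have hsum : F.card + ∑ s, (Finset.univ.filter (fun p => Φ p = some s)).card
      = Fintype.card Y * n := by
    have h0 : (Finset.univ : Finset α).card
        = ∑ o : Option Y, (Finset.univ.filter (fun p => Φ p = o)).card :=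
      Finset.card_eq_sum_card_fiberwise (by simp)
    rw [Fintype.sum_option] at h0
    rw [← hα, ← Finset.card_univ (α := α), h0]
  have hd : ∑ s, (n - (Finset.univ.filter (fun p => Φ p = some s)).card)
      + ∑ s, (Finset.univ.filter (fun p => Φ p = some s)).card = Fintype.card Y * n := by
    rw [← Finset.sum_add_distrib, Finset.sum_congr rfl (fun s _ => Nat.sub_add_cancel (hΦ s))]
    simp
  have hd' : ∑ s, (n - (Finset.univ.filter (fun p => Φ p = some s)).card) = F.card := by omega
  obtain ⟨f, hf⟩ := exists_label F _ hd'.le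
  have hfull : ∀ p ∈ F, ∃ s, f p = some s := by
    have h1 : F.card = ∑ o : Option Y, (F.filter (fun p => f p = o)).card :=
      Finset.card_eq_sum_card_fiberwise (by simp)
    rw [Fintype.sum_option] at h1
    simp only [hf] at h1
    have h2 : (F.filter (fun p => f p = none)).card = 0 := by omega
    intro p hp
    rw [Finset.card_eq_zero, Finset.filter_eq_empty_iff] at h2
    exact Option.ne_none_iff_exists'.mp (h2 hp)
  have hS : ∀ p, ∃ s, Φ p = some s ∨ (Φ p = none ∧ f p = some s) := by
    intro p
    rcases h : Φ p with _ | s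
    · obtain ⟨s, hs⟩ := hfull p (by simp [hF, h])
      exact ⟨s, Or.inr ⟨rfl, hs⟩⟩
    · exact ⟨s, Or.inl rfl⟩
  choose S hS using hS
  refine ⟨S, ?_, ?_⟩
  · intro p s h
    rcases hS p with h' | h'
    · rw [h] at h'; simpa using h'.symm
    · rw [h] at h'; simp at h'
  · intro s
    have : (Finset.univ.filter (fun p => S p = s)) = (Finset.univ.filter (fun p => Φ p = some s)) ∪
        F.filter (fun p => f p = some s) := by
      ext p
      have := hS p
      simp only [Finset.mem_filter, Finset.mem_univ, true_and, Finset.mem_union, hF]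
      grind
    rw [this, Finset.card_union_of_disjoint, hf]
    · have := hΦ s; omega
    · rw [Finset.disjoint_left]
      intro p
      simp only [Finset.mem_filter, Finset.mem_univ, true_and, hF]
      grind

/-- The parity argument. -/
theorem parity_bound {n k : ℕ} {Y : Type*} [Fintype Y] [DecidableEq Y] (hY : Fintype.card Y = n)
    (cl : Fin n → Option (Fin k)) (W : Y → Finset (Fin k)) (hW : ∀ s, (W s).card ≤ 2)
    (S : Fin n × Fin n → Y) (x0 : Fin n) (X : Y)
    (hgood : ∀ p, p.1 ≠ x0 → S p ≠ X → ∀ i, Even ((if cl p.1 = some i then 1 else 0) +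
      (if cl p.2 = some i then 1 else 0) + (if i ∈ W (S p) then 1 else 0)))
    (hodd : ∀ i, Odd (Finset.univ.filter (fun s => i ∈ W s)).card)
    (T : Finset (Fin n × Fin n))
    (hT : ∀ p ∈ T, ∀ q ∈ T, p ≠ q → p.1 ≠ q.1 ∧ p.2 ≠ q.2 ∧ S p ≠ S q) :
    T.card ≤ n ∧ k ≤ 4 * (n - T.card) + 8 := by
  classical
  have i1 : Set.InjOn Prod.fst (T : Set (Fin n × Fin n)) := fun p hp q hq h => by
    by_contra hne; exact (hT p hp q hq hne).1 h
  have i2 : Set.InjOn Prod.snd (T : Set (Fin n × Fin n)) := fun p hp q hq h => by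
    by_contra hne; exact (hT p hp q hq hne).2.1 h
  have i3 : Set.InjOn S (T : Set (Fin n × Fin n)) := fun p hp q hq h => by
    by_contra hne; exact (hT p hp q hq hne).2.2 h
  have c1 := Finset.card_image_of_injOn i1
  have c2 := Finset.card_image_of_injOn i2
  have c3 := Finset.card_image_of_injOn i3
  have hTn : T.card ≤ n := by
    rw [← c1]; simpa using Finset.card_le_univ (T.image Prod.fst)
  refine ⟨hTn, ?_⟩
  set d := n - T.card
  set U := (T.image Prod.fst)ᶜ with hU
  set V := (T.image Prod.snd)ᶜ with hV
  set Z := (T.image S)ᶜ with hZ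
  have cU : U.card = d := by rw [hU, Finset.card_compl, c1]; simp [d]
  have cV : V.card = d := by rw [hV, Finset.card_compl, c2]; simp [d]
  have cZ : Z.card = d := by rw [hZ, Finset.card_compl, c3, hY]
  set B := T.filter (fun p => p.1 = x0 ∨ S p = X) with hB
  have cB : B.card ≤ 2 := by
    rw [hB, Finset.filter_or]
    refine (Finset.card_union_le _ _).trans ?_
    have : (T.filter (fun p => p.1 = x0)).card ≤ 1 := by
      rw [Finset.card_le_one]
      intro p hp q hq
      simp only [Finset.mem_filter] at hp hq
      exact i1 hp.1 hq.1 (hp.2.trans hq.2.symm)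
    have : (T.filter (fun p => S p = X)).card ≤ 1 := by
      rw [Finset.card_le_one]
      intro p hp q hq
      simp only [Finset.mem_filter] at hp hq
      exact i3 hp.1 hq.1 (hp.2.trans hq.2.symm)
    omega
  let C : Finset (Fin k) := (U.biUnion fun x => (cl x).toFinset) ∪ (V.biUnion fun x => (cl x).toFinset)
    ∪ Z.biUnion W ∪ B.biUnion (fun p => (cl p.1).toFinset ∪ (cl p.2).toFinset ∪ W (S p))
  have ho : ∀ o : Option (Fin k), o.toFinset.card ≤ 1 := by
    intro o; cases o <;> simp
  have hC : C.card ≤ d * 1 + d * 1 + d * 2 + 2 * 4 := by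
    refine (Finset.card_union_le _ _).trans (add_le_add ((Finset.card_union_le _ _).trans
      (add_le_add ((Finset.card_union_le _ _).trans (add_le_add ?_ ?_)) ?_)) ?_)
    · rw [← cU]; exact Finset.card_biUnion_le_card_mul _ _ _ (fun x _ => ho _)
    · rw [← cV]; exact Finset.card_biUnion_le_card_mul _ _ _ (fun x _ => ho _)
    · rw [← cZ]; exact Finset.card_biUnion_le_card_mul _ _ _ (fun x _ => hW _)
    · refine (Finset.card_biUnion_le_card_mul _ _ 4 (fun p _ => ?_)).trans (Nat.mul_le_mul_right _ cB)
      have := ho (cl p.1)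
      have := ho (cl p.2)
      have := hW (S p)
      have := Finset.card_union_le ((cl p.1).toFinset ∪ (cl p.2).toFinset) (W (S p))
      have := Finset.card_union_le ((cl p.1).toFinset) ((cl p.2).toFinset)
      omega
  suffices h : ∀ i, i ∈ C by
    have : C = Finset.univ := by ext i; simp [h]
    rw [this] at hC
    simp at hC
    omega
  intro i
  by_contra hi
  simp only [C, Finset.mem_union, Finset.mem_biUnion, not_or, not_exists, not_and,
    Option.mem_toFinset, Option.mem_def] at hi
  obtain ⟨⟨⟨h1, h2⟩, h3⟩, h4⟩ := hi
  have s1 : ∑ x, (if cl x = some i then 1 else 0) = ∑ p ∈ T, (if cl p.1 = some i then 1 else 0) := by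
    rw [← Finset.sum_image (f := fun x => if cl x = some i then 1 else 0) i1]
    symm
    apply Finset.sum_subset (Finset.subset_univ _)
    intro x _ hx
    simp [h1 x (by simpa [hU] using hx)]
  have s2 : ∑ x, (if cl x = some i then 1 else 0) = ∑ p ∈ T, (if cl p.2 = some i then 1 else 0) := by
    rw [← Finset.sum_image (f := fun x => if cl x = some i then 1 else 0) i2]
    symm
    apply Finset.sum_subset (Finset.subset_univ _)
    intro x _ hx
    simp [h2 x (by simpa [hV] using hx)]
  have s3 : ∑ s, (if i ∈ W s then 1 else 0) = ∑ p ∈ T, (if i ∈ W (S p) then 1 else 0) := by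
    rw [← Finset.sum_image (f := fun s => if i ∈ W s then 1 else 0) i3]
    symm
    apply Finset.sum_subset (Finset.subset_univ _)
    intro x _ hx
    simp [h3 x (by simpa [hZ] using hx)]
  have hev : Even (∑ p ∈ T, ((if cl p.1 = some i then 1 else 0) +
      (if cl p.2 = some i then 1 else 0) + (if i ∈ W (S p) then 1 else 0))) := by
    apply Finset.even_sum
    intro p hp
    by_cases hb : p ∈ B
    · obtain ⟨⟨ha, hb⟩, hc⟩ := h4 p hb
      simp [ha, hb, hc]
    · simp only [hB, Finset.mem_filter, not_and, not_or] at hb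
      exact hgood p (hb hp).1 (hb hp).2 i
  rw [Finset.sum_add_distrib, Finset.sum_add_distrib, ← s1, ← s2, ← s3] at hev
  have := hodd i
  rw [Finset.card_filter] at this
  rw [Nat.odd_iff] at this
  rw [Nat.even_iff] at hev
  omega

/-- Index type of the structured symbols. -/
abbrev Idx (k m : ℕ) := Option (Sym2 (Fin k) ⊕ (Fin k × Fin m))

/-- Weights of symbols. -/
def wt (k m r : ℕ) : Idx k m ⊕ Fin r → Finset (Fin k)
  | Sum.inl (some (Sum.inl z)) => if z.IsDiag then ∅ else Finset.univ.filter (· ∈ z)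
  | Sum.inl (some (Sum.inr p)) => {p.1}
  | Sum.inl none => ∅
  | Sum.inr _ => ∅

theorem wt_card (k m r : ℕ) (s : Idx k m ⊕ Fin r) : (wt k m r s).card ≤ 2 := by
  rcases s with (_ | z | p) | _
  · simp [wt]
  · simp only [wt]
    split_ifs
    · simp
    · induction z with
      | h x y =>
        have : Finset.univ.filter (· ∈ s(x, y)) ⊆ ({x, y} : Finset (Fin k)) := by
          intro i; simp
        exact (Finset.card_le_card this).trans Finset.card_le_two
  · simp [wt]
  · simp [wt]

theorem wt_count (k m r : ℕ) (i : Fin k) :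
    (Finset.univ.filter (fun s => i ∈ wt k m r s)).card = (k - 1) + m := by
  rw [Finset.card_filter, Fintype.sum_sum_type, Fintype.sum_option, Fintype.sum_sum_type,
    Fintype.sum_prod_type]
  have h1 : ∑ z : Sym2 (Fin k), (if i ∈ wt k m r (Sum.inl (some (Sum.inl z))) then 1 else 0)
      = k - 1 := by
    rw [← Finset.card_filter]
    have : Finset.univ.filter (fun z => i ∈ wt k m r (Sum.inl (some (Sum.inl z))))
        = (Finset.univ.erase i).image (fun j => s(i, j)) := by
      ext z
      rw [Finset.mem_filter]
      induction z with
      | h x y =>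
        simp only [wt, Finset.mem_univ, true_and, Finset.mem_image,
          Finset.mem_erase, Sym2.mk_isDiag_iff]
        by_cases hxy : x = y
        · simp only [hxy, if_true, Finset.notMem_empty, false_iff]
          rintro ⟨j, hj, h⟩
          rw [Sym2.eq_iff] at h
          grind
        · simp only [hxy, if_false, Finset.mem_filter, Finset.mem_univ, true_and, Sym2.mem_iff]
          constructor
          · rintro (rfl | rfl)
            · exact ⟨y, by grind, rfl⟩
            · exact ⟨x, by grind, Sym2.eq_swap⟩
          · rintro ⟨j, hj, h⟩
            rw [Sym2.eq_iff] at h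
            grind
    rw [this, Finset.card_image_of_injective, Finset.card_erase_of_mem (by simp)]
    · simp
    · intro j j' h
      rw [Sym2.eq_iff] at h
      grind
  rw [h1]
  simp [wt, Finset.sum_ite_eq]

theorem construction {n k a ρ : ℕ} (hn : 2 * a ^ 2 + ρ = n) (hk : k ≤ 2 * a) (hk0 : 0 < k)
    (h1 : k ^ 2 * ρ ≤ n) (h2 : Fintype.card (Sym2 (Fin k)) * ρ + k * a < n)
    (h3 : Fintype.card (Idx k (2 * a - k)) ≤ n) :
    ∃ (Y : Type) (_ : Fintype Y) (_ : DecidableEq Y) (S : Fin n × Fin n → Y),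
      Fintype.card Y = n ∧ 
      (∀ s, (Finset.univ.filter (fun p => S p = s)).card = n) ∧
      ∀ (T : Finset (Fin n × Fin n)),
        (∀ p ∈ T, ∀ q ∈ T, p ≠ q → p.1 ≠ q.1 ∧ p.2 ≠ q.2 ∧ S p ≠ S q) →
        T.card ≤ n ∧ k ≤ 4 * (n - T.card) + 8 := by
  classical
  set m := 2 * a - k with hm
  set r := n - Fintype.card (Idx k m) with hr
  have hY : Fintype.card (Idx k m ⊕ Fin r) = n := by
    rw [Fintype.card_sum, Fintype.card_fin]; omega
  -- row classes
  obtain ⟨cl, hcl⟩ := exists_label (Finset.univ : Finset (Fin n)) (fun _ : Fin k => a)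
    (by simp; omega)
  set N : Finset (Fin n) := Finset.univ.filter (fun x => cl x = none) with hN
  have hNc : N.card + k * a = n := by
    have h0 : (Finset.univ : Finset (Fin n)).card
        = ∑ o : Option (Fin k), (Finset.univ.filter (fun p => cl p = o)).card :=
      Finset.card_eq_sum_card_fiberwise (by simp)
    rw [Fintype.sum_option] at h0
    simp only [hcl] at h0
    simp at h0
    exact h0.symm
  have hNpos : 0 < N.card := by omega
  obtain ⟨x0, hx0⟩ := Finset.card_pos.mp hNpos
  have hx0' : cl x0 = none := by simpa [hN] using hx0
  -- labelling of the exceptional row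
  obtain ⟨e, he⟩ := exists_label N (fun _ : Sym2 (Fin k) => ρ) (by simp at h2 ⊢; omega)
  -- the cells of type `e_i`
  let R : Fin k → Finset (Fin n) := fun i => Finset.univ.filter (fun x => cl x = some i)
  have hR : ∀ i, (R i).card = a := hcl
  let D : Fin k → Finset (Fin n × Fin n) := fun i => (R i) ×ˢ N ∪ N ×ˢ (R i)
  have hD : ∀ i, (D i).card = m * n + k * ρ := by
    intro i
    have : Disjoint ((R i) ×ˢ N) (N ×ˢ (R i)) := by
      rw [Finset.disjoint_left]
      intro p
      simp only [Finset.mem_product, R, hN, Finset.mem_filter, Finset.mem_univ, true_and]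
      grind
    simp only [D]
    rw [Finset.card_union_of_disjoint this, Finset.card_product, Finset.card_product, hR]
    have : (m : ℤ) = 2 * a - k := by omega
    zify at hNc hn ⊢
    rw [this, ← hn]
    have : (N.card : ℤ) = 2 * a ^ 2 + ρ - k * a := by linarith
    rw [this]
    ring
  have hh : ∀ i, ∃ h : Fin n × Fin n → Option (Fin m), ∀ j,
      ((D i).filter (fun x => h x = some j)).card = n := fun i =>
    exists_label (D i) (fun _ : Fin m => n) (by rw [hD]; simp)
  choose h hh using hh
  have hh0 : ∀ i, ((D i).filter (fun x => h i x = none)).card = k * ρ := by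
    intro i
    have h0 : (D i).card
        = ∑ o : Option (Fin m), ((D i).filter (fun p => h i p = o)).card :=
      Finset.card_eq_sum_card_fiberwise (by simp)
    rw [Fintype.sum_option] at h0
    simp only [hh, hD] at h0
    simp at h0
    omega
  let mk : Fin k → Option (Fin m) → Idx k m := fun i o => o.map (fun j => Sum.inr (i, j))
  let Φ : Fin n × Fin n → Option (Idx k m ⊕ Fin r) := fun p =>
    match cl p.1, cl p.2 with
    | some i, some j => some (Sum.inl (some (Sum.inl s(i, j))))
    | some i, none => some (Sum.inl (mk i (h i p)))
    | none, some i => some (Sum.inl (mk i (h i p)))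
    | none, none => if p.1 = x0 then (e p.2).map (fun z => Sum.inl (some (Sum.inl z))) else none
  have fz : ∀ i j, (Finset.univ.filter (fun p => Φ p = some (Sum.inl (some (Sum.inl s(i, j))))))
      = (R i ×ˢ R j ∪ R j ×ˢ R i) ∪ {x0} ×ˢ (N.filter (fun y => e y = some s(i, j))) := by
    intro i j
    ext ⟨x, y⟩
    simp only [Φ, mk, Finset.mem_filter, Finset.mem_univ, true_and, Finset.mem_union,
      Finset.mem_product, R, hN, Finset.mem_singleton]
    rcases hx : cl x with _ | u <;> rcases hy : cl y with _ | v
    · simp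
    · rcases h v (x, y) with _ | _ <;> simp
    · rcases h u (x, y) with _ | _ <;> simp <;> grind
    · simp
  have fp : ∀ i j, (Finset.univ.filter (fun p => Φ p = some (Sum.inl (some (Sum.inr (i, j))))))
      = (D i).filter (fun p => h i p = some j) := by
    intro i j
    ext ⟨x, y⟩
    simp only [Φ, mk, D, Finset.mem_filter, Finset.mem_univ, true_and, Finset.mem_union,
      Finset.mem_product, R, hN]
    rcases hx : cl x with _ | u <;> rcases hy : cl y with _ | v
    · simp
    · rcases hq : h v (x, y) with _ | _ <;> simp <;> grind
    · rcases hq : h u (x, y) with _ | _ <;> simp <;> grind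
    · simp
  have fX : (Finset.univ.filter (fun p => Φ p = some (Sum.inl none)))
      ⊆ Finset.univ.biUnion (fun i => (D i).filter (fun p => h i p = none)) := by
    rintro ⟨x, y⟩
    simp only [Φ, mk, D, Finset.mem_filter, Finset.mem_univ, true_and, Finset.mem_union,
      Finset.mem_product, R, hN, Finset.mem_biUnion]
    rcases hx : cl x with _ | u <;> rcases hy : cl y with _ | v
    · simp
    · rcases hq : h v (x, y) with _ | _ <;> simp <;> grind
    · rcases hq : h u (x, y) with _ | _ <;> simp <;> grind
    · simp
  have fr : ∀ t, (Finset.univ.filter (fun p => Φ p = some (Sum.inr t))) = ∅ := by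
    intro t
    ext ⟨x, y⟩
    simp only [Φ, mk, Finset.mem_filter, Finset.mem_univ, true_and]
    rcases hx : cl x with _ | u <;> rcases hy : cl y with _ | v <;> simp
  have cz : ∀ i j, i ≠ j →
      (Finset.univ.filter (fun p => Φ p = some (Sum.inl (some (Sum.inl s(i, j)))))).card = n := by
    intro i j hij
    rw [fz, Finset.card_union_of_disjoint, Finset.card_union_of_disjoint]
    · simp only [Finset.card_product, hR, Finset.card_singleton, he]
      rw [← hn]; ring
    · rw [Finset.disjoint_left]
      intro p
      simp only [Finset.mem_product, R, Finset.mem_filter, Finset.mem_univ, true_and]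
      grind
    · rw [Finset.disjoint_left]
      intro p
      simp only [Finset.mem_product, R, Finset.mem_filter, Finset.mem_univ, true_and,
        Finset.mem_union, Finset.mem_singleton]
      grind
  have cp : ∀ i j, 
      (Finset.univ.filter (fun p => Φ p = some (Sum.inl (some (Sum.inr (i, j)))))).card = n := by
    intro i j
    rw [fp, hh]
  have hΦ : ∀ s, (Finset.univ.filter (fun p => Φ p = some s)).card ≤ n := by
    rintro ((_ | z | ⟨i, j⟩) | t)
    · refine (Finset.card_le_card fX).trans ((Finset.card_biUnion_le_card_mul _ _ (k * ρ)
        (fun i _ => (hh0 i).le)).trans ?_)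
      simp only [Finset.card_univ, Fintype.card_fin]
      calc k * (k * ρ) = k ^ 2 * ρ := by ring
        _ ≤ n := h1
    · induction z with
      | h i j =>
        rw [fz]
        refine (Finset.card_union_le _ _).trans ?_
        have := Finset.card_union_le (R i ×ˢ R j) (R j ×ˢ R i)
        simp only [Finset.card_product, hR, Finset.card_singleton, he] at this ⊢
        nlinarith
    · exact (cp i j).le
    · rw [fr]; simp
  obtain ⟨S, hS, hSn⟩ := exists_completion n (by rw [hY]; simp) Φ (fun s => by convert hΦ s)
  have hexact : ∀ s, (Finset.univ.filter (fun p => Φ p = some s)).card = n →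
      ∀ p, S p = s → Φ p = some s := by
    intro s hs p hp
    have hsub : (Finset.univ.filter (fun p => Φ p = some s)) ⊆
        (Finset.univ.filter (fun p => S p = s)) := by
      intro q hq
      simp only [Finset.mem_filter, Finset.mem_univ, true_and] at hq ⊢
      exact hS q s hq
    have := Finset.eq_of_subset_of_card_le hsub (by rw [hs]; exact (by convert hSn s : _ = n).le)
    have hp' : p ∈ (Finset.univ.filter (fun p => S p = s)) := by simp [hp]
    rw [← this] at hp'
    simpa using hp'
  refine ⟨Idx k m ⊕ Fin r, inferInstance, inferInstance, S, hY, hSn, fun T hT => ?_⟩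
  refine parity_bound hY cl (wt k m r) (wt_card k m r) S x0 (Sum.inl none) ?_ ?_ T hT
  · rintro ⟨x, y⟩ hx hX i
    simp only at hx ⊢
    rcases hu : cl x with _ | u <;> rcases hv : cl y with _ | v
    · -- free cell
      have hf : Φ (x, y) = none := by simp [Φ, hu, hv, hx]
      have : wt k m r (S (x, y)) = ∅ := by
        rcases hs : S (x, y) with (_ | z | ⟨i, j⟩) | t
        · simp [wt]
        · induction z with
          | h i j =>
            by_cases hij : i = j
            · simp [wt, hij]
            · have := hexact _ (cz i j hij) _ hs
              simp [hf] at this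
        · have := hexact _ (cp i j) _ hs
          simp [hf] at this
        · simp [wt]
      simp [this]
    · have hf : Φ (x, y) = some (Sum.inl (mk v (h v (x, y)))) := by simp [Φ, hu, hv]
      have hs := hS _ _ hf
      rw [hs] at hX ⊢
      rcases hq : h v (x, y) with _ | j
      · simp [mk, hq] at hX
      · simp only [mk, Option.map_some, wt]
        by_cases hi : v = i
        · subst hi; simp
        · simp [hi, Ne.symm hi]
    · have hf : Φ (x, y) = some (Sum.inl (mk u (h u (x, y)))) := by simp [Φ, hu, hv]
      have hs := hS _ _ hf
      rw [hs] at hX ⊢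
      rcases hq : h u (x, y) with _ | j
      · simp [mk, hq] at hX
      · simp only [mk, Option.map_some, wt]
        by_cases hi : u = i
        · subst hi; simp
        · simp [hi, Ne.symm hi]
    · have hf : Φ (x, y) = some (Sum.inl (some (Sum.inl s(u, v)))) := by simp [Φ, hu, hv]
      have hs := hS _ _ hf
      rw [hs]
      simp only [wt, Sym2.mk_isDiag_iff]
      by_cases huv : u = v
      · subst huv
        by_cases hi : u = i <;> simp [hi]
      · by_cases hi : u = i <;> by_cases hj : v = i
        · exact absurd (hi.trans hj.symm) huv
        · simp [huv, hi, hj]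
          grind
        · simp [huv, hi, hj]
        · simp [hi, hj]
          grind
  · intro i
    rw [wt_count, Nat.odd_iff]
    omega

theorem numeric {n : ℕ} (k : ℕ) (hk0 : 0 < k) (hk : 200 * (k + 1) ^ 4 + 200 ≤ n) :
    ∃ a ρ : ℕ, 2 * a ^ 2 + ρ = n ∧ k ≤ 2 * a ∧ k ^ 2 * ρ ≤ n ∧
      Fintype.card (Sym2 (Fin k)) * ρ + k * a < n ∧
      Fintype.card (Idx k (2 * a - k)) ≤ n := by
  set a := Nat.sqrt (n / 2) with ha
  have h1 : a * a ≤ n / 2 := Nat.sqrt_le _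
  have h2 : n / 2 < (a + 1) * (a + 1) := Nat.lt_succ_sqrt _
  obtain ⟨ρ, hρ⟩ : ∃ ρ, n = 2 * (a * a) + ρ := Nat.exists_eq_add_of_le (by omega)
  have hρ' : ρ ≤ 4 * a + 1 := by
    have : n < 2 * ((a + 1) * (a + 1)) := by omega
    nlinarith
  set K := (k + 1) ^ 2 with hK
  have hK4 : 4 ≤ K := by rw [hK]; nlinarith
  have hkK : 2 * k ≤ K := by rw [hK]; nlinarith
  have hkK2 : k ^ 2 ≤ K := by rw [hK]; nlinarith
  have hKa : 9 * K ≤ a := by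
    have e : (k + 1) ^ 4 = K ^ 2 := by rw [hK]; ring
    rw [e] at hk
    have : n < 2 * ((a + 1) * (a + 1)) := by omega
    by_contra hlt
    have : a + 1 ≤ 9 * K := by omega
    have := Nat.mul_le_mul this this
    nlinarith
  have hc : Fintype.card (Sym2 (Fin k)) ≤ K := by
    rw [Sym2.card, Fintype.card_fin, Nat.choose_two_right]
    refine (Nat.div_le_self _ _).trans ?_
    rw [hK]
    simp only [Nat.add_sub_cancel]
    nlinarith
  have hKaa : 9 * (K * a) ≤ a * a := by nlinarith
  have hρa : ρ ≤ 5 * a := by omega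
  have hKρ : K * ρ ≤ 5 * (K * a) := by nlinarith
  have hpos : 0 < K * a := Nat.mul_pos (by omega) (by omega)
  refine ⟨a, ρ, by rw [hρ]; ring, by omega, ?_, ?_, ?_⟩
  · have := Nat.mul_le_mul_right ρ hkK2
    omega
  · have := Nat.mul_le_mul_right ρ hc
    have : k * a ≤ K * a := Nat.mul_le_mul_right a (by omega)
    omega
  · rw [Fintype.card_option, Fintype.card_sum, Fintype.card_prod, Fintype.card_fin,
      Fintype.card_fin]
    have : k * (2 * a - k) ≤ k * (2 * a) := Nat.mul_le_mul_left _ (by omega)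
    have : k * (2 * a) ≤ K * a := by nlinarith
    have : K ≤ K * a := Nat.le_mul_of_pos_right _ (by omega)
    omega

/-- For all sufficiently large `n`, there exists an `n × n` array filled with the
symbols `1, …, n` (modelled as `Fin n`) in which each symbol occurs exactly `n` times, and which
has no partial transversal of size larger than `n - (1/42) · ln n`. -/
theorem stein_conjecture_counterexample :
    ∃ N : ℕ, ∀ n : ℕ, N ≤ n →
      ∃ S : Fin n → Fin n → Fin n,
        (∀ s : Fin n,
          (Finset.univ.filter (fun p : Fin n × Fin n => S p.1 p.2 = s)).card = n) ∧
        (∀ T : Finset (Fin n × Fin n),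
          (∀ p ∈ T, ∀ q ∈ T, p ≠ q → p.1 ≠ q.1 ∧ p.2 ≠ q.2 ∧ S p.1 p.2 ≠ S q.1 q.2) →
          (T.card : ℝ) ≤ (n : ℝ) - Real.log n / 42) := by
  have hlim : ∀ᶠ n : ℕ in Filter.atTop, 200 * (Real.log n + 10) ^ 4 + 200 ≤ (n : ℝ) := by
    have h1 := (Real.isLittleO_pow_log_id_atTop (n := 4)).bound (c := 1 / 6400) (by norm_num)
    have h2 := Real.tendsto_log_atTop.eventually_ge_atTop 10
    have h3 := h1.and (h2.and (Filter.eventually_ge_atTop (400 : ℝ)))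
    refine (tendsto_natCast_atTop_atTop.eventually h3).mono ?_
    rintro n ⟨ha, hb, hc⟩
    rw [Real.norm_of_nonneg (by positivity), Real.norm_of_nonneg (by simp)] at ha
    simp only [id] at ha
    have : (Real.log n + 10) ^ 4 ≤ (2 * Real.log n) ^ 4 :=
      pow_le_pow_left₀ (by linarith) (by linarith) 4
    rw [mul_pow] at this
    linarith
  obtain ⟨N, hN⟩ := Filter.eventually_atTop.mp hlim
  refine ⟨max N 1, fun n hn => ?_⟩
  have hlog := hN n (le_of_max_le_left hn)
  have hn1 : 1 ≤ n := le_of_max_le_right hn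
  have hl0 : 0 ≤ Real.log n := Real.log_natCast_nonneg n
  set k := ⌊Real.log n⌋₊ + 9 with hk
  have hk1 : (k : ℝ) ≤ Real.log n + 9 := by
    rw [hk]; push_cast; linarith [Nat.floor_le hl0]
  have hk2 : Real.log n + 8 ≤ k := by
    rw [hk]; push_cast; linarith [Nat.lt_floor_add_one (Real.log n)]
  have hkn : 200 * (k + 1) ^ 4 + 200 ≤ n := by
    have : (200 * (k + 1) ^ 4 + 200 : ℝ) ≤ n := by
      have : ((k : ℝ) + 1) ^ 4 ≤ (Real.log n + 10) ^ 4 :=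
        pow_le_pow_left₀ (by positivity) (by linarith) 4
      linarith
    exact_mod_cast this
  obtain ⟨a, ρ, e1, e2, e3, e4, e5⟩ := numeric k (by omega) hkn
  obtain ⟨Y, _, _, S, hY, hS, hT⟩ := construction e1 e2 (by omega) e3 e4 e5
  let E : Y ≃ Fin n := Fintype.equivFinOfCardEq hY
  refine ⟨fun x y => E (S (x, y)), fun s => ?_, fun T h => ?_⟩
  · refine Eq.trans ?_ (hS (E.symm s))
    congr 1
    ext p
    simp [Equiv.eq_symm_apply]
  · obtain ⟨t1, t2⟩ := hT T (fun p hp q hq hpq => by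
      obtain ⟨u, v, w⟩ := h p hp q hq hpq
      exact ⟨u, v, fun hh => w (by simp [hh])⟩)
    have : (k : ℝ) ≤ 4 * ((n : ℝ) - T.card) + 8 := by
      rw [← Nat.cast_sub t1]
      exact_mod_cast t2
    linarith
end

section
/- There exists a positive integer n and an n×n array filled with the symbols 1, …, n, each symbol occurring exactly n times, which has no partial transversal of size n − 1. (This disproves Stein's conjecture that every such array has a partial transversal of size n − 1.) -/
open Finset

namespace SteinAux

/-- If `g` is injective on `T` and `T` has one element less than the target, exactly one
element of the target is missed. -/
lemma missing {α β : Type*} [Fintype β] [DecidableEq β] (T : Finset α) (g : α → β)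
    (hg : ∀ p ∈ T, ∀ q ∈ T, g p = g q → p = q) (hc : T.card + 1 = Fintype.card β) :
    ∃ b0 : β, ∀ f : β → ℕ, ∑ p ∈ T, f (g p) + f b0 = ∑ b, f b := by
  classical
  have hcard : (T.image g).card = T.card :=
    Finset.card_image_of_injOn (fun p hp q hq h => hg p hp q hq h)
  have h1 : ((T.image g)ᶜ).card = 1 := by
    rw [Finset.card_compl, hcard]; omega
  obtain ⟨b0, hb0⟩ := Finset.card_eq_one.mp h1
  refine ⟨b0, fun f => ?_⟩
  rw [← Finset.sum_add_sum_compl (T.image g) f, hb0, Finset.sum_singleton,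
    Finset.sum_image (fun p hp q hq h => hg p hp q hq h)]

/-- The parity obstruction. -/
lemma parity {ι X Y : Type*} [Fintype ι] [DecidableEq ι] [Fintype X] [DecidableEq X]
    [Fintype Y] [DecidableEq Y] (r : X → Option ι) (own : Y → Option ι) (w : Y → ℕ)
    (S : X × X → Y) (Br : X × X → Finset ι)
    (hBr : ∀ p, (Br p).card ≤ w (S p))
    (hev : ∀ p i, i ∉ Br p → Even ((if r p.1 = some i then 1 else 0) +
      (if r p.2 = some i then 1 else 0) + (if own (S p) = some i then 1 else 0)))
    (hodd : ∀ i, Odd (∑ y, if own y = some i then 1 else 0))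
    (hw : ∑ y, w y + 3 < Fintype.card ι)
    (hXY : Fintype.card X = Fintype.card Y)
    (T : Finset (X × X))
    (hT : ∀ p ∈ T, ∀ q ∈ T, p ≠ q → p.1 ≠ q.1 ∧ p.2 ≠ q.2 ∧ S p ≠ S q)
    (hcard : T.card + 1 = Fintype.card X) : False := by
  classical
  obtain ⟨x0, hx0⟩ := missing T (fun p => p.1)
    (fun p hp q hq h => by by_contra hne; exact (hT p hp q hq hne).1 h) hcard
  obtain ⟨y0, hy0⟩ := missing T (fun p => p.2)
    (fun p hp q hq h => by by_contra hne; exact (hT p hp q hq hne).2.1 h) hcard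
  obtain ⟨s0, hs0⟩ := missing T S
    (fun p hp q hq h => by by_contra hne; exact (hT p hp q hq hne).2.2 h) (hcard.trans hXY)
  have hopt : ∀ o : Option ι, o.toFinset.card ≤ 1 := by
    intro o; cases o <;> simp
  have hB : ((r x0).toFinset ∪ (r y0).toFinset ∪ (own s0).toFinset ∪ T.biUnion Br).card
      < (Finset.univ : Finset ι).card := by
    have h1 := Finset.card_union_le
      ((r x0).toFinset ∪ (r y0).toFinset ∪ (own s0).toFinset) (T.biUnion Br)
    have h2 := Finset.card_union_le ((r x0).toFinset ∪ (r y0).toFinset) (own s0).toFinset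
    have h3 := Finset.card_union_le (r x0).toFinset (r y0).toFinset
    have h4 : (T.biUnion Br).card ≤ ∑ p ∈ T, w (S p) :=
      Finset.card_biUnion_le.trans (Finset.sum_le_sum fun p _ => hBr p)
    have h5 := hs0 w
    have h6 := hopt (r x0)
    have h7 := hopt (r y0)
    have h8 := hopt (own s0)
    rw [Finset.card_univ]
    omega
  obtain ⟨i, -, hi⟩ := Finset.exists_mem_notMem_of_card_lt_card hB
  simp only [Finset.mem_union, Option.mem_toFinset, Finset.mem_biUnion, not_or,
    Option.mem_def, not_exists, not_and] at hi
  obtain ⟨⟨⟨h1, h2⟩, h3⟩, h4⟩ := hi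
  have e1 := hx0 (fun x => if r x = some i then 1 else 0)
  have e2 := hy0 (fun x => if r x = some i then 1 else 0)
  have e3 := hs0 (fun y => if own y = some i then 1 else 0)
  simp only [h1, h2, h3, if_false, add_zero] at e1 e2 e3
  have hE : Even (∑ p ∈ T, ((if r p.1 = some i then 1 else 0) +
      (if r p.2 = some i then 1 else 0) + (if own (S p) = some i then 1 else 0))) :=
    Finset.even_sum _ fun p hp => hev p i (h4 p hp)
  rw [Finset.sum_add_distrib, Finset.sum_add_distrib, e1, e2, e3] at hE
  have ho := hodd i
  rw [Nat.odd_iff] at ho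
  rw [Nat.even_iff] at hE
  omega

/-- Filling classes of cells with symbols. -/
lemma fill {A C : Type*} [Fintype A] [DecidableEq A] [Fintype C] [DecidableEq C] (f : A → C) (size : C → ℕ)
    (n : ℕ) (h : ∀ c, (univ.filter fun a => f a = c).card = n * size c) :
    ∃ g : A → (Σ c, Fin (size c)), (∀ a, (g a).1 = f a) ∧
      ∀ s, (univ.filter fun a => g a = s).card = n := by
  classical
  have e0 : ∀ c, Nonempty ({a // f a = c} ≃ Fin (size c) × Fin n) := by
    intro c
    refine ⟨Fintype.equivOfCardEq ?_⟩
    rw [Fintype.card_subtype, h c]; simp [mul_comm]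
  let e := fun c => Classical.choice (e0 c)
  refine ⟨fun a => ⟨f a, (e (f a) ⟨a, rfl⟩).1⟩, fun a => rfl, ?_⟩
  rintro ⟨c, s⟩
  have : (univ.filter fun a => (⟨f a, (e (f a) ⟨a, rfl⟩).1⟩ : Σ c, Fin (size c)) = ⟨c, s⟩)
      = (univ : Finset (Fin n)).image (fun t => ((e c).symm (s, t)).1) := by
    ext a
    simp only [mem_filter, mem_univ, true_and, mem_image]
    constructor
    · intro hh
      obtain rfl : f a = c := congrArg Sigma.fst hh
      have h2 : (e (f a) ⟨a, rfl⟩).1 = s := by simpa using hh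
      refine ⟨(e (f a) ⟨a, rfl⟩).2, ?_⟩
      rw [← h2]; simp
    · rintro ⟨t, rfl⟩
      have key : ∀ x : {a // f a = c}, (⟨f x.1, (e (f x.1) ⟨x.1, rfl⟩).1⟩ : Σ c, Fin (size c))
          = ⟨c, (e c x).1⟩ := by
        rintro ⟨x, rfl⟩; rfl
      rw [key]; simp
  rw [this, Finset.card_image_of_injective, Finset.card_univ, Fintype.card_fin]
  intro t t' htt
  have := (e c).symm.injective (Subtype.ext htt)
  simpa using this

/-- Classes: native `inl i`, owned `inr (inl i)`, breaking `inr (inr true)`,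
generic `inr (inr false)`. -/
def cls {ι X : Type*} [DecidableEq ι] [DecidableEq X] (r : X → Option ι) (lev : ι → ℕ)
    (Own : ι → Finset (X × X)) (F : Finset (X × X)) (p : X × X) : ι ⊕ (ι ⊕ Bool) :=
  match r p.1, r p.2 with
  | some i, none => Sum.inl i
  | none, some i => Sum.inl i
  | none, none => if p ∈ F then Sum.inr (Sum.inr true) else Sum.inr (Sum.inr false)
  | some i, some j =>
    if lev j < lev i ∧ p ∈ Own i then Sum.inr (Sum.inl i)
    else if lev i < lev j ∧ p ∈ Own j then Sum.inr (Sum.inl j)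
    else if i = j then Sum.inr (Sum.inr false) else Sum.inr (Sum.inr true)

/-- The class owning a symbol. -/
def ownC {ι : Type*} : ι ⊕ (ι ⊕ Bool) → Option ι
  | Sum.inl i => some i
  | Sum.inr (Sum.inl i) => some i
  | Sum.inr (Sum.inr _) => none

/-- How many types a symbol may break. -/
def wC {ι : Type*} : ι ⊕ (ι ⊕ Bool) → ℕ
  | Sum.inl _ => 0
  | Sum.inr (Sum.inl _) => 1
  | Sum.inr (Sum.inr true) => 2
  | Sum.inr (Sum.inr false) => 0

/-- Number of symbols in each class. -/
def sizeC {ι : Type*} (m : ι → ℕ) (u g : ℕ) : ι ⊕ (ι ⊕ Bool) → ℕ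
  | Sum.inl i => m i
  | Sum.inr (Sum.inl i) => m i - 1
  | Sum.inr (Sum.inr true) => u
  | Sum.inr (Sum.inr false) => g

lemma break_card {ι X : Type*} [Fintype ι] [DecidableEq ι] [DecidableEq X] (r : X → Option ι)
    (lev : ι → ℕ) (Own : ι → Finset (X × X)) (F : Finset (X × X)) (p : X × X) :
    (univ.filter fun i => ¬ Even ((if r p.1 = some i then 1 else 0) +
      (if r p.2 = some i then 1 else 0) +
      (if ownC (cls r lev Own F p) = some i then 1 else 0))).card ≤ wC (cls r lev Own F p) := by
  classical
  have hsub : ∀ (s t : Finset ι) (k : ℕ), s ⊆ t → t.card ≤ k → s.card ≤ k :=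
    fun s t k h h' => (Finset.card_le_card h).trans h'
  unfold cls
  rcases h1 : r p.1 with _ | i <;> rcases h2 : r p.2 with _ | j
  · simp only
    split_ifs <;> simp [ownC, wC]
  · simp only [wC]
    refine hsub _ ∅ _ ?_ (by simp)
    intro a ha
    replace ha := (mem_filter.mp ha).2
    revert ha
    simp only [ownC, Option.some.injEq, reduceCtorEq, if_false]
    split_ifs <;> simp_all
  · simp only [wC]
    refine hsub _ ∅ _ ?_ (by simp)
    intro a ha
    replace ha := (mem_filter.mp ha).2
    revert ha
    simp only [ownC, Option.some.injEq, reduceCtorEq, if_false]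
    split_ifs <;> simp_all
  · simp only
    split_ifs with c1 c2 c3
    · simp only [wC]
      refine hsub _ {j} _ ?_ (by simp)
      intro a ha
      replace ha := (mem_filter.mp ha).2
      revert ha
      simp only [ownC, Option.some.injEq, reduceCtorEq, if_false]
      split_ifs <;> simp_all
    · simp only [wC]
      refine hsub _ {i} _ ?_ (by simp)
      intro a ha
      replace ha := (mem_filter.mp ha).2
      revert ha
      simp only [ownC, Option.some.injEq, reduceCtorEq, if_false]
      split_ifs <;> simp_all
    · simp only [wC]
      refine hsub _ ∅ _ ?_ (by simp)
      intro a ha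
      replace ha := (mem_filter.mp ha).2
      revert ha
      simp only [ownC, Option.some.injEq, reduceCtorEq, if_false]
      split_ifs <;> simp_all
    · simp only [wC]
      refine hsub _ {i, j} _ ?_ Finset.card_le_two
      intro a ha
      replace ha := (mem_filter.mp ha).2
      revert ha
      simp only [ownC, Option.some.injEq, reduceCtorEq, if_false]
      split_ifs <;> simp_all

/-- Cells on which the class function takes given values: counts. -/
lemma card_prod {X : Type*} [Fintype X] [DecidableEq X] (P Q : X → Prop) [DecidablePred P]
    [DecidablePred Q] :
    (univ.filter fun p : X × X => P p.1 ∧ Q p.2).card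
      = (univ.filter P).card * (univ.filter Q).card := by
  rw [← Finset.card_product]; congr 1; ext p; simp

lemma array_exists {ι X : Type*} [Fintype ι] [DecidableEq ι] [Fintype X] [DecidableEq X]
    (r : X → Option ι) (lev m : ι → ℕ) (u M : ℕ) (hm : ∀ i, 1 ≤ m i) (hM : ∑ i, m i = M)
    (hr : ∀ i, (univ.filter fun x => r x = some i).card = m i)
    (hr0 : (univ.filter fun x => r x = none).card = M)
    (hlev : ∀ i, M * (m i - 1) ≤ m i * ∑ j with lev j < lev i, m j)
    (hu : 2 * M * Fintype.card ι ≤ M * M + ∑ i, m i * m i + 2 * M * u)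
    (hu2 : 2 * u + M + 3 < 2 * Fintype.card ι) :
    ∃ Own F, ∀ c, (univ.filter fun p => cls r lev Own F p = c).card
      = (2 * M) * sizeC m u (Fintype.card ι - u) c := by
  classical
  -- basic counts
  have hX : Fintype.card X = 2 * M := by
    have := Finset.card_eq_sum_card_fiberwise (s := (univ : Finset X)) (f := r)
      (t := univ) (fun _ _ => by simp)
    rw [Fintype.sum_option, hr0] at this
    simp only [hr, hM, Finset.card_univ] at this
    omega
  have hk : Fintype.card ι ≤ M := by
    rw [← hM, ← Finset.card_univ, Finset.card_eq_sum_ones]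
    exact Finset.sum_le_sum fun i _ => hm i
  have hlow : ∀ i, (univ.filter fun x => ∃ j, r x = some j ∧ lev j < lev i).card
      = ∑ j with lev j < lev i, m j := by
    intro i
    have : (univ.filter fun x => ∃ j, r x = some j ∧ lev j < lev i)
        = (univ.filter fun j => lev j < lev i).biUnion
          (fun j => univ.filter fun x => r x = some j) := by
      ext x; simp [and_comm]
    rw [this, Finset.card_biUnion]
    · simp [hr]
    · intro a _ b _ hab
      rw [Function.onFun, Finset.disjoint_left]
      intro x hx hx'
      simp only [mem_filter, mem_univ, true_and] at hx hx'
      exact hab (Option.some.inj (hx.symm.trans hx'))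
  -- owned cells
  have hOwn : ∀ i, ∃ O : Finset (X × X), (∀ p ∈ O,
      (r p.1 = some i ∧ ∃ j, r p.2 = some j ∧ lev j < lev i) ∨
      ((∃ j, r p.1 = some j ∧ lev j < lev i) ∧ r p.2 = some i)) ∧
      O.card = 2 * M * (m i - 1) := by
    intro i
    have hc : 2 * M * (m i - 1) ≤
        ((univ.filter fun p : X × X => r p.1 = some i ∧ ∃ j, r p.2 = some j ∧ lev j < lev i) ∪
        (univ.filter fun p : X × X =>
          (∃ j, r p.1 = some j ∧ lev j < lev i) ∧ r p.2 = some i)).card := by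
      rw [Finset.card_union_of_disjoint]
      · rw [card_prod (fun x => r x = some i) (fun x => ∃ j, r x = some j ∧ lev j < lev i),
          card_prod (fun x => ∃ j, r x = some j ∧ lev j < lev i) (fun x => r x = some i),
          hr, hlow]
        have := hlev i
        nlinarith
      · rw [Finset.disjoint_left]
        intro p hp hp'
        simp only [mem_filter, mem_univ, true_and] at hp hp'
        obtain ⟨h1, -⟩ := hp
        obtain ⟨⟨j, h2, h3⟩, -⟩ := hp'
        rw [h1] at h2
        cases h2
        exact lt_irrefl _ h3
    obtain ⟨O, hO, hO2⟩ := Finset.exists_subset_card_eq hc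
    refine ⟨O, fun p hp => ?_, hO2⟩
    have := hO hp
    simpa only [mem_union, mem_filter, mem_univ, true_and] using this
  choose Own hOwn hOwnc using hOwn
  have hfibN : ∀ F i, (univ.filter fun p => cls r lev Own F p = Sum.inl i).card = 2 * M * m i := by
    intro F i
    have : (univ.filter fun p => cls r lev Own F p = Sum.inl i) =
        (univ.filter fun p : X × X => r p.1 = some i ∧ r p.2 = none) ∪
        (univ.filter fun p : X × X => r p.1 = none ∧ r p.2 = some i) := by
      ext p
      simp only [mem_union, mem_filter, mem_univ, true_and]
      unfold cls
      rcases h1 : r p.1 with _ | a <;> rcases h2 : r p.2 with _ | b <;> simp only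
      · split_ifs <;> simp
      · simp
      · simp
      · split_ifs <;> simp
    rw [this, Finset.card_union_of_disjoint,
      card_prod (fun x => r x = some i) (fun x => r x = none),
      card_prod (fun x => r x = none) (fun x => r x = some i), hr, hr0]
    · ring
    · rw [Finset.disjoint_left]
      intro p hp hp'
      simp only [mem_filter, mem_univ, true_and] at hp hp'
      rw [hp.1] at hp'
      simp at hp'
  have hfibO : ∀ F i, (univ.filter fun p => cls r lev Own F p = Sum.inr (Sum.inl i)).card
      = 2 * M * (m i - 1) := by
    intro F i
    rw [← hOwnc i]
    congr 1
    ext p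
    simp only [mem_filter, mem_univ, true_and]
    unfold cls
    constructor
    · rcases h1 : r p.1 with _ | a <;> rcases h2 : r p.2 with _ | b <;> simp only
      · split_ifs <;> simp
      · simp
      · simp
      · split_ifs with c1 c2 c3
        · intro h; simp only [Sum.inr.injEq, Sum.inl.injEq] at h; subst h; exact c1.2
        · intro h; simp only [Sum.inr.injEq, Sum.inl.injEq] at h; subst h; exact c2.2
        · simp
        · simp
    · intro hp
      rcases hOwn i p hp with ⟨h1, j, h2, h3⟩ | ⟨⟨j, h1, h3⟩, h2⟩
      · simp [h1, h2, h3, hp]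
      · have : ¬ lev i < lev j := by omega
        simp [h1, h2, h3, hp, this]
  -- the unowned cross cells
  set UC := univ.filter fun p => cls r lev Own ∅ p = Sum.inr (Sum.inr true) with hUC
  have htot : ∀ F, ∑ c, (univ.filter fun p => cls r lev Own F p = c).card
      = (2 * M) * (2 * M) := by
    intro F
    have := Finset.card_eq_sum_card_fiberwise (s := (univ : Finset (X × X)))
      (f := cls r lev Own F) (t := univ) (fun _ _ => by simp)
    rw [← this, Finset.card_univ, Fintype.card_prod, hX]
  have hsum1 : ∑ i, (m i - 1) + Fintype.card ι = M := by
    rw [← hM, ← Finset.card_univ, Finset.card_eq_sum_ones, ← Finset.sum_add_distrib]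
    exact Finset.sum_congr rfl fun i _ => Nat.sub_add_cancel (hm i)
  have htot2 : ∀ F, 2 * M * M + (2 * M * (M - Fintype.card ι) +
      ((univ.filter fun p => cls r lev Own F p = Sum.inr (Sum.inr true)).card +
      (univ.filter fun p => cls r lev Own F p = Sum.inr (Sum.inr false)).card))
      = (2 * M) * (2 * M) := by
    intro F
    have := htot F
    rw [Fintype.sum_sum_type, Fintype.sum_sum_type, Fintype.sum_bool] at this
    simp only [hfibN, hfibO] at this
    rw [← Finset.mul_sum, ← Finset.mul_sum, hM] at this
    rw [← this, ← hsum1]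
    simp
  have hZ : (univ.filter fun p : X × X => r p.1 = none ∧ r p.2 = none).card = M * M := by
    rw [card_prod (fun x => r x = none) (fun x => r x = none), hr0]
  have hG0 : M * M + ∑ i, m i * m i ≤
      (univ.filter fun p => cls r lev Own ∅ p = Sum.inr (Sum.inr false)).card := by
    have hd : ∑ i, m i * m i =
        (univ.biUnion fun i => univ.filter fun p : X × X => r p.1 = some i ∧ r p.2 = some i).card := by
      rw [Finset.card_biUnion]
      · refine Finset.sum_congr rfl fun i _ => ?_
        rw [card_prod (fun x => r x = some i) (fun x => r x = some i), hr]
      · intro a _ b _ hab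
        rw [Function.onFun, Finset.disjoint_left]
        intro x hx hx'
        simp only [mem_filter, mem_univ, true_and] at hx hx'
        exact hab (Option.some.inj (hx.1.symm.trans hx'.1))
    rw [hd, ← hZ, ← Finset.card_union_of_disjoint]
    · apply Finset.card_le_card
      intro p
      simp only [mem_union, mem_filter, mem_univ, true_and, mem_biUnion]
      rintro (⟨h1, h2⟩ | ⟨i, h1, h2⟩)
      · simp [cls, h1, h2]
      · simp [cls, h1, h2]
    · rw [Finset.disjoint_left]
      intro p hp hp'
      simp only [mem_filter, mem_univ, true_and, mem_biUnion] at hp hp'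
      obtain ⟨i, hi, -⟩ := hp'
      rw [hp.1] at hi
      simp at hi
  have hUle : UC.card ≤ 2 * M * u := by
    have h := htot2 ∅
    rw [← hUC] at h
    obtain ⟨d, hd⟩ := Nat.exists_eq_add_of_le hk
    have : M - Fintype.card ι = d := by omega
    rw [this] at h
    nlinarith
  have hF : 2 * M * u - UC.card ≤
      (univ.filter fun p : X × X => r p.1 = none ∧ r p.2 = none).card := by
    rw [hZ]
    have : 2 * u ≤ M := by omega
    have : 2 * M * u ≤ M * M := by nlinarith
    omega
  obtain ⟨F, hFs, hFc⟩ := Finset.exists_subset_card_eq hF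
  have hFmem : ∀ p ∈ F, r p.1 = none ∧ r p.2 = none := fun p hp => by
    simpa only [mem_filter, mem_univ, true_and] using hFs hp
  have hfibU : (univ.filter fun p => cls r lev Own F p = Sum.inr (Sum.inr true)).card
      = 2 * M * u := by
    have : (univ.filter fun p => cls r lev Own F p = Sum.inr (Sum.inr true)) = UC ∪ F := by
      ext p
      simp only [hUC, mem_union, mem_filter, mem_univ, true_and]
      have := hFmem p
      unfold cls
      rcases h1 : r p.1 with _ | a <;> rcases h2 : r p.2 with _ | b <;> simp_all
    rw [this, Finset.card_union_of_disjoint, hFc]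
    · omega
    · rw [Finset.disjoint_left]
      intro p hp hp'
      obtain ⟨h1, h2⟩ := hFmem p hp'
      simp [hUC, cls, h1, h2] at hp
  refine ⟨Own, F, ?_⟩
  rintro (i | i | b)
  · exact hfibN F i
  · exact hfibO F i
  · cases b
    · have h := htot2 F
      rw [hfibU] at h
      simp only [sizeC]
      obtain ⟨d, hd⟩ := Nat.exists_eq_add_of_le hk
      have h1 : M - Fintype.card ι = d := by omega
      obtain ⟨e, he⟩ := Nat.exists_eq_add_of_le (show u ≤ Fintype.card ι by omega)
      have h2 : Fintype.card ι - u = e := by omega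
      rw [h1] at h
      rw [h2]
      have : 2 * M * (2 * M) = 2 * M * M + 2 * M * d + 2 * M * u + 2 * M * e := by
        have : 2 * M = M + d + u + e := by omega
        calc 2 * M * (2 * M) = 2 * M * (M + d + u + e) := by rw [← this]
          _ = _ := by ring
      omega
    · exact hfibU

lemma sum_sizes {C : Type*} [Fintype C] (size f : C → ℕ) :
    ∑ y : (Σ c, Fin (size c)), f y.1 = ∑ c, size c * f c := by
  rw [Fintype.sum_sigma]; simp

lemma main {ι X : Type*} [Fintype ι] [DecidableEq ι] [Fintype X] [DecidableEq X]
    (r : X → Option ι) (lev m : ι → ℕ) (u M : ℕ) (hm : ∀ i, 1 ≤ m i) (hM : ∑ i, m i = M)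
    (hr : ∀ i, (univ.filter fun x => r x = some i).card = m i)
    (hr0 : (univ.filter fun x => r x = none).card = M)
    (hX : Fintype.card X = 2 * M)
    (hlev : ∀ i, M * (m i - 1) ≤ m i * ∑ j with lev j < lev i, m j)
    (hu : 2 * M * Fintype.card ι ≤ M * M + ∑ i, m i * m i + 2 * M * u)
    (hu2 : 2 * u + M + 3 < 2 * Fintype.card ι) :
    ∃ S : X × X → (Σ c, Fin (sizeC m u (Fintype.card ι - u) c)),
      Fintype.card (Σ c, Fin (sizeC m u (Fintype.card ι - u) c)) = 2 * M ∧
      (∀ s, (univ.filter fun p => S p = s).card = 2 * M) ∧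
      ∀ T : Finset (X × X),
        (∀ p ∈ T, ∀ q ∈ T, p ≠ q → p.1 ≠ q.1 ∧ p.2 ≠ q.2 ∧ S p ≠ S q) →
        T.card + 1 = 2 * M → False := by
  classical
  obtain ⟨Own, F, h⟩ := array_exists r lev m u M hm hM hr hr0 hlev hu hu2
  obtain ⟨S, hS, hSc⟩ := fill _ _ _ h
  have hsum1 : ∑ i, (m i - 1) + Fintype.card ι = M := by
    rw [← hM, ← Finset.card_univ, Finset.card_eq_sum_ones, ← Finset.sum_add_distrib]
    exact Finset.sum_congr rfl fun i _ => Nat.sub_add_cancel (hm i)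
  have hY : Fintype.card (Σ c, Fin (sizeC m u (Fintype.card ι - u) c)) = 2 * M := by
    rw [Fintype.card_sigma, Fintype.sum_sum_type, Fintype.sum_sum_type, Fintype.sum_bool]
    simp only [Fintype.card_fin]
    simp only [sizeC, hM]
    omega
  refine ⟨S, hY, hSc, fun T hT hTc => ?_⟩
  refine parity r (fun y => ownC y.1) (fun y => wC y.1) S
    (fun p => univ.filter fun i => ¬ Even ((if r p.1 = some i then 1 else 0) +
      (if r p.2 = some i then 1 else 0) +
      (if ownC (S p).1 = some i then 1 else 0))) ?_ ?_ ?_ ?_ (hX.trans hY.symm) T hT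
      (hTc.trans hX.symm)
  · intro p
    simp only [hS]
    exact break_card r lev Own F p
  · intro p i hi
    simpa only [mem_filter, mem_univ, true_and, not_not] using hi
  · intro i
    have : (∑ y : (Σ c, Fin (sizeC m u (Fintype.card ι - u) c)),
        if ownC y.1 = some i then 1 else 0) = m i + (m i - 1) := by
      rw [sum_sizes _ (fun c => if ownC c = some i then 1 else 0),
        Fintype.sum_sum_type, Fintype.sum_sum_type, Fintype.sum_bool]
      simp [ownC, sizeC]
    rw [this]
    have := hm i
    exact ⟨m i - 1, by omega⟩
  · have : (∑ y : (Σ c, Fin (sizeC m u (Fintype.card ι - u) c)), wC y.1)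
        = ∑ i, (m i - 1) + 2 * u := by
      rw [Fintype.sum_sigma, Fintype.sum_sum_type, Fintype.sum_sum_type, Fintype.sum_bool]
      simp only [sum_const, card_univ, Fintype.card_fin]
      simp [wC, sizeC, mul_comm]
    rw [this]
    omega

/-- Index set of types: `4 ^ (7 - t)` types on level `t`. -/
abbrev Idx : Type := Σ t : Fin 8, Fin (4 ^ (7 - t.val))

/-- Size of a type. -/
def mul (i : Idx) : ℕ := 2 ^ i.1.val

/-- Rows and columns. -/
abbrev Line (N : ℕ) : Type := (Σ i : Idx, Fin (mul i)) ⊕ Fin N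

/-- Type of a line. -/
def lineType {N : ℕ} : Line N → Option Idx
  | Sum.inl x => some x.1
  | Sum.inr _ => none

lemma sum_mul : ∑ i, mul i = 32640 := by
  rw [Fintype.sum_sigma]
  simp [mul, Fin.sum_univ_eight]

lemma sum_mul_sq : ∑ i, mul i * mul i = 131072 := by
  rw [Fintype.sum_sigma]
  simp [mul, Fin.sum_univ_eight]

lemma card_idx : Fintype.card Idx = 21845 := by
  rw [Fintype.card_sigma]
  simp [Fin.sum_univ_eight]

lemma sum_lower (i : Idx) : ∑ j : Idx with j.1.val < i.1.val, mul j
    = ∑ t : Fin 8, if t.val < i.1.val then 4 ^ (7 - t.val) * 2 ^ t.val else 0 := by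
  rw [Finset.sum_filter, Fintype.sum_sigma]
  refine Finset.sum_congr rfl fun t _ => ?_
  simp only [mul]
  split_ifs <;> simp

lemma level_num : ∀ t : Fin 8, 32640 * (2 ^ t.val - 1) ≤ 2 ^ t.val *
    ∑ x : Fin 8, if x.val < t.val then 4 ^ (7 - x.val) * 2 ^ x.val else 0 := by
  intro t
  rw [Fin.sum_univ_eight]
  fin_cases t <;> simp

lemma level_ok (i : Idx) :
    32640 * (mul i - 1) ≤ mul i * ∑ j : Idx with j.1.val < i.1.val, mul j := by
  rw [sum_lower]
  exact level_num i.1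

lemma card_lineType (N : ℕ) (i : Idx) : (univ.filter fun x : Line N => lineType x = some i).card = mul i := by
  rw [Finset.card_filter, Fintype.sum_sum_type, Fintype.sum_sigma]
  simp [lineType]

lemma card_lineType_none (N : ℕ) : (univ.filter fun x : Line N => lineType x = none).card = N := by
  rw [Finset.card_filter, Fintype.sum_sum_type, Fintype.sum_sigma]
  simp [lineType]

lemma card_line (N : ℕ) (hN : N = 32640) : Fintype.card (Line N) = 2 * N := by
  rw [Fintype.card_sum, Fintype.card_sigma]
  simp only [Fintype.card_fin, sum_mul]
  omega

end SteinAux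

set_option linter.constructorNameAsVariable false

/-- There exists a positive integer `n` and an `n × n` array filled with the symbols
`1, …, n` (modelled as `Fin n`), each symbol occurring exactly `n` times, which has no partial
transversal of size `n - 1`. -/
theorem stein_conjecture_false :
    ∃ n : ℕ, 0 < n ∧
      ∃ S : Fin n → Fin n → Fin n,
        (∀ s : Fin n,
          (Finset.univ.filter (fun p : Fin n × Fin n => S p.1 p.2 = s)).card = n) ∧
        ¬ ∃ T : Finset (Fin n × Fin n),
            (∀ p ∈ T, ∀ q ∈ T, p ≠ q → p.1 ≠ q.1 ∧ p.2 ≠ q.2 ∧ S p.1 p.2 ≠ S q.1 q.2) ∧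
            T.card = n - 1 := by
  classical
  obtain ⟨N, hN⟩ : ∃ N : ℕ, N = 32640 := ⟨_, rfl⟩
  obtain ⟨u, hu⟩ : ∃ u : ℕ, u = 5523 := ⟨_, rfl⟩
  obtain ⟨S, hY, hS, hT⟩ := SteinAux.main (SteinAux.lineType (N := N)) (fun i => i.1.val)
    SteinAux.mul u N (fun i => Nat.one_le_two_pow) (SteinAux.sum_mul.trans hN.symm)
    (SteinAux.card_lineType N) (SteinAux.card_lineType_none N) (SteinAux.card_line N hN)
    (by rw [hN]; exact SteinAux.level_ok)
    (by rw [SteinAux.card_idx, SteinAux.sum_mul_sq, hN, hu]; norm_num)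
    (by rw [SteinAux.card_idx, hN, hu]; norm_num)
  have hn : 0 < 2 * N := by omega
  have hX := SteinAux.card_line N hN
  generalize 2 * N = n at *
  have eX := Fintype.equivFinOfCardEq hX
  have eY := Fintype.equivFinOfCardEq hY
  refine ⟨n, hn, fun a b => eY (S (eX.symm a, eX.symm b)), ?_, ?_⟩
  · intro s
    refine (Finset.card_bij' (fun p _ => (eX.symm p.1, eX.symm p.2))
      (fun p _ => (eX p.1, eX p.2)) ?_ ?_ ?_ ?_).trans (hS (eY.symm s))
    · intro p hp
      simp only [Finset.mem_filter, Finset.mem_univ, true_and] at hp ⊢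
      rw [← hp]; simp
    · intro p hp
      simp only [Finset.mem_filter, Finset.mem_univ, true_and] at hp ⊢
      simp [hp]
    · intro p hp; simp
    · intro p hp; simp
  · rintro ⟨T, h1, h2⟩
    refine hT (T.map (Equiv.prodCongr eX.symm eX.symm).toEmbedding) ?_ ?_
    · intro p hp q hq hpq
      rw [Finset.mem_map] at hp hq
      obtain ⟨p, hp, rfl⟩ := hp
      obtain ⟨q, hq, rfl⟩ := hq
      have hne : p ≠ q := fun h => hpq (by rw [h])
      obtain ⟨g1, g2, g3⟩ := h1 p hp q hq hne
      refine ⟨fun h => g1 (eX.symm.injective h), fun h => g2 (eX.symm.injective h), fun h => g3 ?_⟩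
      exact congrArg eY h
    · rw [Finset.card_map, h2]; omega
end

section
/- For all sufficiently large n, there exists an n×n array filled with symbols (from some set of symbols) in which every symbol occurs at most n − (1/85)·ln n times, and which has no transversal of size n. (Hence the Erdős–Spencer theorem cannot be strengthened from the bound (n−1)/16 occurrences of each symbol to n − (1/85)·ln n occurrences.) -/
open Finset

/-- Distribute the elements of `C` greedily into groups of size `m`. -/
lemma es_assign {β : Type*} [DecidableEq β] (C : Finset β) (m : ℕ) (hm : 0 < m) :
    ∃ f : β → ℕ, (∀ s, #{x ∈ C | f x = s} ≤ m) ∧ ∀ q, #{x ∈ C | q ≤ f x} ≤ #C - q * m := by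
  classical
  let idx : β → ℕ := fun x => if h : x ∈ C then (C.equivFin ⟨x, h⟩ : ℕ) else 0
  have hinj : ∀ x ∈ C, ∀ y ∈ C, idx x = idx y → x = y := by
    intro x hx y hy h
    simp only [idx, hx, hy, dif_pos] at h
    have := C.equivFin.injective (Fin.ext h)
    simpa using this
  have hlt : ∀ x ∈ C, idx x < #C := by
    intro x hx
    simp only [idx, hx, dif_pos]
    exact Fin.is_lt _
  refine ⟨fun x => idx x / m, ?_, ?_⟩
  · intro s
    have h1 : #{x ∈ C | idx x / m = s} ≤ #(Finset.Ico (s * m) (s * m + m)) := by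
      apply Finset.card_le_card_of_injOn idx
      · intro x hx
        simp only [coe_filter, Set.mem_ofPred_eq] at hx
        obtain ⟨-, hx⟩ := hx
        have := Nat.div_add_mod (idx x) m
        have h2 := Nat.mod_lt (idx x) hm
        rw [hx, mul_comm] at this
        simp only [coe_Ico, Set.mem_Ico]
        omega
      · intro x hx y hy h
        simp only [coe_filter, Set.mem_ofPred_eq] at hx hy
        exact hinj x hx.1 y hy.1 h
    simpa using h1
  · intro q
    have h1 : #{x ∈ C | q ≤ idx x / m} ≤ #(Finset.Ico (q * m) (#C)) := by
      apply Finset.card_le_card_of_injOn idx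
      · intro x hx
        simp only [coe_filter, Set.mem_ofPred_eq] at hx
        simp only [coe_Ico, Set.mem_Ico]
        exact ⟨(Nat.le_div_iff_mul_le hm).1 hx.2, hlt x hx.1⟩
      · intro x hx y hy h
        simp only [coe_filter, Set.mem_ofPred_eq] at hx hy
        exact hinj x hx.1 y hy.1 h
    simpa using h1

lemma es_proj {n : ℕ} {γ : Type*} (T : Finset γ) (f : γ → Fin n)
    (hf : ∀ p ∈ T, ∀ q ∈ T, f p = f q → p = q) (hT : #T = n) (P : Fin n → Prop)
    [DecidablePred P] : #{p ∈ T | P (f p)} = #{r : Fin n | P r} := by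
  classical
  have himg : T.image f = univ := by
    apply Finset.eq_univ_of_card
    rw [Finset.card_image_of_injOn (fun p hp q hq h => hf p hp q hq h), hT, Fintype.card_fin]
  have : ({r : Fin n | P r} : Finset (Fin n)) = ({p ∈ T | P (f p)} : Finset γ).image f := by
    rw [← himg, Finset.filter_image]
  rw [this, Finset.card_image_of_injOn]
  intro p hp q hq h
  simp only [coe_filter, Set.mem_ofPred_eq] at hp hq
  exact hf p hp.1 q hq.1 h

/-- The parity obstruction. -/
lemma es_noTrans {n k : ℕ} {α : Type*} [DecidableEq α] (U : Finset α)
    (S : Fin n → Fin n → α) (hS : ∀ r c, S r c ∈ U) (blk : Fin n → Option (Fin k))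
    (g : α) (A : Fin k → Finset α) (hAU : ∀ i, A i ⊆ U) (hodd : ∀ i, Odd #(A i))
    (h1 : ∀ i r c, ¬(blk r = some i ↔ blk c = some i) → S r c ∈ A i ∨ S r c = g)
    (h2 : ∀ i r c, S r c ∈ A i → ¬(blk r = some i ↔ blk c = some i))
    (h3 : ∀ s, #{i | s ∈ A i} ≤ 2) (K : ℕ) (hU : #U ≤ n + K) (hk : 2 * K + 2 < k) :
    ¬ ∃ T : Finset (Fin n × Fin n),
      (∀ p ∈ T, ∀ q ∈ T, p ≠ q → p.1 ≠ q.1 ∧ p.2 ≠ q.2 ∧ S p.1 p.2 ≠ S q.1 q.2) ∧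
            T.card = n := by
  classical
  rintro ⟨T, hT, hcard⟩
  have i1 : ∀ p ∈ T, ∀ q ∈ T, p.1 = q.1 → p = q := fun p hp q hq h => by
    by_contra hne; exact (hT p hp q hq hne).1 h
  have i2 : ∀ p ∈ T, ∀ q ∈ T, p.2 = q.2 → p = q := fun p hp q hq h => by
    by_contra hne; exact (hT p hp q hq hne).2.1 h
  have i3 : ∀ p ∈ T, ∀ q ∈ T, S p.1 p.2 = S q.1 q.2 → p = q := fun p hp q hq h => by
    by_contra hne; exact (hT p hp q hq hne).2.2 h
  let F : Fin n × Fin n → α := fun p => S p.1 p.2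
  let I := T.image F
  have hI : #I = n := by
    rw [← hcard]; exact Finset.card_image_of_injOn (fun p hp q hq h => i3 p hp q hq h)
  have hIU : I ⊆ U := by
    intro x hx
    obtain ⟨p, -, rfl⟩ := Finset.mem_image.1 hx
    exact hS _ _
  have hUI : #(U \ I) ≤ K := by
    rw [Finset.card_sdiff_of_subset hIU, hI]; omega
  let G : Finset (Fin k) := {i | ∃ p ∈ T, F p = g ∧ ¬(blk p.1 = some i ↔ blk p.2 = some i)}
  have hG : #G ≤ 2 := by
    by_cases h : ∃ p ∈ T, F p = g
    · obtain ⟨p, hp, hpg⟩ := h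
      have hsub : G ⊆ ({i | blk p.1 = some i} : Finset (Fin k)) ∪
          ({i | blk p.2 = some i} : Finset (Fin k)) := by
        intro i hi
        simp only [G, mem_filter, mem_univ, true_and] at hi
        obtain ⟨q, hq, hqg, hx⟩ := hi
        have : q = p := i3 q hq p hp (hqg.trans hpg.symm)
        subst this
        simp only [mem_union, mem_filter, mem_univ, true_and]
        tauto
      have c1 : ∀ o : Option (Fin k), #{i | o = some i} ≤ 1 := by
        intro o
        apply Finset.card_le_one.2
        intro a ha b hb
        simp only [mem_filter, mem_univ, true_and] at ha hb
        rw [ha] at hb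
        simpa using hb
      calc #G ≤ _ := Finset.card_le_card hsub
        _ ≤ _ := Finset.card_union_le _ _
        _ ≤ 1 + 1 := add_le_add (c1 _) (c1 _)
    · have : G = ∅ := by
        apply Finset.filter_eq_empty_iff.2
        rintro i - ⟨p, hp, hpg, -⟩
        exact h ⟨p, hp, hpg⟩
      simp [this]
  have hcov : (univ : Finset (Fin k)) ⊆
      (U \ I).biUnion (fun s => ({i | s ∈ A i} : Finset (Fin k))) ∪ G := by
    intro i _
    by_contra hcon
    simp only [mem_union, mem_biUnion, mem_filter, mem_univ, true_and, not_or, G, mem_sdiff,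
      not_exists, not_and] at hcon
    obtain ⟨hc1, hc2⟩ := hcon
    have hAI : A i ⊆ I := by
      intro s hs
      by_contra hsI
      exact hc1 s ⟨hAU i hs, hsI⟩ hs
    let X : Finset (Fin n × Fin n) := {p ∈ T | ¬(blk p.1 = some i ↔ blk p.2 = some i)}
    have hX : X.image F = A i := by
      ext s
      simp only [X, mem_image, mem_filter]
      constructor
      · rintro ⟨p, ⟨hp, hx⟩, rfl⟩
        rcases h1 i _ _ hx with h | h
        · exact h
        · exact absurd hx (hc2 p hp h)
      · intro hs
        obtain ⟨p, hp, rfl⟩ := Finset.mem_image.1 (hAI hs)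
        exact ⟨p, ⟨hp, h2 i _ _ hs⟩, rfl⟩
    have hXc : #X = #(A i) := by
      rw [← hX, Finset.card_image_of_injOn]
      intro p hp q hq h
      simp only [X, coe_filter, Set.mem_ofPred_eq] at hp hq
      exact i3 p hp.1 q hq.1 h
    have e1 := es_proj T Prod.fst i1 hcard (fun r => blk r = some i)
    have e2 := es_proj T Prod.snd i2 hcard (fun r => blk r = some i)
    have s1 := Finset.card_filter_add_card_filter_not (s := ({p ∈ T | blk p.1 = some i} : Finset _))
      (fun p => blk p.2 = some i)
    have s2 := Finset.card_filter_add_card_filter_not (s := ({p ∈ T | blk p.2 = some i} : Finset _))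
      (fun p => blk p.1 = some i)
    have s3 := Finset.card_filter_add_card_filter_not (s := X) (fun p => blk p.1 = some i)
    simp only [X, Finset.filter_filter] at s1 s2 s3
    have q1 : ({p ∈ T | ¬(blk p.1 = some i ↔ blk p.2 = some i) ∧ blk p.1 = some i} : Finset _)
        = {p ∈ T | blk p.1 = some i ∧ ¬ blk p.2 = some i} :=
      Finset.filter_congr (fun p _ => by tauto)
    have q2 : ({p ∈ T | ¬(blk p.1 = some i ↔ blk p.2 = some i) ∧ ¬ blk p.1 = some i} : Finset _)
        = {p ∈ T | blk p.2 = some i ∧ ¬ blk p.1 = some i} :=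
      Finset.filter_congr (fun p _ => by tauto)
    have q3 : ({p ∈ T | blk p.2 = some i ∧ blk p.1 = some i} : Finset _)
        = {p ∈ T | blk p.1 = some i ∧ blk p.2 = some i} :=
      Finset.filter_congr (fun p _ => by tauto)
    rw [q1, q2] at s3
    rw [q3] at s2
    have := hodd i
    rw [← hXc] at this
    obtain ⟨z, hz⟩ := this
    simp only [X] at hz
    omega
  have := Finset.card_le_card hcov
  rw [Finset.card_univ, Fintype.card_fin] at this
  have hb : #((U \ I).biUnion (fun s => ({i | s ∈ A i} : Finset (Fin k)))) ≤ #(U \ I) * 2 :=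
    Finset.card_biUnion_le_card_mul _ _ _ (fun s _ => h3 s)
  have := Finset.card_union_le ((U \ I).biUnion (fun s => ({i | s ∈ A i} : Finset (Fin k)))) G
  omega

/-- Symbols: pair symbols, cross symbols, the garbage symbol, and diagonal symbols. -/
abbrev EsSym (k : ℕ) : Type := Sym2 (Fin k) ⊕ ((Fin k × ℕ) ⊕ Option ℕ)

/-- The array. -/
def esArr {n k : ℕ} (blk : Fin n → Option (Fin k)) (w : ℕ) (f : Fin k → Fin n × Fin n → ℕ)
    (d : Fin n × Fin n → ℕ) (r c : Fin n) : EsSym k :=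
  match blk r, blk c with
  | some a, some b => if a = b then Sum.inr (Sum.inr (some (d (r, c)))) else Sum.inl s(a, b)
  | some a, none =>
      if f a (r, c) < w then Sum.inr (Sum.inl (a, f a (r, c))) else Sum.inr (Sum.inr none)
  | none, some a =>
      if f a (r, c) < w then Sum.inr (Sum.inl (a, f a (r, c))) else Sum.inr (Sum.inr none)
  | none, none => Sum.inr (Sum.inr (some (d (r, c))))

lemma es_blocks (n k v r : ℕ) (h : n = k * v + r) :
    ∃ blk : Fin n → Option (Fin k), (∀ i, #{x | blk x = some i} = v) ∧ #{x | blk x = none} = r := by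
  classical
  have hc : Fintype.card (Fin n) = Fintype.card ((Fin k × Fin v) ⊕ Fin r) := by simp [h]
  let e := Fintype.equivOfCardEq hc
  refine ⟨fun x => Sum.elim (fun y => some y.1) (fun _ => none) (e x), ?_, ?_⟩
  · intro i
    have : ({x | Sum.elim (fun y : Fin k × Fin v => some y.1) (fun _ : Fin r => none) (e x) = some i} :
        Finset (Fin n)) = (univ : Finset (Fin v)).image (fun j => e.symm (Sum.inl (i, j))) := by
      ext x
      simp only [mem_filter, mem_univ, true_and, mem_image]
      rw [← e.symm_apply_apply x]
      rcases e x with ⟨a, b⟩ | z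
      · simp [eq_comm]
      · simp
    rw [this, Finset.card_image_of_injective]
    · simp
    · intro a b hab
      simpa using hab
  · have : ({x | Sum.elim (fun y : Fin k × Fin v => some y.1) (fun _ : Fin r => none) (e x) = none} :
        Finset (Fin n)) = (univ : Finset (Fin r)).image (fun j => e.symm (Sum.inr j)) := by
      ext x
      simp only [mem_filter, mem_univ, true_and, mem_image]
      rw [← e.symm_apply_apply x]
      rcases e x with ⟨a, b⟩ | z
      · simp
      · simp
    rw [this, Finset.card_image_of_injective]
    · simp
    · intro a b hab
      simpa using hab

lemma es_prod_card {n : ℕ} {γ : Type*} [DecidableEq γ] (blk : Fin n → γ) (a b : γ) :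
    #{p : Fin n × Fin n | blk p.1 = a ∧ blk p.2 = b} = #{x | blk x = a} * #{x | blk x = b} := by
  rw [← Finset.card_product]
  congr 1
  ext p
  simp

lemma es_construct (n k v r w D m K : ℕ) (hn : n = k * v + r) (hm : 0 < m)
    (hk : 2 * K + 2 < k) (hwk : w + k = 2 * v) (hpair : 2 * v ^ 2 ≤ m)
    (hgarb : k * (2 * (v * r) - w * m) ≤ m)
    (hdiag : k * v ^ 2 + r ^ 2 ≤ D * m)
    (hcount : k.choose 2 + k * w + 1 + D ≤ n + K) :
    ∃ S : Fin n → Fin n → ℕ,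
      (∀ s : ℕ, #{p : Fin n × Fin n | S p.1 p.2 = s} ≤ m) ∧
      ¬ ∃ T : Finset (Fin n × Fin n),
        (∀ p ∈ T, ∀ q ∈ T, p ≠ q → p.1 ≠ q.1 ∧ p.2 ≠ q.2 ∧ S p.1 p.2 ≠ S q.1 q.2) ∧
            T.card = n := by
  classical
  obtain ⟨blk, hb1, hb2⟩ := es_blocks n k v r hn
  let C : Fin k → Finset (Fin n × Fin n) := fun i =>
    ({p | blk p.1 = some i ∧ blk p.2 = none} : Finset _) ∪
    ({p | blk p.1 = none ∧ blk p.2 = some i} : Finset _)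
  have hC : ∀ i, #(C i) ≤ 2 * (v * r) := by
    intro i
    refine (Finset.card_union_le _ _).trans ?_
    rw [es_prod_card, es_prod_card, hb1, hb2]
    linarith [mul_comm r v]
  let Dg : Finset (Fin n × Fin n) := {p | blk p.1 = blk p.2}
  have hDg : #Dg ≤ k * v ^ 2 + r ^ 2 := by
    have hsub : Dg ⊆ (univ : Finset (Option (Fin k))).biUnion
        (fun o => ({p | blk p.1 = o ∧ blk p.2 = o} : Finset (Fin n × Fin n))) := by
      intro p hp
      simp only [Dg, mem_filter, mem_univ, true_and] at hp
      simp [hp]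
    refine (Finset.card_le_card hsub).trans (Finset.card_biUnion_le.trans ?_)
    simp only [es_prod_card]
    rw [Fintype.sum_option, hb2]
    simp only [hb1, sum_const, card_univ, Fintype.card_fin, smul_eq_mul]
    apply le_of_eq; ring
  choose f hf1 hf2 using fun i => es_assign (C i) m hm
  obtain ⟨d, hd1, hd2⟩ := es_assign Dg m hm
  have hdlt : ∀ p ∈ Dg, d p < D := by
    intro p hp
    by_contra hcon
    push Not at hcon
    have := hd2 D
    have h0 : #Dg - D * m = 0 := by omega
    rw [h0] at this
    have : p ∈ ({x ∈ Dg | D ≤ d x} : Finset _) := by simp [hp, hcon]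
    have := Finset.card_pos.2 ⟨p, this⟩
    omega
  let S := esArr blk w f d
  let A : Fin k → Finset (EsSym k) := fun i =>
    (univ.erase i).image (fun j => Sum.inl s(i, j)) ∪
    (Finset.range w).image (fun a => Sum.inr (Sum.inl (i, a)))
  let U : Finset (EsSym k) :=
    ((((univ : Finset (Fin k)).offDiag.image (fun p => s(p.1, p.2))).image Sum.inl ∪
    ((univ : Finset (Fin k)) ×ˢ Finset.range w).image (fun q => Sum.inr (Sum.inl q))) ∪
    {Sum.inr (Sum.inr none)}) ∪ (Finset.range D).image (fun a => Sum.inr (Sum.inr (some a)))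
  have hUc : #U ≤ n + K := by
    refine le_trans ?_ hcount
    refine (Finset.card_union_le _ _).trans (add_le_add ?_ ?_)
    · refine (Finset.card_union_le _ _).trans (add_le_add ?_ ?_)
      · refine (Finset.card_union_le _ _).trans (add_le_add ?_ ?_)
        · refine Finset.card_image_le.trans ?_
          have := Sym2.card_image_offDiag (univ : Finset (Fin k))
          rw [Finset.card_univ, Fintype.card_fin] at this
          exact this.le
        · refine Finset.card_image_le.trans ?_
          simp
      · simp
    · refine Finset.card_image_le.trans ?_
      simp
  have hSU : ∀ r c, S r c ∈ U := by
    intro x y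
    have hxy := hdlt (x, y)
    simp only [Dg, mem_filter, mem_univ, true_and] at hxy
    simp only [S, esArr]
    rcases hx : blk x with _ | a <;> rcases hy : blk y with _ | b <;> simp only [hx, hy] at hxy ⊢
    · simp [U, hxy]
    · split_ifs with h <;> simp [U, h]
    · split_ifs with h <;> simp [U, h]
    · split_ifs with h
      · simp [U, hxy, h]
      · simp only [U, mem_union]
        left; left; left
        apply Finset.mem_image_of_mem
        apply Finset.mem_image.2
        exact ⟨(a, b), by simpa using h, rfl⟩
  have hAU : ∀ i, A i ⊆ U := by
    intro i s hs
    simp only [A, mem_union, mem_image, mem_erase, mem_univ, and_true, mem_range] at hs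
    rcases hs with ⟨j, hj, rfl⟩ | ⟨a, ha, rfl⟩
    · simp only [U, mem_union]
      left; left; left
      apply Finset.mem_image_of_mem
      apply Finset.mem_image.2
      exact ⟨(i, j), by simpa using hj.symm, rfl⟩
    · simp [U, ha]
  have hodd : ∀ i, Odd #(A i) := by
    intro i
    have : #(A i) = (k - 1) + w := by
      simp only [A]
      rw [Finset.card_union_of_disjoint, Finset.card_image_of_injective,
        Finset.card_image_of_injective]
      · simp
      · intro a b h; simp at h; grind
      · intro a b h; simp at h; grind
      · rw [Finset.disjoint_left]
        intro s hs hs'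
        simp only [mem_image] at hs hs'
        obtain ⟨_, -, rfl⟩ := hs
        obtain ⟨_, -, h⟩ := hs'
        simp at h
    rw [this]
    exact ⟨v - 1, by omega⟩
  have h1 : ∀ i r c, ¬(blk r = some i ↔ blk c = some i) →
      S r c ∈ A i ∨ S r c = Sum.inr (Sum.inr none) := by
    intro i x y h
    simp only [S, esArr]
    rcases hx : blk x with _ | a <;> rcases hy : blk y with _ | b <;>
      simp only [hx, hy] at h ⊢
    · simp at h
    · have : b = i := by simpa using h
      subst this
      split_ifs with h' <;> simp [A, h']
    · have : a = i := by simpa using h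
      subst this
      split_ifs with h' <;> simp [A, h']
    · simp only [Option.some.injEq] at h
      left
      have hab : a ≠ b := by rintro rfl; simp at h
      rw [if_neg hab]
      by_cases ha : a = i
      · subst ha
        simp only [A, mem_union]
        left
        exact Finset.mem_image.2 ⟨b, by simpa using hab.symm, rfl⟩
      · have hb : b = i := by tauto
        subst hb
        simp only [A, mem_union]
        left
        exact Finset.mem_image.2 ⟨a, by simpa using hab, by rw [Sym2.eq_swap]⟩
  have h2 : ∀ i r c, S r c ∈ A i → ¬(blk r = some i ↔ blk c = some i) := by
    intro i x y h
    simp only [S, esArr] at h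
    rcases hx : blk x with _ | a <;> rcases hy : blk y with _ | b <;>
      simp only [hx, hy] at h ⊢
    · simp [A] at h
    · split_ifs at h with h' <;> simp [A] at h
      simp [h.2]
    · split_ifs at h with h' <;> simp [A] at h
      simp [h.2]
    · split_ifs at h with h' <;> simp [A] at h
      simp only [Option.some.injEq]
      obtain ⟨z, hz, hz'⟩ := h
      rcases hz' with h | h <;> grind
  have h3 : ∀ s, #{i | s ∈ A i} ≤ 2 := by
    intro s
    rcases s with z | ⟨j, a⟩ | o
    · induction z using Sym2.ind with
      | _ x y =>
        refine le_trans (Finset.card_le_card (t := {x, y}) ?_) Finset.card_le_two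
        intro i hi
        simp [A] at hi
        simp only [mem_insert, mem_singleton]
        grind
    · refine le_trans (Finset.card_le_card (t := {j, j}) ?_) Finset.card_le_two
      intro i hi
      simp [A] at hi
      simp [hi.2]
    · simp [A]
  have hno := es_noTrans U S hSU blk (Sum.inr (Sum.inr none)) A hAU hodd h1 h2 h3 K hUc hk
  have hfib : ∀ s : EsSym k, #{p : Fin n × Fin n | S p.1 p.2 = s} ≤ m := by
    intro s
    rcases s with z | ⟨j, a⟩ | _ | a
    · induction z using Sym2.ind with
      | _ x y =>
        refine le_trans (Finset.card_le_card
          (t := ({p | blk p.1 = some x ∧ blk p.2 = some y} : Finset _) ∪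
            ({p | blk p.1 = some y ∧ blk p.2 = some x} : Finset _)) ?_) ?_
        · intro p hp
          simp only [mem_filter, mem_univ, true_and, S, esArr] at hp
          simp only [mem_union, mem_filter, mem_univ, true_and]
          rcases hx : blk p.1 with _ | a <;> rcases hy : blk p.2 with _ | b <;>
            simp only [hx, hy] at hp ⊢
          · simp at hp
          · split_ifs at hp
          · split_ifs at hp
          · split_ifs at hp
            simpa using hp
        · refine (Finset.card_union_le _ _).trans ?_
          rw [es_prod_card, es_prod_card, hb1, hb1]
          nlinarith
    · refine le_trans (Finset.card_le_card ?_) (hf1 j a)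
      intro p hp
      simp only [mem_filter, mem_univ, true_and, S, esArr] at hp
      simp only [C, mem_union, mem_filter, mem_univ, true_and]
      rcases hx : blk p.1 with _ | b <;> rcases hy : blk p.2 with _ | c <;>
        simp only [hx, hy] at hp ⊢
      · simp at hp
      · split_ifs at hp
        · simp at hp
          obtain ⟨rfl, h⟩ := hp
          simpa using h
        · simp at hp
      · split_ifs at hp
        · simp at hp
          obtain ⟨rfl, h⟩ := hp
          simpa using h
        · simp at hp
      · split_ifs at hp
        simp at hp
    · refine le_trans (Finset.card_le_card
        (t := (univ : Finset (Fin k)).biUnion (fun i => {x ∈ C i | w ≤ f i x})) ?_) ?_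
      · intro p hp
        simp only [mem_filter, mem_univ, true_and, S, esArr] at hp
        simp only [C, mem_biUnion, mem_union, mem_filter, mem_univ, true_and]
        rcases hx : blk p.1 with _ | b <;> rcases hy : blk p.2 with _ | c <;>
          simp only [hx, hy] at hp ⊢
        · simp at hp
        · split_ifs at hp with h
          · simp at hp
          · exact ⟨c, by simp, by simpa using h⟩
        · split_ifs at hp with h
          · simp at hp
          · exact ⟨b, by simp, by simpa using h⟩
        · split_ifs at hp
          simp at hp
      · refine (Finset.card_biUnion_le_card_mul _ _ (2 * (v * r) - w * m) ?_).trans ?_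
        · intro i _
          have := hf2 i w
          have := hC i
          omega
        · simpa using hgarb
    · refine le_trans (Finset.card_le_card ?_) (hd1 a)
      intro p hp
      simp only [mem_filter, mem_univ, true_and, S, esArr] at hp
      simp only [Dg, mem_filter, mem_univ, true_and]
      rcases hx : blk p.1 with _ | b <;> rcases hy : blk p.2 with _ | c <;>
        simp only [hx, hy] at hp ⊢
      · simpa using hp
      · split_ifs at hp
        · simp at hp
        · simp at hp
      · split_ifs at hp
        · simp at hp
        · simp at hp
      · split_ifs at hp with h
        simpa [h] using hp
  obtain ⟨enc, henc⟩ := exists_injective_nat (EsSym k)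
  refine ⟨fun x y => enc (S x y), ?_, ?_⟩
  · intro s
    by_cases hs : ∃ t, enc t = s
    · obtain ⟨t, rfl⟩ := hs
      simp only [henc.eq_iff]
      exact hfib t
    · have : ({p | enc (S p.1 p.2) = s} : Finset (Fin n × Fin n)) = ∅ := by
        apply Finset.filter_eq_empty_iff.2
        intro p _ h
        exact hs ⟨_, h⟩
      rw [this]; simp
  · simp only [ne_eq, henc.eq_iff]
    exact hno

lemma es_numbers (n K m v : ℕ) (hn : n = m + K) (hv : 4 * (2 * K + 7) ^ 2 ≤ v)
    (h1 : 2 * v ^ 2 ≤ m) (h2 : m < 2 * (v + 1) ^ 2) :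
    ∃ S : Fin n → Fin n → ℕ,
      (∀ s : ℕ, #{p : Fin n × Fin n | S p.1 p.2 = s} ≤ m) ∧
      ¬ ∃ T : Finset (Fin n × Fin n),
        (∀ p ∈ T, ∀ q ∈ T, p ≠ q → p.1 ≠ q.1 ∧ p.2 ≠ q.2 ∧ S p.1 p.2 ≠ S q.1 q.2) ∧
            T.card = n := by
  obtain ⟨k, hk⟩ : ∃ k, k = 2 * K + 5 := ⟨_, rfl⟩
  have hkv : 4 * k ^ 2 ≤ v := by
    refine le_trans ?_ hv
    have : k ≤ 2 * K + 7 := by omega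
    gcongr
  have hk1 : 5 ≤ k := by omega
  have hKk : K ≤ k := by omega
  have hkv1 : k ≤ v := by nlinarith
  have hKkv : K ≤ k * v := hKk.trans (Nat.le_mul_of_pos_right k (by omega))
  have hkvv : k * v ≤ v ^ 2 := by nlinarith
  obtain ⟨r, hr⟩ : ∃ r, n = k * v + r := Nat.exists_eq_add_of_le (by omega)
  obtain ⟨w, hw⟩ : ∃ w, 2 * v = k + w := Nat.exists_eq_add_of_le (by omega)
  obtain ⟨D, hD⟩ : ∃ D, n + K + (2 * K + 5) * (K + 3) = 2 * (k * v) + D :=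
    Nat.exists_eq_add_of_le (by omega)
  have hch : k.choose 2 = (2 * K + 5) * (K + 2) := by
    rw [Nat.choose_two_right, hk]
    apply Nat.div_eq_of_eq_mul_left (by norm_num)
    have : 2 * K + 5 - 1 = 2 * K + 4 := by omega
    rw [this]; ring
  refine es_construct n k v r w D m (K + 1) hr (by nlinarith) (by omega) (by omega) h1 ?_ ?_ ?_
  · have hx : 2 * (v * r) - w * m ≤ 2 * v * K + k * (4 * v + 2) := by
      rw [Nat.sub_le_iff_le_add]
      zify at *
      have er : (r : ℤ) = m + K - k * v := by linarith
      have ew : (w : ℤ) = 2 * v - k := by linarith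
      rw [er, ew]
      have : (k : ℤ) * m ≤ k * (2 * (v + 1) ^ 2) := by gcongr
      linarith
    calc k * (2 * (v * r) - w * m) ≤ k * (2 * v * K + k * (4 * v + 2)) := by gcongr
      _ ≤ k * (2 * v * k + k * (4 * v + 2 * v)) := by gcongr; omega
      _ = 8 * k ^ 2 * v := by ring
      _ = 2 * (4 * k ^ 2) * v := by ring
      _ ≤ 2 * v * v := by gcongr
      _ = 2 * v ^ 2 := by ring
      _ ≤ m := h1
  · zify at *
    have er : (r : ℤ) = m + K - k * v := by linarith
    have eD : (D : ℤ) = m + 2 * K + (2 * K + 5) * (K + 3) - 2 * (k * v) := by linarith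
    rw [er, eD]
    have e1 : 2 * (v : ℤ) ^ 2 * ((2 * K + 5) * (K + 3)) ≤ m * ((2 * K + 5) * (K + 3)) := by
      gcongr
    have e2 : (K : ℤ) * K ≤ k * v * K := mul_le_mul_of_nonneg_right hKkv (Int.natCast_nonneg K)
    have e3 : (0 : ℤ) ≤ k * v * K := by positivity
    have e4 : (k : ℤ) * v ^ 2 + k ^ 2 * v ^ 2 = 2 * (v : ℤ) ^ 2 * ((2 * K + 5) * (K + 3)) := by
      rw [hk]; ring
    linarith
  · rw [hch]
    have : k * w + k * k = 2 * (k * v) := by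
      have h6 : k * (2 * v) = k * (k + w) := by rw [hw]
      linarith
    have h5 : k * k = (2 * K + 5) * (K + 2) + (2 * K + 5) * (K + 3) := by rw [hk]; ring
    omega

/-- For all sufficiently large `n`, there exists an `n × n` array filled with symbols
(from some set of symbols, modelled as `ℕ`) in which every symbol occurs at most
`n - (1/85) · ln n` times, and which has no transversal of size `n`. -/
theorem erdos_spencer_not_strengthenable :
    ∃ N : ℕ, ∀ n : ℕ, N ≤ n →
      ∃ S : Fin n → Fin n → ℕ,
        (∀ s : ℕ,
          ((Finset.univ.filter (fun p : Fin n × Fin n => S p.1 p.2 = s)).card : ℝ) ≤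
            (n : ℝ) - Real.log n / 85) ∧
        ¬ ∃ T : Finset (Fin n × Fin n),
            (∀ p ∈ T, ∀ q ∈ T, p ≠ q → p.1 ≠ q.1 ∧ p.2 ≠ q.2 ∧ S p.1 p.2 ≠ S q.1 q.2) ∧
            T.card = n := by
  have hlog : ∀ᶠ x : ℝ in Filter.atTop, Real.log x ^ 4 ≤ 1 / 1000000000 * x ∧ 1000 ≤ Real.log x := by
    refine Filter.Eventually.and ?_ (Real.tendsto_log_atTop.eventually_ge_atTop 1000)
    have h := (Real.isLittleO_pow_log_id_atTop (n := 4)).bound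
      (show (0 : ℝ) < 1 / 1000000000 by norm_num)
    filter_upwards [h, Filter.eventually_ge_atTop 0] with x hx h0
    simp only [Real.norm_eq_abs, id] at hx
    rw [abs_of_nonneg h0] at hx
    exact (le_abs_self _).trans hx
  have hev := tendsto_natCast_atTop_atTop (R := ℝ) |>.eventually hlog
  obtain ⟨N, hN⟩ := Filter.eventually_atTop.1 hev
  refine ⟨N, fun n hn => ?_⟩
  obtain ⟨hA, hB⟩ := hN n hn
  set L := Real.log n with hL
  obtain ⟨K, hK⟩ : ∃ K, K = ⌈L / 85⌉₊ := ⟨_, rfl⟩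
  have hK1 : L / 85 ≤ K := by rw [hK]; exact Nat.le_ceil _
  have hK2 : (K : ℝ) < L / 85 + 1 := by rw [hK]; exact Nat.ceil_lt_add_one (by positivity)
  have hbig : K + 2 * (4 * (2 * K + 7) ^ 2) ^ 2 ≤ n := by
    have : ((K + 2 * (4 * (2 * K + 7) ^ 2) ^ 2 : ℕ) : ℝ) ≤ n := by
      push_cast
      have h1 : (2 * (K : ℝ) + 7) ≤ L := by linarith
      have h2 : (2 * (K : ℝ) + 7) ^ 4 ≤ L ^ 4 := by gcongr
      have h3 : (K : ℝ) ≤ L ^ 4 := by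
        have : L ≤ L ^ 4 := le_self_pow₀ (by linarith) (by norm_num)
        linarith
      have h4 : (0 : ℝ) ≤ n := by positivity
      nlinarith
    exact_mod_cast this
  obtain ⟨m, hm⟩ : ∃ m, n = K + m := Nat.exists_eq_add_of_le (by omega)
  have hv : 4 * (2 * K + 7) ^ 2 ≤ Nat.sqrt (m / 2) := by
    rw [Nat.le_sqrt, ← pow_two]
    omega
  have hs1 := Nat.sqrt_le' (m / 2)
  have hs2 := Nat.lt_succ_sqrt' (m / 2)
  obtain ⟨S, hS1, hS2⟩ := es_numbers n K m (Nat.sqrt (m / 2)) (by omega) hv (by omega)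
    (by simp only [Nat.succ_eq_add_one] at hs2; omega)
  refine ⟨S, fun s => ?_, hS2⟩
  have h1 : ((#{p : Fin n × Fin n | S p.1 p.2 = s} : ℕ) : ℝ) ≤ m := by exact_mod_cast hS1 s
  have h2 : (n : ℝ) = K + m := by exact_mod_cast hm
  refine h1.trans ?_
  linarith
end

section
/- For every ε > 0 there exist δ > 0 and N such that the following holds for every n ≥ N: if S is an n×n array filled with the symbols 1, …, n so that each symbol occurs exactly n times in the array, and each symbol occurs at most δ·n times in every row and at most δ·n times in every column, then S has a partial transversal of size at least (1 − ε)·n. -/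
namespace Nibble

set_option linter.unusedSectionVars false

variable {E V : Type*} [DecidableEq E] [DecidableEq V]

/-- Degree of `v` in the edge set `H`. -/
noncomputable def dg (I : E → Finset V) (H : Finset E) (v : V) : ℝ :=
  ((H.filter (fun g => v ∈ I g)).card : ℝ)

/-- Number of edges at `v` that are hit by `f` outside `v`. -/
noncomputable def del (I : E → Finset V) (H : Finset E) (f : E) (v : V) : ℝ :=
  ((H.filter (fun g => v ∈ I g ∧ ∃ u ∈ (I g).erase v, u ∈ I f)).card : ℝ)

theorem dbl (I : E → Finset V) (H : Finset E) (A : Finset V) (hA : ∀ g ∈ H, I g ⊆ A)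
    (F : E → V → ℝ) :
    ∑ v ∈ A, ∑ g ∈ H.filter (fun g => v ∈ I g), F g v = ∑ g ∈ H, ∑ v ∈ I g, F g v := by
  apply Finset.sum_comm'
  intro v g
  simp only [Finset.mem_filter]
  constructor
  · rintro ⟨_, h1, h2⟩; exact ⟨h2, h1⟩
  · rintro ⟨h1, h2⟩; exact ⟨hA g h2 h1, h2, h1⟩

theorem dbl1 (I : E → Finset V) (H : Finset E) (A : Finset V) (hA : ∀ g ∈ H, I g ⊆ A)
    (w : V → ℝ) :
    ∑ g ∈ H, ∑ v ∈ I g, w v = ∑ v ∈ A, dg I H v * w v := by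
  rw [← dbl I H A hA (fun _ v => w v)]
  apply Finset.sum_congr rfl
  intro v _
  simp [dg]

theorem sum_del_eq (I : E → Finset V) (H : Finset E) (v : V) :
    ∑ f ∈ H, del I H f v = ∑ g ∈ H.filter (fun g => v ∈ I g),
      ((H.filter (fun f => ∃ u ∈ (I g).erase v, u ∈ I f)).card : ℝ) := by
  simp only [del, Finset.card_eq_sum_ones, Nat.cast_sum, Nat.cast_one]
  apply Finset.sum_comm'
  intro f g
  simp only [Finset.mem_filter]
  tauto

theorem hit_bounds (I : E → Finset V) (H : Finset E) (K : ℝ)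
    (h3 : ∀ g ∈ H, (I g).card = 3)
    (hK : ∀ u v, u ≠ v → ((H.filter (fun g => u ∈ I g ∧ v ∈ I g)).card : ℝ) ≤ K)
    (v : V) (g : E) (hg : g ∈ H) (hv : v ∈ I g) :
    ((H.filter (fun f => ∃ u ∈ (I g).erase v, u ∈ I f)).card : ℝ)
      ≤ ∑ u ∈ (I g).erase v, dg I H u ∧
    ∑ u ∈ (I g).erase v, dg I H u - K ≤
      ((H.filter (fun f => ∃ u ∈ (I g).erase v, u ∈ I f)).card : ℝ) := by
  have hc : ((I g).erase v).card = 2 := by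
    rw [Finset.card_erase_of_mem hv, h3 g hg]
  obtain ⟨a, b, hab, he⟩ := Finset.card_eq_two.1 hc
  rw [he]
  have e1 : H.filter (fun f => ∃ u ∈ ({a, b} : Finset V), u ∈ I f)
      = H.filter (fun f => a ∈ I f) ∪ H.filter (fun f => b ∈ I f) := by
    rw [← Finset.filter_or]; apply Finset.filter_congr; intro f _; simp
  have e2 := Finset.card_union_add_card_inter (H.filter (fun f => a ∈ I f))
    (H.filter (fun f => b ∈ I f))
  rw [← Finset.filter_and] at e2
  rw [e1, Finset.sum_pair hab]
  have e3 : ((H.filter (fun f => a ∈ I f) ∪ H.filter (fun f => b ∈ I f)).card : ℝ)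
      + ((H.filter (fun f => a ∈ I f ∧ b ∈ I f)).card : ℝ) = dg I H a + dg I H b := by
    unfold dg; exact_mod_cast e2
  have := hK a b hab
  have h0 : (0:ℝ) ≤ ((H.filter (fun f => a ∈ I f ∧ b ∈ I f)).card : ℝ) := by positivity
  constructor <;> linarith

theorem del_le (I : E → Finset V) (H : Finset E) (K : ℝ) (hK0 : 0 ≤ K)
    (h3 : ∀ g ∈ H, (I g).card = 3)
    (hK : ∀ u v, u ≠ v → ((H.filter (fun g => u ∈ I g ∧ v ∈ I g)).card : ℝ) ≤ K)
    (v : V) (f : E) (hf : f ∈ H) : del I H f v ≤ 3 * K := by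
  have hsub : H.filter (fun g => v ∈ I g ∧ ∃ u ∈ (I g).erase v, u ∈ I f) ⊆
      ((I f).erase v).biUnion (fun u => H.filter (fun g => u ∈ I g ∧ v ∈ I g)) := by
    intro g hg
    simp only [Finset.mem_filter, Finset.mem_biUnion, Finset.mem_erase] at hg ⊢
    obtain ⟨h1, h2, u, ⟨h4, h5⟩, h6⟩ := hg
    exact ⟨u, ⟨h4, h6⟩, h1, h5, h2⟩
  have h1 := (Finset.card_le_card hsub).trans Finset.card_biUnion_le
  have h2 : del I H f v ≤ ∑ u ∈ (I f).erase v,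
      ((H.filter (fun g => u ∈ I g ∧ v ∈ I g)).card : ℝ) := by
    unfold del; exact_mod_cast h1
  refine h2.trans ?_
  calc _ ≤ ∑ u ∈ (I f).erase v, K := Finset.sum_le_sum (fun u hu =>
        hK u v (Finset.ne_of_mem_erase hu))
    _ = ((I f).erase v).card * K := by simp
    _ ≤ 3 * K := by
        gcongr
        have := Finset.card_le_card (Finset.erase_subset v (I f))
        rw [h3 f hf] at this
        exact_mod_cast this

theorem sum_del_le (I : E → Finset V) (H : Finset E) (A : Finset V) (hA : ∀ g ∈ H, I g ⊆ A)
    (n : ℝ) (h3 : ∀ g ∈ H, (I g).card = 3)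
    (hd : ∀ v, dg I H v ≤ n) (f : E) (hf : f ∈ H) :
    ∑ v ∈ A, del I H f v ≤ 9 * n := by
  set H' := H.filter (fun g => ∃ u ∈ I f, u ∈ I g) with hH'
  have h1 : ∀ v, del I H f v ≤ dg I H' v := by
    intro v
    unfold del dg
    norm_cast
    apply Finset.card_le_card
    intro g hg
    simp only [hH', Finset.mem_filter, Finset.mem_erase] at hg ⊢
    obtain ⟨h1, h2, u, ⟨h4, h5⟩, h6⟩ := hg
    exact ⟨⟨h1, u, h6, h5⟩, h2⟩
  have h2 := dbl1 I H' A (fun g hg => hA g (Finset.mem_filter.1 hg).1) (fun _ => 1)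
  have h4 : ∑ g ∈ H', ∑ v ∈ I g, (1:ℝ) = 3 * H'.card := by
    have : ∀ g ∈ H', ∑ v ∈ I g, (1:ℝ) = 3 := by
      intro g hg
      simp [h3 g (Finset.mem_filter.1 hg).1]
    rw [Finset.sum_congr rfl this]; simp [mul_comm]
  have h5 : (H'.card : ℝ) ≤ 3 * n := by
    have hsub : H' ⊆ (I f).biUnion (fun u => H.filter (fun g => u ∈ I g)) := by
      intro g hg
      simp only [hH', Finset.mem_filter, Finset.mem_biUnion] at hg ⊢
      obtain ⟨h1, u, h2, h3⟩ := hg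
      exact ⟨u, h2, h1, h3⟩
    have h6 := (Finset.card_le_card hsub).trans Finset.card_biUnion_le
    have h7 : (H'.card : ℝ) ≤ ∑ u ∈ I f, dg I H u := by
      unfold dg; exact_mod_cast h6
    calc _ ≤ _ := h7
      _ ≤ ∑ u ∈ I f, n := Finset.sum_le_sum (fun u _ => hd u)
      _ = 3 * n := by simp [h3 f hf]
  calc _ ≤ ∑ v ∈ A, dg I H' v := Finset.sum_le_sum (fun v _ => h1 v)
    _ = 3 * H'.card := by rw [← h4, h2]; simp
    _ ≤ 9 * n := by linarith

theorem quad_local (s : Finset V) (hs : s.card = 3) (d : V → ℝ) (D : ℝ) :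
    2 * D * ∑ v ∈ s, (d v - D) - ∑ v ∈ s, (d v - D) ^ 2
      ≤ ∑ v ∈ s, (d v - D) * ∑ u ∈ s.erase v, d u := by
  obtain ⟨a, b, c, hab, hac, hbc, rfl⟩ := Finset.card_eq_three.1 hs
  have h : ∀ v ∈ ({a, b, c} : Finset V), (d v - D) * ∑ u ∈ ({a, b, c} : Finset V).erase v, d u
      = (d v - D) * ((d a + d b + d c) - d v) := by
    intro v hv
    rw [Finset.sum_erase_eq_sub hv, Finset.sum_insert (by simp [hab, hac]), Finset.sum_pair hbc]
    ring
  rw [Finset.sum_congr rfl h]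
  simp only [Finset.sum_insert (show a ∉ ({b, c} : Finset V) by simp [hab, hac]),
    Finset.sum_pair hbc]
  nlinarith [sq_nonneg ((d a - D) + (d b - D) + (d c - D))]

theorem dg_new (I : E → Finset V) (H : Finset E) (f : E) (v : V) (hv : v ∉ I f) :
    dg I (H.filter (fun g => Disjoint (I g) (I f))) v = dg I H v - del I H f v := by
  unfold dg del
  have := Finset.card_filter_add_card_filter_not (s := H.filter (fun g => v ∈ I g))
    (fun g => Disjoint (I g) (I f))
  rw [Finset.filter_filter, Finset.filter_filter] at this
  have e1 : H.filter (fun g => v ∈ I g ∧ ∃ u ∈ (I g).erase v, u ∈ I f)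
      = H.filter (fun g => v ∈ I g ∧ ¬ Disjoint (I g) (I f)) := by
    apply Finset.filter_congr
    intro g _
    rw [Finset.not_disjoint_iff]
    constructor
    · rintro ⟨h1, u, h2, h3⟩; exact ⟨h1, u, Finset.mem_of_mem_erase h2, h3⟩
    · rintro ⟨h1, u, h2, h3⟩
      exact ⟨h1, u, Finset.mem_erase.2 ⟨fun h => hv (h ▸ h3), h2⟩, h3⟩
  rw [e1, Finset.filter_filter]
  have e2 : H.filter (fun g => Disjoint (I g) (I f) ∧ v ∈ I g)
      = H.filter (fun g => v ∈ I g ∧ Disjoint (I g) (I f)) := by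
    apply Finset.filter_congr; intro g _; exact and_comm
  rw [e2, ← this]
  push_cast; ring

theorem step (I : E → Finset V) (H : Finset E) (A : Finset V) (hA : ∀ g ∈ H, I g ⊆ A)
    (n K m : ℝ) (hn : 1 ≤ n) (hK1 : 1 ≤ K) (hm1 : 1 ≤ m) (hmn : m ≤ n)
    (h3 : ∀ g ∈ H, (I g).card = 3)
    (hd : ∀ v, dg I H v ≤ n)
    (hK : ∀ u v, u ≠ v → ((H.filter (fun g => u ∈ I g ∧ v ∈ I g)).card : ℝ) ≤ K)
    (hAc : (A.card : ℝ) = 3 * m) (hne : H.Nonempty) (Φ : ℝ)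
    (hΦ : Φ = ∑ v ∈ A, (dg I H v - m ^ 2 / n) ^ 2) :
    ∃ f ∈ H, ∑ v ∈ A \ I f, (dg I (H.filter (fun g => Disjoint (I g) (I f))) v
      - (m - 1) ^ 2 / n) ^ 2 ≤ Φ + (2 * n * Φ + 51 * n ^ 3 * K) / H.card := by
  have hn0 : 0 < n := by linarith
  have hm0 : 0 < m := by linarith
  set D : ℝ := m ^ 2 / n with hD
  set θ : ℝ := D - (m - 1) ^ 2 / n with hθ
  set e : ℝ := (H.card : ℝ) with he
  have he0 : 0 < e := by
    have := hne.card_pos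
    rw [he]; exact_mod_cast this
  have hD0 : 0 ≤ D := by positivity
  have hDn : D ≤ n := by rw [hD, div_le_iff₀ hn0]; nlinarith
  have hθ1 : θ = 2 * D / m - 1 / n := by rw [hθ, hD]; field_simp; ring
  have hθ0 : 0 ≤ θ := by
    have : θ = (2 * m - 1) / n := by rw [hθ, hD]; field_simp; ring
    rw [this]; apply div_nonneg <;> linarith
  have hθ2 : θ ≤ 2 := by
    have : θ = (2 * m - 1) / n := by rw [hθ, hD]; field_simp; ring
    rw [this, div_le_iff₀ hn0]; linarith
  have hdg0 : ∀ v, 0 ≤ dg I H v := fun v => by unfold dg; positivity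
  have hdel0 : ∀ f v, 0 ≤ del I H f v := fun f v => by unfold del; positivity
  set x : V → ℝ := fun v => dg I H v - D with hx
  have hxabs : ∀ v, |x v| ≤ n := by
    intro v; rw [abs_le]; simp only [hx]; constructor <;> linarith [hdg0 v, hd v]
  set X : ℝ := ∑ v ∈ A, x v with hX
  have hΦ0 : 0 ≤ Φ := by rw [hΦ]; positivity
  -- total degree
  have hdeg : ∑ v ∈ A, dg I H v = 3 * e := by
    have := dbl1 I H A hA (fun _ => 1)
    simp only [mul_one] at this
    rw [← this]
    have h4 : ∀ g ∈ H, ∑ v ∈ I g, (1:ℝ) = 3 := by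
      intro g hg
      simp [h3 g hg]
    rw [Finset.sum_congr rfl h4]; simp [mul_comm, he]
  have hXe : X = 3 * e - 3 * m * D := by
    rw [hX]; simp only [hx]
    rw [Finset.sum_sub_distrib, hdeg]; simp [hAc]
  have hXabs : |X| ≤ 3 * n * n := by
    calc |X| ≤ ∑ v ∈ A, |x v| := Finset.abs_sum_le_sum_abs _ _
      _ ≤ ∑ v ∈ A, n := Finset.sum_le_sum (fun v _ => hxabs v)
      _ = 3 * m * n := by simp [hAc]
      _ ≤ 3 * n * n := by gcongr
  have hXsq : X ^ 2 ≤ 3 * m * Φ := by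
    have := sq_sum_le_card_mul_sum_sq (s := A) (f := x)
    rw [hAc] at this
    rw [hΦ]; exact this
  have hen : e ≤ n ^ 2 := by
    have : ∑ v ∈ A, dg I H v ≤ ∑ v ∈ A, n := Finset.sum_le_sum (fun v _ => hd v)
    rw [hdeg] at this
    simp [hAc] at this
    nlinarith
  -- cross term
  set P : V → ℝ := fun v => ∑ g ∈ H.filter (fun g => v ∈ I g), ∑ u ∈ (I g).erase v, dg I H u
    with hP
  set S : V → ℝ := fun v => ∑ f ∈ H, del I H f v with hS
  have hSP : ∀ v, |S v - P v| ≤ n * K := by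
    intro v
    have hb : ∀ g ∈ H.filter (fun g => v ∈ I g), _ := fun g hg =>
      hit_bounds I H K h3 hK v g (Finset.mem_filter.1 hg).1 (Finset.mem_filter.1 hg).2
    have hSv : S v = _ := sum_del_eq I H v
    have h1 := Finset.sum_le_sum (fun g hg => (hb g hg).1)
    have h2 := Finset.sum_le_sum (fun g hg => (hb g hg).2)
    rw [← hSv] at h1 h2
    rw [Finset.sum_sub_distrib] at h2
    have h5 : ∑ g ∈ H.filter (fun g => v ∈ I g), K = dg I H v * K := by simp [dg]
    rw [h5] at h2
    have h6 : dg I H v * K ≤ n * K := by gcongr; exact hd v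
    have h7 : 0 ≤ n * K := by positivity
    rw [abs_le]
    constructor <;> simp only [hP] <;> linarith
  have hcross : 2 * D * (D * X + Φ) - n * Φ ≤ ∑ v ∈ A, x v * P v := by
    have h1 : ∑ v ∈ A, x v * P v
        = ∑ g ∈ H, ∑ v ∈ I g, x v * ∑ u ∈ (I g).erase v, dg I H u := by
      rw [← dbl I H A hA]
      apply Finset.sum_congr rfl
      intro v _
      rw [hP, Finset.mul_sum]
    have h2 : ∑ g ∈ H, (2 * D * ∑ v ∈ I g, x v - ∑ v ∈ I g, x v ^ 2) ≤ ∑ v ∈ A, x v * P v := by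
      rw [h1]
      exact Finset.sum_le_sum (fun g hg => quad_local (I g) (h3 g hg) (dg I H) D)
    rw [Finset.sum_sub_distrib, ← Finset.mul_sum, dbl1 I H A hA, dbl1 I H A hA] at h2
    have h4 : ∑ v ∈ A, dg I H v * x v = D * X + Φ := by
      rw [hX, hΦ, Finset.mul_sum, ← Finset.sum_add_distrib]
      apply Finset.sum_congr rfl
      intro v _
      simp only [hx]; ring
    have h5 : ∑ v ∈ A, dg I H v * x v ^ 2 ≤ n * Φ := by
      rw [hΦ, Finset.mul_sum]
      apply Finset.sum_le_sum
      intro v _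
      have := hd v
      simp only [hx]
      gcongr
    rw [h4] at h2
    linarith
  have hcross2 : ∑ v ∈ A, x v * P v - 3 * n ^ 3 * K ≤ ∑ v ∈ A, x v * S v := by
    have h1 : ∑ v ∈ A, (x v * P v - x v * S v) ≤ ∑ v ∈ A, n * (n * K) := by
      apply Finset.sum_le_sum
      intro v _
      calc x v * P v - x v * S v = x v * (P v - S v) := by ring
        _ ≤ |x v * (P v - S v)| := le_abs_self _
        _ = |x v| * |S v - P v| := by rw [abs_mul, abs_sub_comm (P v)]
        _ ≤ n * (n * K) := by
          apply mul_le_mul (hxabs v) (hSP v) (abs_nonneg _) hn0.le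
    rw [Finset.sum_sub_distrib] at h1
    have h2 : ∑ v ∈ A, n * (n * K) ≤ 3 * n ^ 3 * K := by
      rw [Finset.sum_const, nsmul_eq_mul, hAc]
      have : 0 ≤ n * (n * K) := by positivity
      nlinarith
    linarith
  have hsecond : ∑ f ∈ H, ∑ v ∈ A, (del I H f v - θ) ^ 2 ≤ e * (39 * K * n) := by
    have h1 : ∀ f ∈ H, ∑ v ∈ A, (del I H f v - θ) ^ 2 ≤ 39 * K * n := by
      intro f hf
      calc ∑ v ∈ A, (del I H f v - θ) ^ 2 ≤ ∑ v ∈ A, (3 * K * del I H f v + 4) := by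
            apply Finset.sum_le_sum
            intro v _
            have a1 := hdel0 f v
            have a2 := del_le I H K (by linarith) h3 hK v f hf
            nlinarith [mul_nonneg a1 hθ0, mul_nonneg a1 (sub_nonneg.2 a2)]
        _ = 3 * K * ∑ v ∈ A, del I H f v + 4 * (3 * m) := by
            rw [Finset.sum_add_distrib, ← Finset.mul_sum]; simp [hAc]; ring
        _ ≤ 3 * K * (9 * n) + 4 * (3 * n) := by
            gcongr
            exact sum_del_le I H A hA n h3 hd f hf
        _ ≤ 39 * K * n := by nlinarith
    calc _ ≤ ∑ f ∈ H, 39 * K * n := Finset.sum_le_sum h1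
      _ = _ := by simp [he]
  -- the average
  have htot : ∑ f ∈ H, ∑ v ∈ A, (x v - (del I H f v - θ)) ^ 2
      = e * Φ - 2 * (∑ v ∈ A, x v * S v - e * θ * X)
        + ∑ f ∈ H, ∑ v ∈ A, (del I H f v - θ) ^ 2 := by
    have h1 : ∀ f ∈ H, ∑ v ∈ A, (x v - (del I H f v - θ)) ^ 2
        = Φ - 2 * ∑ v ∈ A, x v * del I H f v + 2 * θ * X
          + ∑ v ∈ A, (del I H f v - θ) ^ 2 := by
      intro f _
      rw [hΦ, hX, Finset.mul_sum, Finset.mul_sum, ← Finset.sum_sub_distrib,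
        ← Finset.sum_add_distrib, ← Finset.sum_add_distrib]
      apply Finset.sum_congr rfl
      intro v _
      simp only [hx]; ring
    rw [Finset.sum_congr rfl h1, Finset.sum_add_distrib, Finset.sum_add_distrib,
      Finset.sum_sub_distrib, ← Finset.mul_sum, Finset.sum_comm]
    have h2 : ∑ v ∈ A, ∑ f ∈ H, x v * del I H f v = ∑ v ∈ A, x v * S v := by
      apply Finset.sum_congr rfl
      intro v _
      rw [hS, Finset.mul_sum]
    rw [h2]
    simp only [Finset.sum_const, nsmul_eq_mul, ← he]
    ring
  have hmain : ∑ f ∈ H, ∑ v ∈ A, (x v - (del I H f v - θ)) ^ 2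
      ≤ e * Φ + 2 * n * Φ + 51 * n ^ 3 * K := by
    rw [htot]
    have a1 : -4 * D ^ 2 * X + 2 * e * θ * X = 4 * D / (3 * m) * X ^ 2 - 2 * e * X / n := by
      rw [hθ1]
      have : e = X / 3 + m * D := by rw [hXe]; ring
      rw [this]; field_simp; ring
    have a2 : 4 * D / (3 * m) * X ^ 2 ≤ 4 * D * Φ := by
      calc 4 * D / (3 * m) * X ^ 2 ≤ 4 * D / (3 * m) * (3 * m * Φ) := by gcongr
        _ = 4 * D * Φ := by field_simp
    have a3 : - (2 * e * X / n) ≤ 6 * n ^ 3 * K := by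
      have b1 : -X ≤ 3 * n * n := (neg_le_abs X).trans hXabs
      have b2 : - (2 * e * X / n) = 2 * e * (-X) / n := by ring
      rw [b2, div_le_iff₀ hn0]
      calc 2 * e * (-X) ≤ 2 * e * (3 * n * n) := by gcongr
        _ ≤ 2 * n ^ 2 * (3 * n * n) := by gcongr
        _ = 6 * n ^ 3 * 1 * n := by ring
        _ ≤ 6 * n ^ 3 * K * n := by gcongr
    have a4 : e * (39 * K * n) ≤ 39 * n ^ 3 * K := by
      calc e * (39 * K * n) ≤ n ^ 2 * (39 * K * n) := by gcongr
        _ = _ := by ring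
    linarith
  obtain ⟨f, hf, hle⟩ : ∃ f ∈ H, ∑ v ∈ A, (x v - (del I H f v - θ)) ^ 2
      ≤ Φ + (2 * n * Φ + 51 * n ^ 3 * K) / e := by
    apply Finset.exists_le_of_sum_le hne
    rw [Finset.sum_const, nsmul_eq_mul, ← he]
    refine hmain.trans (le_of_eq ?_)
    field_simp
    ring
  refine ⟨f, hf, le_trans ?_ hle⟩
  calc _ = ∑ v ∈ A \ I f, (x v - (del I H f v - θ)) ^ 2 := by
        apply Finset.sum_congr rfl
        intro v hv
        rw [dg_new I H f v (Finset.mem_sdiff.1 hv).2]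
        simp only [hx, hθ]; ring
    _ ≤ _ := Finset.sum_le_sum_of_subset_of_nonneg Finset.sdiff_subset
        (fun _ _ _ => sq_nonneg _)

theorem edge_count (I : E → Finset V) (H : Finset E) (A : Finset V) (hA : ∀ g ∈ H, I g ⊆ A)
    (m D : ℝ) (h3 : ∀ g ∈ H, (I g).card = 3) (hAc : (A.card : ℝ) = 3 * m) :
    (3 * (H.card : ℝ) - 3 * m * D) ^ 2 ≤ 3 * m * ∑ v ∈ A, (dg I H v - D) ^ 2 := by
  have hdeg : ∑ v ∈ A, dg I H v = 3 * (H.card : ℝ) := by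
    have := dbl1 I H A hA (fun _ => 1)
    simp only [mul_one] at this
    rw [← this]
    have h4 : ∀ g ∈ H, ∑ v ∈ I g, (1:ℝ) = 3 := by
      intro g hg
      simp [h3 g hg]
    rw [Finset.sum_congr rfl h4]; simp [mul_comm]
  have hXe : ∑ v ∈ A, (dg I H v - D) = 3 * (H.card : ℝ) - 3 * m * D := by
    rw [Finset.sum_sub_distrib, hdeg]; simp [hAc]
  have := sq_sum_le_card_mul_sum_sq (s := A) (f := fun v => dg I H v - D)
  rw [hAc, hXe] at this
  exact this

theorem iter (I : E → Finset V) (H₀ : Finset E) (A₀ : Finset V) (hA₀ : ∀ g ∈ H₀, I g ⊆ A₀)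
    (n : ℕ) (hn : 1 ≤ n) (ε K c B : ℝ) (hε : 0 < ε) (hK1 : 1 ≤ K) (hc : c = ε ^ 3 / 2)
    (hB : B = 51 / c * Real.exp (2 / c)) (hKB : 3 * B * K ≤ ε ^ 6 * n)
    (h3 : ∀ g ∈ H₀, (I g).card = 3)
    (hd : ∀ v, dg I H₀ v ≤ n) (hdeq : ∀ v ∈ A₀, dg I H₀ v = n)
    (hK : ∀ u v, u ≠ v → ((H₀.filter (fun g => u ∈ I g ∧ v ∈ I g)).card : ℝ) ≤ K)
    (hAc₀ : (A₀.card : ℝ) = 3 * n) (j : ℕ) :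
    (j : ℝ) < (1 - ε) * n + 1 →
    ∃ (M H : Finset E) (A : Finset V), H ⊆ H₀ ∧ M.card = j ∧
      (∀ g ∈ M, ∀ h ∈ M, g ≠ h → Disjoint (I g) (I h)) ∧
      (∀ g ∈ M, ∀ h ∈ H, Disjoint (I g) (I h)) ∧
      (∀ g ∈ H, I g ⊆ A) ∧ (A.card : ℝ) = 3 * (n - j) ∧
      ∑ v ∈ A, (dg I H v - ((n : ℝ) - j) ^ 2 / n) ^ 2
        ≤ 51 * n * K / c * j * (1 + 2 / (c * n)) ^ j := by
  have hn0 : (0 : ℝ) < n := by exact_mod_cast hn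
  have hn1 : (1 : ℝ) ≤ n := by exact_mod_cast hn
  have hc0 : 0 < c := by rw [hc]; positivity
  induction j with
  | zero =>
    intro _
    refine ⟨∅, H₀, A₀, subset_rfl, rfl, by simp, by simp, hA₀, by simpa using hAc₀, ?_⟩
    have : ∑ v ∈ A₀, (dg I H₀ v - ((n : ℝ) - (0 : ℕ)) ^ 2 / n) ^ 2 = 0 := by
      apply Finset.sum_eq_zero
      intro v hv
      rw [hdeq v hv]
      push_cast
      have : (n : ℝ) - ((n : ℝ) - 0) ^ 2 / n = 0 := by field_simp; ring
      rw [this]; simp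
    rw [this]; simp
  | succ j ih =>
    intro hj
    push_cast at hj
    obtain ⟨M, H, A, hHs, hMc, hMM, hMH, hA, hAc, hΦ⟩ := ih (by linarith)
    have hmε : ε * n < (n : ℝ) - j := by linarith
    have hm0 : 0 < (n : ℝ) - j := lt_of_le_of_lt (by positivity) hmε
    have hm1 : 1 ≤ (n : ℝ) - j := by
      have : j < n := by
        have : (j : ℝ) < n := by linarith
        exact_mod_cast this
      have : ((j + 1 : ℕ) : ℝ) ≤ n := by exact_mod_cast this
      push_cast at this; linarith
    have hjn : (j : ℝ) ≤ n := by linarith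
    have hj0 : (0 : ℝ) ≤ j := by positivity
    have hmn : (n : ℝ) - j ≤ n := by linarith
    have h3' : ∀ g ∈ H, (I g).card = 3 := fun g hg => h3 g (hHs hg)
    have hd' : ∀ v, dg I H v ≤ n := by
      intro v
      refine le_trans ?_ (hd v)
      unfold dg
      norm_cast
      exact Finset.card_le_card (Finset.filter_subset_filter _ hHs)
    have hK' : ∀ u v, u ≠ v → ((H.filter (fun g => u ∈ I g ∧ v ∈ I g)).card : ℝ) ≤ K := by
      intro u v huv
      refine le_trans ?_ (hK u v huv)
      norm_cast
      exact Finset.card_le_card (Finset.filter_subset_filter _ hHs)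
    set m : ℝ := (n : ℝ) - j with hm
    set Φ : ℝ := ∑ v ∈ A, (dg I H v - m ^ 2 / n) ^ 2 with hΦd
    have hΦ0 : 0 ≤ Φ := by rw [hΦd]; positivity
    set q : ℝ := 1 + 2 / (c * n) with hq
    have hq1 : 1 ≤ q := by
      have : 0 ≤ 2 / (c * n) := by positivity
      linarith
    have hqj : q ^ j ≤ Real.exp (2 / c) := by
      have h1 : q ≤ Real.exp (2 / (c * n)) := by
        have := Real.add_one_le_exp (2 / (c * n)); linarith
      calc q ^ j ≤ q ^ n := pow_le_pow_right₀ hq1 (by exact_mod_cast hjn)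
        _ ≤ (Real.exp (2 / (c * n))) ^ n := by gcongr
        _ = Real.exp (2 / c) := by
          rw [← Real.exp_nat_mul]; congr 1; field_simp
    have hΦB : 3 * m * Φ ≤ (ε ^ 3 * n ^ 2) ^ 2 := by
      calc 3 * m * Φ ≤ 3 * n * (51 * n * K / c * n * Real.exp (2 / c)) := by
            have : Φ ≤ 51 * n * K / c * n * Real.exp (2 / c) := by
              refine hΦ.trans ?_
              gcongr
            gcongr
        _ = (3 * B * K) * n ^ 3 := by rw [hB]; field_simp
        _ ≤ (ε ^ 6 * n) * n ^ 3 := by gcongr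
        _ = _ := by ring
    have hec := edge_count I H A hA m (m ^ 2 / n) h3' hAc
    have habs := abs_le_of_sq_le_sq (hec.trans hΦB) (by positivity)
    have hmD : ε ^ 3 * n ^ 2 ≤ m * (m ^ 2 / n) := by
      have h1 : (ε * n) ^ 3 ≤ m ^ 3 := by gcongr
      have h2 : m * (m ^ 2 / n) = m ^ 3 / n := by ring
      rw [h2, le_div_iff₀ hn0]
      linarith [h1, show (ε * n) ^ 3 = ε ^ 3 * n ^ 2 * n by ring]
    have hecn : c * n ^ 2 ≤ (H.card : ℝ) := by
      have h1 : 0 ≤ ε ^ 3 * (n : ℝ) ^ 2 := by positivity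
      rw [hc]
      linarith [(abs_le.1 habs).1]
    have hcn0 : 0 < c * (n : ℝ) ^ 2 := by positivity
    have hne : H.Nonempty := by
      rw [← Finset.card_pos]
      have : (0 : ℝ) < H.card := by linarith
      exact_mod_cast this
    obtain ⟨f, hf, hfle⟩ := step I H A hA n K m hn1 hK1 hm1 hmn h3' hd' hK' hAc hne Φ hΦd
    have hfM : f ∉ M := by
      intro h
      have h1 := hMH f h f hf
      rw [disjoint_self] at h1
      have h2 := h3' f hf
      rw [h1] at h2
      simp at h2
    refine ⟨insert f M, H.filter (fun g => Disjoint (I g) (I f)), A \ I f,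
      (Finset.filter_subset _ _).trans hHs, ?_, ?_, ?_, ?_, ?_, ?_⟩
    · rw [Finset.card_insert_of_notMem hfM, hMc]
    · intro g hg h hh hgh
      rw [Finset.mem_insert] at hg hh
      rcases hg with rfl | hg <;> rcases hh with rfl | hh
      · exact absurd rfl hgh
      · exact (hMH h hh g hf).symm
      · exact hMH g hg h hf
      · exact hMM g hg h hh hgh
    · intro g hg h hh
      rw [Finset.mem_filter] at hh
      rw [Finset.mem_insert] at hg
      rcases hg with rfl | hg
      · exact hh.2.symm
      · exact hMH g hg h hh.1
    · intro g hg
      rw [Finset.mem_filter] at hg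
      exact Finset.subset_sdiff.2 ⟨hA g hg.1, hg.2⟩
    · have h1 := Finset.card_sdiff_add_card_eq_card (hA f hf)
      rw [h3' f hf] at h1
      have h2 : ((A \ I f).card : ℝ) + 3 = A.card := by exact_mod_cast h1
      rw [hAc] at h2
      push_cast
      rw [hm] at h2
      linarith
    · have e1 : (n : ℝ) - ((j + 1 : ℕ) : ℝ) = m - 1 := by push_cast; rw [hm]; ring
      rw [e1]
      refine hfle.trans ?_
      have h1 : (2 * n * Φ + 51 * (n : ℝ) ^ 3 * K) / H.card
          ≤ (2 * n * Φ + 51 * (n : ℝ) ^ 3 * K) / (c * n ^ 2) := by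
        gcongr
      have h2 : Φ + (2 * n * Φ + 51 * (n : ℝ) ^ 3 * K) / (c * n ^ 2)
          = q * Φ + 51 * n * K / c := by
        rw [hq]; field_simp; ring
      set b : ℝ := 51 * n * K / c with hb
      have hb0 : 0 ≤ b := by positivity
      have h4 : q * Φ ≤ q * (b * j * q ^ j) := by gcongr
      have h5 : b * 1 ≤ b * q ^ (j + 1) := by
        gcongr
        exact one_le_pow₀ hq1
      push_cast
      calc _ ≤ q * Φ + b := by linarith
        _ ≤ q * (b * j * q ^ j) + b * q ^ (j + 1) := by linarith
        _ = b * (j + 1) * q ^ (j + 1) := by ring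

end Nibble

theorem Nibble.cells {n : ℕ} (S : Fin n → Fin n → Fin n) (ε K c B : ℝ) (hn : 1 ≤ n)
    (hε : 0 < ε) (hK1 : 1 ≤ K) (hc : c = ε ^ 3 / 2)
    (hB : B = 51 / c * Real.exp (2 / c)) (hKB : 3 * B * K ≤ ε ^ 6 * n)
    (hS : ∀ s : Fin n,
      (Finset.univ.filter (fun p : Fin n × Fin n => S p.1 p.2 = s)).card = n)
    (hr : ∀ s : Fin n, ∀ i : Fin n,
      ((Finset.univ.filter (fun j : Fin n => S i j = s)).card : ℝ) ≤ K)
    (hcol : ∀ s : Fin n, ∀ j : Fin n,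
      ((Finset.univ.filter (fun i : Fin n => S i j = s)).card : ℝ) ≤ K)
    (k : ℕ) (hk : (k : ℝ) < (1 - ε) * n + 1) :
    ∃ T : Finset (Fin n × Fin n),
      (∀ p ∈ T, ∀ q ∈ T, p ≠ q → p.1 ≠ q.1 ∧ p.2 ≠ q.2 ∧ S p.1 p.2 ≠ S q.1 q.2) ∧
      T.card = k := by
  set I : Fin n × Fin n → Finset (Fin 3 × Fin n) :=
    fun p => {(0, p.1), (1, p.2), (2, S p.1 p.2)} with hI
  have m0 : ∀ p i, ((0 : Fin 3), i) ∈ I p ↔ p.1 = i := by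
    intro p i; simp [hI, eq_comm]
  have m1 : ∀ p i, ((1 : Fin 3), i) ∈ I p ↔ p.2 = i := by
    intro p i; simp [hI, eq_comm]
  have m2 : ∀ p i, ((2 : Fin 3), i) ∈ I p ↔ S p.1 p.2 = i := by
    intro p i; simp [hI, eq_comm]
  have hdeg : ∀ v, Nibble.dg I Finset.univ v = n := by
    rintro ⟨a, i⟩
    unfold Nibble.dg
    norm_cast
    fin_cases a
    · simp only [Fin.zero_eta, m0]
      have : Finset.univ.filter (fun p : Fin n × Fin n => p.1 = i)
          = ({i} : Finset (Fin n)) ×ˢ Finset.univ := by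
        ext ⟨p1, p2⟩; simp only [Finset.mem_filter, Finset.mem_product, Finset.mem_singleton, Finset.mem_univ, true_and, and_true]
      rw [this]; simp
    · simp only [Fin.mk_one, m1]
      have : Finset.univ.filter (fun p : Fin n × Fin n => p.2 = i)
          = (Finset.univ : Finset (Fin n)) ×ˢ {i} := by
        ext ⟨p1, p2⟩; simp only [Finset.mem_filter, Finset.mem_product, Finset.mem_singleton, Finset.mem_univ, true_and, and_true]
      rw [this]; simp
    · simp only [Fin.reduceFinMk, m2]
      exact hS i
  have c01 : ∀ i j : Fin n,
      ((Finset.univ.filter (fun p : Fin n × Fin n => p.1 = i ∧ p.2 = j)).card : ℝ) ≤ K := by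
    intro i j
    refine le_trans ?_ hK1
    norm_cast
    rw [Finset.card_le_one]
    rintro ⟨a, b⟩ ha ⟨a', b'⟩ hb
    simp at ha hb
    simp [ha, hb]
  have c02 : ∀ i s : Fin n,
      ((Finset.univ.filter (fun p : Fin n × Fin n => p.1 = i ∧ S p.1 p.2 = s)).card : ℝ)
        ≤ K := by
    intro i s
    refine le_trans ?_ (hr s i)
    norm_cast
    apply Finset.card_le_card_of_injOn (fun p => p.2)
    · rintro ⟨a, b⟩ h
      simp at h ⊢
      rw [← h.1]; exact h.2
    · rintro ⟨a, b⟩ h ⟨a', b'⟩ h' hh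
      simp at h h' hh ⊢
      exact ⟨h.1.trans h'.1.symm, hh⟩
  have c12 : ∀ j s : Fin n,
      ((Finset.univ.filter (fun p : Fin n × Fin n => p.2 = j ∧ S p.1 p.2 = s)).card : ℝ)
        ≤ K := by
    intro i s
    refine le_trans ?_ (hcol s i)
    norm_cast
    apply Finset.card_le_card_of_injOn (fun p => p.1)
    · rintro ⟨a, b⟩ h
      simp at h ⊢
      rw [← h.1]; exact h.2
    · rintro ⟨a, b⟩ h ⟨a', b'⟩ h' hh
      simp at h h' hh ⊢
      exact ⟨hh, h.1.trans h'.1.symm⟩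
  have hemp : ∀ (F : Fin n × Fin n → Fin n) (i j : Fin n), i ≠ j →
      ((Finset.univ.filter (fun p : Fin n × Fin n => F p = i ∧ F p = j)).card : ℝ) ≤ K := by
    intro F i j hij
    have : Finset.univ.filter (fun p : Fin n × Fin n => F p = i ∧ F p = j) = ∅ := by
      apply Finset.filter_false_of_mem
      rintro p _ ⟨h1, h2⟩
      exact hij (h1.symm.trans h2)
    rw [this]; simp; linarith
  have hcod : ∀ u v, u ≠ v →
      ((Finset.univ.filter (fun g => u ∈ I g ∧ v ∈ I g)).card : ℝ) ≤ K := by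
    rintro ⟨a, i⟩ ⟨b, j⟩ huv
    fin_cases a <;> fin_cases b <;>
      simp only [Fin.zero_eta, Fin.mk_one, Fin.reduceFinMk, m0, m1, m2] at huv ⊢
    · exact hemp (fun p => p.1) i j (fun h => huv (by rw [h]))
    · exact c01 i j
    · exact c02 i j
    · simpa only [and_comm] using c01 j i
    · exact hemp (fun p => p.2) i j (fun h => huv (by rw [h]))
    · exact c12 i j
    · simpa only [and_comm] using c02 j i
    · simpa only [and_comm] using c12 j i
    · exact hemp (fun p => S p.1 p.2) i j (fun h => huv (by rw [h]))
  obtain ⟨M, -, -, -, hMc, hMM, -⟩ := Nibble.iter I Finset.univ Finset.univ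
    (fun _ _ => Finset.subset_univ _) n hn ε K c B hε hK1 hc hB hKB
    (fun g _ => by simp [hI])
    (fun v => (hdeg v).le) (fun v _ => hdeg v) hcod (by simp) k hk
  refine ⟨M, ?_, hMc⟩
  intro p hp q hq hpq
  have hdis := Finset.disjoint_left.1 (hMM p hp q hq hpq)
  refine ⟨fun h => ?_, fun h => ?_, fun h => ?_⟩
  · exact hdis ((m0 p p.1).2 rfl) ((m0 q p.1).2 h.symm)
  · exact hdis ((m1 p p.2).2 rfl) ((m1 q p.2).2 h.symm)
  · exact hdis ((m2 p _).2 rfl) ((m2 q _).2 h.symm)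


/-- For every `ε > 0` there exist `δ > 0` and `N` such that for every `n ≥ N`:
if `S` is an `n × n` array filled with the symbols `1, …, n` so that each symbol occurs exactly
`n` times in the array, and each symbol occurs at most `δ·n` times in every row and in every
column, then `S` has a partial transversal of size at least `(1 - ε)·n`. -/
theorem asymptotic_stein_bounded_repetitions :
    ∀ ε : ℝ, 0 < ε →
      ∃ δ : ℝ, 0 < δ ∧ ∃ N : ℕ, ∀ n : ℕ, N ≤ n →
        ∀ S : Fin n → Fin n → Fin n,
          (∀ s : Fin n,
            (Finset.univ.filter (fun p : Fin n × Fin n => S p.1 p.2 = s)).card = n) →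
          (∀ s : Fin n, ∀ i : Fin n,
            ((Finset.univ.filter (fun j : Fin n => S i j = s)).card : ℝ) ≤ δ * n) →
          (∀ s : Fin n, ∀ j : Fin n,
            ((Finset.univ.filter (fun i : Fin n => S i j = s)).card : ℝ) ≤ δ * n) →
          ∃ T : Finset (Fin n × Fin n),
            (∀ p ∈ T, ∀ q ∈ T, p ≠ q → p.1 ≠ q.1 ∧ p.2 ≠ q.2 ∧ S p.1 p.2 ≠ S q.1 q.2) ∧
            (1 - ε) * (n : ℝ) ≤ (T.card : ℝ) := by
  intro ε hε
  have hB0 : 0 < 51 / (ε ^ 3 / 2) * Real.exp (2 / (ε ^ 3 / 2)) := by positivity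
  set B : ℝ := 51 / (ε ^ 3 / 2) * Real.exp (2 / (ε ^ 3 / 2)) with hB
  refine ⟨ε ^ 6 / (3 * B), by positivity, 1, ?_⟩
  intro n hn S hS hr hc
  have hn0 : (0 : ℝ) < n := by exact_mod_cast hn
  have hK1 : 1 ≤ ε ^ 6 / (3 * B) * n := by
    refine le_trans ?_ (hr (S ⟨0, hn⟩ ⟨0, hn⟩) ⟨0, hn⟩)
    have : 0 < (Finset.univ.filter
        (fun j : Fin n => S ⟨0, hn⟩ j = S ⟨0, hn⟩ ⟨0, hn⟩)).card :=
      Finset.card_pos.2 ⟨⟨0, hn⟩, by simp⟩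
    exact_mod_cast this
  have hKB : 3 * B * (ε ^ 6 / (3 * B) * n) ≤ ε ^ 6 * n := by
    apply le_of_eq; field_simp
  by_cases h1 : (1 - ε) * (n : ℝ) ≤ 0
  · exact ⟨∅, by simp, by simpa using h1⟩
  · push Not at h1
    obtain ⟨T, hT, hTc⟩ := Nibble.cells S ε _ _ B hn hε hK1 rfl hB hKB hS hr hc
      ⌈(1 - ε) * (n : ℝ)⌉₊ (Nat.ceil_lt_add_one h1.le)
    exact ⟨T, hT, by rw [hTc]; exact Nat.le_ceil _⟩
end

section
/- For every ε > 0 and all sufficiently large n, there exists an n×n array filled with the symbols 1, …, n in which each symbol occurs exactly n times, which has no partial transversal of size larger than n − (1/42)·ln n, but which does have a partial transversal of size at least (1 − ε)·n. -/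
/-- Block index of a row or column. -/
def blk (k r m : ℕ) : ℕ := min (m / r) k

/-- Class of a cell, from the block indices of its row and column. -/
def ccl (k i j : ℕ) : ℕ × ℕ := if i = j then (k, k) else (min i j, max i j)

/-- Class of a symbol. -/
def scl (k r s : ℕ) : ℕ × ℕ :=
  if s < k * (2 * r) then
    (if s % (2 * r) < s / (2 * r) then (s % (2 * r), s / (2 * r))
      else if s % (2 * r) < k then (k, k) else (s / (2 * r), k))
  else (k, k)

/-- Parity weight of a class with respect to index `i`. -/
def hw (i : ℕ) (p : ℕ × ℕ) : ℕ := if p.1 = i ∨ p.2 = i then 1 else 0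

theorem fill_lemma {α β Q : Type*} [Fintype α] [Fintype β] [DecidableEq α] [DecidableEq β]
    [DecidableEq Q] (hcard : Fintype.card α = Fintype.card β)
    (G : Finset α) (B : Finset β) (ca : α → Q) (cb : β → Q) (d : Q → ℕ)
    (h1 : ∀ q, (G.filter (fun a => ca a = q)).card
      ≤ (Finset.univ.filter (fun b => b ∉ B ∧ cb b = q)).card + d q)
    (h2 : ∀ Q' : Finset Q, ∑ q ∈ Q', d q ≤ B.card) :
    ∃ e : α ≃ β, ∀ a ∈ G, (d (ca a) ≠ 0 ∧ e a ∈ B) ∨ cb (e a) = ca a := by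
  classical
  let t : {a // a ∈ G} → Finset β := fun a =>
    (if d (ca a) = 0 then ∅ else B) ∪ Finset.univ.filter (fun b => b ∉ B ∧ cb b = ca a)
  have hall : ∀ s : Finset {a // a ∈ G}, s.card ≤ (s.biUnion t).card := by
    intro s
    rcases s.eq_empty_or_nonempty with rfl | hne
    · simp
    let Q' : Finset Q := s.image (fun a : {a // a ∈ G} => ca a.1)
    have hs : s.card ≤ ∑ q ∈ Q', (G.filter (fun a => ca a = q)).card := by
      rw [← Finset.card_map (Function.Embedding.subtype _)]
      rw [← Finset.card_biUnion]
      · apply Finset.card_le_card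
        intro a ha
        simp only [Finset.mem_map, Function.Embedding.coe_subtype] at ha
        obtain ⟨a', ha', rfl⟩ := ha
        simp only [Finset.mem_biUnion, Finset.mem_filter]
        exact ⟨ca a', Finset.mem_image_of_mem _ ha', a'.2, rfl⟩
      · intro x _ y _ hxy
        simp only [Function.onFun]
        rw [Finset.disjoint_left]
        intro a ha hb
        simp only [Finset.mem_filter] at ha hb
        exact hxy (ha.2.symm.trans hb.2)
    have hdis : ∀ x ∈ Q', ∀ y ∈ Q', x ≠ y → Disjoint
        (Finset.univ.filter (fun b => b ∉ B ∧ cb b = x))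
        (Finset.univ.filter (fun b => b ∉ B ∧ cb b = y)) := by
      intro x _ y _ hxy
      rw [Finset.disjoint_left]
      intro a ha hb
      simp only [Finset.mem_filter] at ha hb
      exact hxy (ha.2.2.symm.trans hb.2.2)
    have hb : ∑ q ∈ Q', d q + ∑ q ∈ Q', (Finset.univ.filter (fun b => b ∉ B ∧ cb b = q)).card
        ≤ (s.biUnion t).card := by
      rw [← Finset.card_biUnion hdis]
      by_cases hz : ∀ q ∈ Q', d q = 0
      · rw [Finset.sum_eq_zero hz, zero_add]
        apply Finset.card_le_card
        intro b hb
        simp only [Finset.mem_biUnion] at hb ⊢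
        obtain ⟨q, hq, hb⟩ := hb
        obtain ⟨a, ha, rfl⟩ := Finset.mem_image.1 hq
        exact ⟨a, ha, Finset.mem_union_right _ hb⟩
      · push Not at hz
        obtain ⟨q0, hq0, hd0⟩ := hz
        refine (Nat.add_le_add_right (h2 Q') _).trans ?_
        rw [← Finset.card_union_of_disjoint]
        · apply Finset.card_le_card
          intro b hb
          simp only [Finset.mem_union, Finset.mem_biUnion] at hb
          simp only [Finset.mem_biUnion]
          rcases hb with hb | ⟨q, hq, hb⟩
          · obtain ⟨a, ha, rfl⟩ := Finset.mem_image.1 hq0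
            refine ⟨a, ha, Finset.mem_union_left _ ?_⟩
            rw [if_neg hd0]; exact hb
          · obtain ⟨a, ha, rfl⟩ := Finset.mem_image.1 hq
            exact ⟨a, ha, Finset.mem_union_right _ hb⟩
        · rw [Finset.disjoint_left]
          intro b hb hb2
          simp only [Finset.mem_biUnion, Finset.mem_filter] at hb2
          obtain ⟨q, _, _, hb3, _⟩ := hb2
          exact hb3 hb
    have h3 : ∑ q ∈ Q', (G.filter (fun a => ca a = q)).card
        ≤ ∑ q ∈ Q', ((Finset.univ.filter (fun b => b ∉ B ∧ cb b = q)).card + d q) :=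
      Finset.sum_le_sum (fun q _ => h1 q)
    rw [Finset.sum_add_distrib] at h3
    omega
  obtain ⟨f, hf, hft⟩ := (Finset.all_card_le_biUnion_card_iff_exists_injective t).1 hall
  rcases isEmpty_or_nonempty β with hβ | ⟨⟨b0⟩⟩
  · have hα : IsEmpty α := by
      rw [← Fintype.card_eq_zero_iff, hcard, Fintype.card_eq_zero_iff]; exact hβ
    exact ⟨Fintype.equivOfCardEq hcard, fun a => (hα.false a).elim⟩
  let f' : α → β := fun a => if h : a ∈ G then f ⟨a, h⟩ else b0
  have hf' : ∀ a (h : a ∈ G), f' a = f ⟨a, h⟩ := fun a h => by simp [f', h]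
  obtain ⟨g, hg⟩ := Finset.exists_equiv_extend_of_card_eq (t := (Finset.univ : Finset β))
    (s := G) (f := f') (by simpa using hcard) (by simp) (by
      intro x hx y hy hxy
      rw [hf' x hx, hf' y hy] at hxy
      exact congrArg Subtype.val (hf hxy))
  refine ⟨g.trans (Equiv.subtypeUnivEquiv (by simp)), ?_⟩
  intro a ha
  have h4 : (g.trans (Equiv.subtypeUnivEquiv (by simp))) a = f ⟨a, ha⟩ := by
    rw [← hf' a ha, ← hg a ha]; rfl
  rw [h4]
  have := hft ⟨a, ha⟩
  simp only [t, Finset.mem_union, Finset.mem_filter] at this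
  rcases this with h | h
  · left
    by_cases hd : d (ca a) = 0
    · simp [hd] at h
    · rw [if_neg hd] at h; exact ⟨hd, h⟩
  · right; exact h.2.2

theorem card_blk_lt {n k r i : ℕ} (hr : 0 < r) (hn : k * r ≤ n) (hi : i < k) :
    (Finset.univ.filter (fun a : Fin n => blk k r a = i)).card = r := by
  rw [← Finset.card_map Fin.valEmbedding]
  have : (Finset.univ.filter (fun a : Fin n => blk k r a = i)).map Fin.valEmbedding
      = Finset.Ico (i * r) ((i + 1) * r) := by
    ext m
    simp only [Finset.mem_map, Finset.mem_filter, Finset.mem_univ, true_and, Finset.mem_Ico,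
      Fin.valEmbedding_apply]
    constructor
    · rintro ⟨a, ha, rfl⟩
      have : (a : ℕ) / r = i := by unfold blk at ha; omega
      rw [Nat.div_eq_iff hr] at this
      constructor
      · nlinarith
      · have := this.2; rw [add_mul]; omega
    · rintro ⟨h1, h2⟩
      have h3 : (i + 1) * r ≤ k * r := Nat.mul_le_mul_right _ hi
      refine ⟨⟨m, by omega⟩, ?_, rfl⟩
      have : m / r = i := by
        rw [Nat.div_eq_iff hr]; rw [add_mul] at h2; omega
      simp only [blk, this]; omega
  rw [this, Nat.card_Ico, add_mul]; omega

theorem card_blk_eq {n k r : ℕ} (hr : 0 < r) (hn : k * r ≤ n) :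
    (Finset.univ.filter (fun a : Fin n => blk k r a = k)).card = n - k * r := by
  rw [← Finset.card_map Fin.valEmbedding]
  have : (Finset.univ.filter (fun a : Fin n => blk k r a = k)).map Fin.valEmbedding
      = Finset.Ico (k * r) n := by
    ext m
    simp only [Finset.mem_map, Finset.mem_filter, Finset.mem_univ, true_and, Finset.mem_Ico,
      Fin.valEmbedding_apply]
    constructor
    · rintro ⟨a, ha, rfl⟩
      have : k ≤ (a : ℕ) / r := by unfold blk at ha; omega
      rw [Nat.le_div_iff_mul_le hr] at this
      exact ⟨this, a.2⟩
    · rintro ⟨h1, h2⟩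
      refine ⟨⟨m, h2⟩, ?_, rfl⟩
      have : k ≤ m / r := by rwa [Nat.le_div_iff_mul_le hr]
      simp only [blk]; omega
  rw [this, Nat.card_Ico]

theorem sum_block (f : ℕ → ℕ) (k m : ℕ) :
    ∑ s ∈ Finset.range (k * m), f s
      = ∑ i ∈ Finset.range k, ∑ u ∈ Finset.range m, f (i * m + u) := by
  induction k with
  | zero => simp
  | succ k ih =>
    rw [add_mul, one_mul, Finset.sum_range_add, ih, Finset.sum_range_succ]

theorem scl_block {k r i u : ℕ} (hi : i < k) (hu : u < 2 * r) :
    scl k r (i * (2 * r) + u)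
      = if u < i then (u, i) else if u < k then (k, k) else (i, k) := by
  have h1 : (i * (2 * r) + u) % (2 * r) = u := by
    rw [mul_comm, Nat.mul_add_mod, Nat.mod_eq_of_lt hu]
  have h2 : (i * (2 * r) + u) / (2 * r) = i := by
    rw [mul_comm, Nat.mul_add_div (by omega), Nat.div_eq_of_lt hu]; simp
  have h3 : i * (2 * r) + u < k * (2 * r) := by
    have : (i + 1) * (2 * r) ≤ k * (2 * r) := Nat.mul_le_mul_right _ hi
    rw [add_mul] at this; omega
  simp only [scl, h1, h2, h3, if_true]

/-- Sum over all symbols of a function vanishing on the free class. -/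
theorem sum_scl {n k r : ℕ} (hn : k * (2 * r) ≤ n) (g : ℕ × ℕ → ℕ) (hg : g (k, k) = 0) :
    ∑ s : Fin n, g (scl k r s) = ∑ i ∈ Finset.range k, ∑ u ∈ Finset.range (2 * r),
      g (if u < i then (u, i) else if u < k then (k, k) else (i, k)) := by
  rw [Fin.sum_univ_eq_sum_range (fun s => g (scl k r s)) n]
  obtain ⟨m, rfl⟩ := Nat.exists_eq_add_of_le hn
  rw [Finset.sum_range_add]
  have h0 : ∑ x ∈ Finset.range m, g (scl k r (k * (2 * r) + x)) = 0 := by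
    apply Finset.sum_eq_zero
    intro x _
    simp [scl, hg]
  rw [h0, add_zero, sum_block]
  apply Finset.sum_congr rfl
  intro i hi
  apply Finset.sum_congr rfl
  intro u hu
  rw [scl_block (Finset.mem_range.1 hi) (Finset.mem_range.1 hu)]

theorem sum_hw {n k r i : ℕ} (hn : k * (2 * r) ≤ n) (hi : i < k) (hk : k ≤ 2 * r) :
    ∑ s : Fin n, hw i (scl k r s) + 1 = 2 * r := by
  rw [sum_scl hn (hw i) (by simp [hw]; omega)]
  have h : ∀ j ∈ Finset.range k, ∑ u ∈ Finset.range (2 * r),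
      hw i (if u < j then (u, j) else if u < k then (k, k) else (j, k))
      = (if j = i then i + (2 * r - k) else 0) + (if i < j then 1 else 0) := by
    intro j hj
    have hj := Finset.mem_range.1 hj
    by_cases hji : j = i
    · subst hji
      obtain ⟨m, hm⟩ := Nat.exists_eq_add_of_le hk
      obtain ⟨l, hl⟩ := Nat.exists_eq_add_of_lt hj
      rw [hm, Finset.sum_range_add]
      have e1 : ∑ x ∈ Finset.range m, hw j (if k + x < j then (k + x, j) else
          if k + x < k then (k, k) else (j, k)) = m := by
        rw [Finset.sum_congr rfl (g := fun _ => 1)]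
        · simp
        · intro x _
          rw [if_neg (by omega), if_neg (by omega)]; simp [hw]
      have e2 : ∑ x ∈ Finset.range k, hw j (if x < j then (x, j) else
          if x < k then (k, k) else (j, k)) = j := by
        have : ∀ x ∈ Finset.range k, hw j (if x < j then (x, j) else
          if x < k then (k, k) else (j, k)) = if x < j then 1 else 0 := by
          intro x hx
          have hx := Finset.mem_range.1 hx
          by_cases h : x < j
          · simp [h, hw]
          · simp [h, hw, hx]; omega
        rw [Finset.sum_congr rfl this, ← Finset.card_filter]
        have : (Finset.range k).filter (fun x => x < j) = Finset.range j := by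
          ext x; simp; omega
        rw [this]; simp
      rw [e1, e2]; simp
    · have : ∀ u ∈ Finset.range (2 * r),
        hw i (if u < j then (u, j) else if u < k then (k, k) else (j, k))
          = if u = i then (if i < j then 1 else 0) else 0 := by
        intro u hu
        unfold hw
        by_cases h : u < j
        · by_cases h2 : u = i
          · subst h2; simp [h]
          · simp [h, h2, hji]
        · by_cases h3 : u < k
          · simp only [h, h3, if_true, if_false]; split_ifs <;> omega
          · simp only [h, h3, if_false]; split_ifs <;> omega
      rw [Finset.sum_congr rfl this, Finset.sum_ite_eq']
      rw [if_neg hji, if_pos (Finset.mem_range.2 (by omega))]; simp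
  rw [Finset.sum_congr rfl h, Finset.sum_add_distrib, Finset.sum_ite_eq', ← Finset.card_filter]
  have : (Finset.range k).filter (fun x => i < x) = Finset.Ico (i + 1) k := by
    ext x; simp; omega
  rw [this, Nat.card_Ico, if_pos (Finset.mem_range.2 hi)]
  omega

theorem upper_bound {n k r : ℕ} (hr : 0 < r) (hn : k * (2 * r) ≤ n) (hk : k ≤ 2 * r)
    (S : Fin n → Fin n → Fin n) (rs es : Fin n)
    (hS : ∀ a b, a ≠ rs → S a b ≠ es → scl k r (S a b) = ccl k (blk k r a) (blk k r b))
    (T : Finset (Fin n × Fin n))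
    (hT : ∀ p ∈ T, ∀ q ∈ T, p ≠ q → p.1 ≠ q.1 ∧ p.2 ≠ q.2 ∧ S p.1 p.2 ≠ S q.1 q.2) :
    k + 4 * T.card ≤ 4 * n + 8 := by
  classical
  let T' := T.filter (fun p => ¬ (p.1 = rs) ∧ ¬ (S p.1 p.2 = es))
  have hsub : T' ⊆ T := Finset.filter_subset _ _
  have i1 : Set.InjOn (fun p : Fin n × Fin n => p.1) T := by
    intro p hp q hq h
    by_contra hne; exact (hT p hp q hq hne).1 h
  have i2 : Set.InjOn (fun p : Fin n × Fin n => p.2) T := by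
    intro p hp q hq h
    by_contra hne; exact (hT p hp q hq hne).2.1 h
  have i3 : Set.InjOn (fun p : Fin n × Fin n => S p.1 p.2) T := by
    intro p hp q hq h
    by_contra hne; exact (hT p hp q hq hne).2.2 h
  have j1 := i1.mono (Finset.coe_subset.2 hsub)
  have j2 := i2.mono (Finset.coe_subset.2 hsub)
  have j3 := i3.mono (Finset.coe_subset.2 hsub)
  have c1 : (T.filter (fun p => p.1 = rs)).card ≤ 1 := by
    rw [Finset.card_le_one]
    intro p hp q hq
    simp only [Finset.mem_filter] at hp hq
    exact i1 hp.1 hq.1 (hp.2.trans hq.2.symm)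
  have c2 : (T.filter (fun p => S p.1 p.2 = es)).card ≤ 1 := by
    rw [Finset.card_le_one]
    intro p hp q hq
    simp only [Finset.mem_filter] at hp hq
    exact i3 hp.1 hq.1 (hp.2.trans hq.2.symm)
  have c3 : T.card ≤ T'.card + 2 := by
    have : T ⊆ T' ∪ (T.filter (fun p => p.1 = rs) ∪ T.filter (fun p => S p.1 p.2 = es)) := by
      intro p hp
      simp only [T', Finset.mem_union, Finset.mem_filter]
      tauto
    have h1 := Finset.card_le_card this
    have h2 := Finset.card_union_le T' (T.filter (fun p => p.1 = rs) ∪ T.filter (fun p => S p.1 p.2 = es))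
    have h3 := Finset.card_union_le (T.filter (fun p => p.1 = rs)) (T.filter (fun p => S p.1 p.2 = es))
    omega
  let MR := (T'.image (fun p => p.1))ᶜ
  let MC := (T'.image (fun p => p.2))ᶜ
  let MS := (T'.image (fun p => S p.1 p.2))ᶜ
  have m1 : MR.card = n - T'.card := by
    simp only [MR]; rw [Finset.card_compl, Finset.card_image_of_injOn j1, Fintype.card_fin]
  have m2 : MC.card = n - T'.card := by
    simp only [MC]; rw [Finset.card_compl, Finset.card_image_of_injOn j2, Fintype.card_fin]
  have m3 : MS.card = n - T'.card := by
    simp only [MS]; rw [Finset.card_compl, Finset.card_image_of_injOn j3, Fintype.card_fin]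
  have m4 : T'.card ≤ n := by
    rw [← Finset.card_image_of_injOn j1]
    exact (Finset.card_le_univ _).trans_eq (Fintype.card_fin n)
  have key : Finset.range k ⊆ (MR.image (fun a : Fin n => blk k r a) ∪
      MC.image (fun a : Fin n => blk k r a)) ∪
      (MS.image (fun s : Fin n => (scl k r s).1) ∪ MS.image (fun s : Fin n => (scl k r s).2)) := by
    intro i hi
    have hi := Finset.mem_range.1 hi
    by_contra hcon
    simp only [Finset.mem_union, Finset.mem_image, not_or, not_exists, not_and] at hcon
    obtain ⟨⟨n1, n2⟩, n3, n4⟩ := hcon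
    have e1 : ∑ p ∈ T', (if blk k r p.1 = i then 1 else 0) = r := by
      rw [← Finset.sum_image (f := fun a : Fin n => if blk k r a = i then 1 else 0) (g := fun p : Fin n × Fin n => p.1) j1]
      rw [Finset.sum_subset (Finset.subset_univ _), ← Finset.card_filter]
      · exact card_blk_lt hr (by nlinarith) hi
      · intro a _ ha
        exact if_neg (n1 a (Finset.mem_compl.2 ha))
    have e2 : ∑ p ∈ T', (if blk k r p.2 = i then 1 else 0) = r := by
      rw [← Finset.sum_image (f := fun a : Fin n => if blk k r a = i then 1 else 0) (g := fun p : Fin n × Fin n => p.2) j2]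
      rw [Finset.sum_subset (Finset.subset_univ _), ← Finset.card_filter]
      · exact card_blk_lt hr (by nlinarith) hi
      · intro a _ ha
        exact if_neg (n2 a (Finset.mem_compl.2 ha))
    have e3 : ∑ p ∈ T', hw i (scl k r (S p.1 p.2)) + 1 = 2 * r := by
      rw [← Finset.sum_image (f := fun s : Fin n => hw i (scl k r s)) (g := fun p : Fin n × Fin n => S p.1 p.2) j3]
      rw [Finset.sum_subset (Finset.subset_univ _)]
      · exact sum_hw hn hi hk
      · intro s _ hs
        have := n3 s (Finset.mem_compl.2 hs)
        have := n4 s (Finset.mem_compl.2 hs)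
        simp [hw, *]
    have e4 : (∑ p ∈ T', hw i (scl k r (S p.1 p.2))) % 2 =
        (∑ p ∈ T', ((if blk k r p.1 = i then 1 else 0) + (if blk k r p.2 = i then 1 else 0))) % 2 := by
      rw [Finset.sum_nat_mod, Finset.sum_nat_mod (f := fun p : Fin n × Fin n =>
        ((if blk k r p.1 = i then 1 else 0) + (if blk k r p.2 = i then 1 else 0)))]
      congr 1
      apply Finset.sum_congr rfl
      intro p hp
      have hp := (Finset.mem_filter.1 hp).2
      rw [hS p.1 p.2 hp.1 hp.2]
      unfold hw ccl
      generalize blk k r p.1 = x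
      generalize blk k r p.2 = y
      by_cases hxy : x = y
      · subst hxy
        have hki : k ≠ i := by omega
        by_cases hx : x = i
        · simp [hx, hki]
        · simp [hx, hki]
      · rw [if_neg hxy]
        simp only
        split_ifs <;> omega
    rw [Finset.sum_add_distrib, e1, e2] at e4
    omega
  have k1 := Finset.card_le_card key
  rw [Finset.card_range] at k1
  have k2 := Finset.card_union_le (MR.image (fun a : Fin n => blk k r a) ∪
      MC.image (fun a : Fin n => blk k r a))
      (MS.image (fun s : Fin n => (scl k r s).1) ∪ MS.image (fun s : Fin n => (scl k r s).2))
  have k3 := Finset.card_union_le (MR.image (fun a : Fin n => blk k r a))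
      (MC.image (fun a : Fin n => blk k r a))
  have k4 := Finset.card_union_le (MS.image (fun s : Fin n => (scl k r s).1))
    (MS.image (fun s : Fin n => (scl k r s).2))
  have k5 := Finset.card_image_le (s := MR) (f := fun a : Fin n => blk k r a)
  have k6 := Finset.card_image_le (s := MC) (f := fun a : Fin n => blk k r a)
  have k7 := Finset.card_image_le (s := MS) (f := fun s : Fin n => (scl k r s).1)
  have k8 := Finset.card_image_le (s := MS) (f := fun s : Fin n => (scl k r s).2)
  omega

theorem blk_le (k r m : ℕ) : blk k r m ≤ k := min_le_right _ _

/-- Number of symbols which are not free. -/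
theorem card_nonfree {n k r : ℕ} (hn : k * (2 * r) ≤ n) (hk : k ≤ 2 * r) :
    2 * (Finset.univ.filter (fun s : Fin n => scl k r s ≠ (k, k))).card + k * k + k
      = 4 * (k * r) := by
  have h1 : (Finset.univ.filter (fun s : Fin n => scl k r s ≠ (k, k))).card
      = ∑ i ∈ Finset.range k, (i + (2 * r - k)) := by
    rw [Finset.card_filter]
    rw [sum_scl hn (fun p => if p ≠ (k, k) then 1 else 0) (by simp)]
    apply Finset.sum_congr rfl
    intro i hi
    have hi := Finset.mem_range.1 hi
    obtain ⟨m, hm⟩ := Nat.exists_eq_add_of_le hk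
    rw [hm, Finset.sum_range_add]
    congr 1
    · have : ∀ x ∈ Finset.range k, (if (if x < i then (x, i) else
          if x < k then (k, k) else (i, k)) ≠ (k, k) then 1 else 0) = if x < i then 1 else 0 := by
        intro x hx
        have hx := Finset.mem_range.1 hx
        by_cases h : x < i
        · rw [if_pos h, if_pos h, if_pos]; simp; omega
        · rw [if_neg h, if_neg h, if_pos hx]; simp
      rw [Finset.sum_congr rfl this, ← Finset.card_filter]
      have : (Finset.range k).filter (fun x => x < i) = Finset.range i := by
        ext x; simp; omega
      rw [this]; simp
    · rw [Finset.sum_congr rfl (g := fun _ => 1)]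
      · simp
      · intro x _
        rw [if_neg (by omega : ¬ k + x < i), if_neg (by omega : ¬ k + x < k), if_pos]
        simp; omega
  rw [h1, Finset.sum_add_distrib]
  have h2 := Finset.sum_range_id_mul_two k
  simp only [Finset.sum_const, Finset.card_range, smul_eq_mul]
  obtain ⟨m, hm⟩ := Nat.exists_eq_add_of_le hk
  rw [show 2 * r - k = m by omega]
  rcases k with _ | k
  · simp
  · simp only [Nat.add_sub_cancel] at h2
    have : 4 * ((k + 1) * r) = 2 * ((k + 1) * (2 * r)) := by ring
    rw [this, hm]
    nlinarith

theorem card_pair_cells {n k r i j : ℕ} (hij : i < j) :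
    (Finset.univ.filter (fun p : Fin n × Fin n =>
      ccl k (blk k r p.1) (blk k r p.2) = (i, j))).card
    ≤ 2 * ((Finset.univ.filter (fun a : Fin n => blk k r a = i)).card *
      (Finset.univ.filter (fun a : Fin n => blk k r a = j)).card) := by
  have : (Finset.univ.filter (fun p : Fin n × Fin n =>
      ccl k (blk k r p.1) (blk k r p.2) = (i, j))) ⊆
    ((Finset.univ.filter (fun a : Fin n => blk k r a = i)) ×ˢ
      (Finset.univ.filter (fun a : Fin n => blk k r a = j))) ∪
    ((Finset.univ.filter (fun a : Fin n => blk k r a = j)) ×ˢ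
      (Finset.univ.filter (fun a : Fin n => blk k r a = i))) := by
    rintro ⟨a, b⟩ h
    simp only [Finset.mem_filter, Finset.mem_univ, true_and, Finset.mem_union,
      Finset.mem_product] at h ⊢
    unfold ccl at h
    split_ifs at h with h0
    · simp only [Prod.mk.injEq] at h; omega
    · simp only [Prod.mk.injEq] at h; omega
  refine (Finset.card_le_card this).trans ((Finset.card_union_le _ _).trans ?_)
  rw [Finset.card_product, Finset.card_product]
  rw [mul_comm (Finset.card (Finset.univ.filter (fun a : Fin n => blk k r a = j)))]
  omega

theorem card_free_cells {n k r : ℕ} (hr : 0 < r) (hn : k * r ≤ n) (rs : Fin n)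
    (hrs : blk k r rs = k) :
    (Finset.univ.filter (fun p : Fin n × Fin n =>
      p.1 ≠ rs ∧ blk k r p.1 = blk k r p.2)).card
    ≤ k * (r * r) + (n - k * r - 1) * (n - k * r) := by
  have : (Finset.univ.filter (fun p : Fin n × Fin n =>
      p.1 ≠ rs ∧ blk k r p.1 = blk k r p.2)) ⊆
    ((Finset.range k).biUnion (fun i => (Finset.univ.filter (fun a : Fin n => blk k r a = i)) ×ˢ
      (Finset.univ.filter (fun a : Fin n => blk k r a = i)))) ∪
    (((Finset.univ.filter (fun a : Fin n => blk k r a = k)).erase rs) ×ˢ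
      (Finset.univ.filter (fun a : Fin n => blk k r a = k))) := by
    rintro ⟨a, b⟩ h
    simp only [Finset.mem_filter, Finset.mem_univ, true_and, Finset.mem_union,
      Finset.mem_product, Finset.mem_biUnion, Finset.mem_range, Finset.mem_erase] at h ⊢
    rcases (blk_le k r a).lt_or_eq with h1 | h1
    · exact Or.inl ⟨_, h1, rfl, h.2.symm⟩
    · exact Or.inr ⟨⟨h.1, h1⟩, h.2.symm.trans h1⟩
  refine (Finset.card_le_card this).trans ((Finset.card_union_le _ _).trans ?_)
  apply Nat.add_le_add
  · refine Finset.card_biUnion_le.trans ?_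
    rw [Finset.sum_congr rfl (g := fun _ => r * r)]
    · simp
    · intro i hi
      rw [Finset.card_product, card_blk_lt hr hn (Finset.mem_range.1 hi)]
  · rw [Finset.card_product, Finset.card_erase_of_mem (by simpa using hrs), card_blk_eq hr hn]

theorem free_arith {n k r y nf : ℕ} (h1 : y + 1 + nf = n) (h2 : 2 * nf + k * k + k = 4 * (k * r))
    (h3 : 2 * (r * r) ≤ n) (h4 : k * r < n) :
    k * (r * r) + (n - k * r - 1) * (n - k * r) ≤ n * y + k * r := by
  obtain ⟨m, rfl⟩ := Nat.exists_eq_add_of_lt h4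
  rw [show k * r + m + 1 - k * r - 1 = m by omega, show k * r + m + 1 - k * r = m + 1 by omega]
  have h5 : k * (k + 1) * (2 * (r * r)) ≤ k * (k + 1) * (k * r + m + 1) :=
    Nat.mul_le_mul_left _ h3
  have h6 : (k * r + m + 1) * (2 * y + 2 + 4 * (k * r)) =
      (k * r + m + 1) * (2 * (k * r + m + 1) + k * k + k) := by
    congr 1; omega
  nlinarith

theorem construct {n k r : ℕ} (hr : 0 < r) (hk : k ≤ 2 * r) (hn : k * (2 * r) < n)
    (h2r : 2 * (r * r) ≤ n) (hD : k * (k * (n - 2 * (r * r))) + k * r ≤ n) :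
    ∃ (S : Fin n → Fin n → Fin n) (rs es : Fin n),
      (∀ s : Fin n,
        (Finset.univ.filter (fun p : Fin n × Fin n => S p.1 p.2 = s)).card = n) ∧
      (∀ a b, a ≠ rs → S a b ≠ es → scl k r (S a b) = ccl k (blk k r a) (blk k r b)) ∧
      (∀ m : Fin n, k * (2 * r) < m → S m m = m) := by
  classical
  have hkr : k * (2 * r) = 2 * (k * r) := by ring
  have hn' : k * r ≤ n := by omega
  have hn'' : k * (2 * r) ≤ n := hn.le
  let rs : Fin n := ⟨k * r, by omega⟩
  let es : Fin n := ⟨k * (2 * r), hn⟩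
  have hrs : blk k r rs = k := by
    simp only [blk, rs]; rw [Nat.mul_div_cancel _ hr]; simp
  have hes : scl k r es = (k, k) := by simp [scl, es]
  have hbig : ∀ m : ℕ, k * (2 * r) < m → scl k r m = (k, k) := by
    intro m hm; rw [scl, if_neg (by omega)]
  have hbigb : ∀ m : ℕ, k * (2 * r) < m → blk k r m = k := by
    intro m hm
    unfold blk
    apply min_eq_right
    rw [Nat.le_div_iff_mul_le hr]; omega
  let z : Fin n := ⟨0, by omega⟩
  let ca : Fin n × Fin n → (ℕ × ℕ) ⊕ ℕ := fun p =>
    if p.1 = p.2 ∧ k * (2 * r) < (p.1 : ℕ) then Sum.inr p.1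
      else Sum.inl (ccl k (blk k r p.1) (blk k r p.2))
  let cb : Fin n × Fin n → (ℕ × ℕ) ⊕ ℕ := fun p =>
    if p.2 = z ∧ k * (2 * r) < (p.1 : ℕ) then Sum.inr p.1 else Sum.inl (scl k r p.1)
  let G : Finset (Fin n × Fin n) := Finset.univ.filter (fun p => p.1 ≠ rs)
  let B : Finset (Fin n × Fin n) := {es} ×ˢ Finset.univ
  have hBmem : ∀ p, p ∈ B ↔ p.1 = es := by intro p; simp only [B, Finset.mem_product, Finset.mem_singleton, Finset.mem_univ, and_true]
  have hBcard : B.card = n := by simp [B]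
  let d : (ℕ × ℕ) ⊕ ℕ → ℕ := fun q => (if q = Sum.inl (k, k) then k * r else 0) +
    ∑ i ∈ Finset.range k, (if q = Sum.inl (i, k) then k * (n - 2 * (r * r)) else 0)
  have hd2 : ∀ Q' : Finset ((ℕ × ℕ) ⊕ ℕ), ∑ q ∈ Q', d q ≤ B.card := by
    intro Q'
    rw [hBcard]
    simp only [d]
    rw [Finset.sum_add_distrib, Finset.sum_comm]
    have e1 : ∑ q ∈ Q', (if q = Sum.inl (k, k) then k * r else 0) ≤ k * r := by
      rw [Finset.sum_ite_eq']; split_ifs <;> simp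
    have e2 : ∑ i ∈ Finset.range k, ∑ q ∈ Q',
        (if q = Sum.inl (i, k) then k * (n - 2 * (r * r)) else 0)
        ≤ ∑ i ∈ Finset.range k, k * (n - 2 * (r * r)) := by
      apply Finset.sum_le_sum
      intro i _
      rw [Finset.sum_ite_eq']; split_ifs <;> simp
    simp only [Finset.sum_const, Finset.card_range, smul_eq_mul] at e2
    omega
  have hd1 : ∀ q, (G.filter (fun a => ca a = q)).card
      ≤ (Finset.univ.filter (fun b => b ∉ B ∧ cb b = q)).card + d q := by
    rintro (⟨i, j⟩ | m)
    · by_cases hfree : i = k ∧ j = k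
      · obtain ⟨rfl, hji⟩ := hfree
        obtain rfl : i = j := hji.symm
        have hdk : d (Sum.inl (i, i)) = i * r := by
          simp only [d, if_true]
          rw [Finset.sum_eq_zero]
          · simp
          · intro x hx
            have hx := Finset.mem_range.1 hx
            rw [if_neg]; simp; omega
        rw [hdk]
        let M : Finset (Fin n) := Finset.univ.filter (fun m => i * (2 * r) < (m : ℕ))
        let Dc : Finset (Fin n × Fin n) := M.image (fun m => (m, m))
        let Dt : Finset (Fin n × Fin n) := M.image (fun m => (m, z))
        let X := Finset.univ.filter (fun p : Fin n × Fin n =>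
          p.1 ≠ rs ∧ blk i r p.1 = blk i r p.2)
        let Y0 := Finset.univ.filter (fun s : Fin n => s ≠ es ∧ scl i r s = (i, i))
        let Y : Finset (Fin n × Fin n) := Y0 ×ˢ Finset.univ
        have cDc : Dc.card = M.card := Finset.card_image_of_injective _ (by
          intro x y h; exact (Prod.mk.inj h).1)
        have cDt : Dt.card = M.card := Finset.card_image_of_injective _ (by
          intro x y h; exact (Prod.mk.inj h).1)
        have sDc : Dc ⊆ X := by
          intro p hp
          obtain ⟨m, hm, rfl⟩ := Finset.mem_image.1 hp
          have hm := (Finset.mem_filter.1 hm).2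
          simp only [X, Finset.mem_filter, Finset.mem_univ, true_and, and_true]
          intro h
          rw [h] at hm; simp only [rs] at hm; omega
        have sDt : Dt ⊆ Y := by
          intro p hp
          obtain ⟨m, hm, rfl⟩ := Finset.mem_image.1 hp
          have hm := (Finset.mem_filter.1 hm).2
          simp only [Y, Y0, Finset.mem_product, Finset.mem_filter, Finset.mem_univ, true_and, and_true]
          refine ⟨?_, hbig _ hm⟩
          intro h
          rw [h] at hm; simp only [es] at hm; omega
        have s1 : (G.filter (fun a => ca a = Sum.inl (i, i))) ⊆ X \ Dc := by
          intro p hp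
          simp only [G, Finset.mem_filter, Finset.mem_univ, true_and, ca] at hp
          obtain ⟨hp1, hp2⟩ := hp
          split_ifs at hp2 with hc
          simp only [Sum.inl.injEq] at hp2
          have hpe : blk i r p.1 = blk i r p.2 := by
            by_contra hne
            simp only [ccl, if_neg hne, Prod.mk.injEq] at hp2
            omega
          rw [Finset.mem_sdiff]
          refine ⟨by simp [X, hp1, hpe], ?_⟩
          intro hD
          obtain ⟨m, hm, rfl⟩ := Finset.mem_image.1 hD
          exact hc ⟨rfl, (Finset.mem_filter.1 hm).2⟩
        have s2 : Y \ Dt ⊆ (Finset.univ.filter (fun b => b ∉ B ∧ cb b = Sum.inl (i, i))) := by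
          intro p hp
          obtain ⟨hp1, hp2⟩ := Finset.mem_sdiff.1 hp
          simp only [Y, Y0, Finset.mem_product, Finset.mem_filter, Finset.mem_univ, true_and,
            and_true] at hp1
          simp only [Finset.mem_filter, Finset.mem_univ, true_and, hBmem, cb]
          refine ⟨hp1.1, ?_⟩
          rw [if_neg, hp1.2]
          rintro ⟨h1, h2⟩
          apply hp2
          refine Finset.mem_image.2 ⟨p.1, by simp [M, h2], ?_⟩
          rw [← h1]
        have t1 := Finset.card_le_card s1
        have t2 := Finset.card_le_card s2
        rw [Finset.card_sdiff_of_subset sDc] at t1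
        rw [Finset.card_sdiff_of_subset sDt] at t2
        have t3 := Finset.card_le_card sDc
        have t4 := Finset.card_le_card sDt
        have cX : X.card ≤ _ := card_free_cells hr hn' rs hrs
        have cY : Y.card = n * Y0.card := by
          simp [Y, Finset.card_product, mul_comm]
        have cY0 : Y0.card + 1 +
            (Finset.univ.filter (fun s : Fin n => scl i r s ≠ (i, i))).card = n := by
          have e1 : Y0 = (Finset.univ.filter (fun s : Fin n => scl i r s = (i, i))).erase es := by
            ext s; simp [Y0]
          have e2 : es ∈ (Finset.univ.filter (fun s : Fin n => scl i r s = (i, i))) := by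
            simp [hes]
          rw [e1, Finset.card_erase_add_one e2]
          have := Finset.card_filter_add_card_filter_not (s := (Finset.univ : Finset (Fin n)))
            (fun s : Fin n => scl i r s = (i, i))
          simpa using this
        have := free_arith cY0 (card_nonfree hn'' hk) h2r (by omega)
        omega
      · by_cases hij : i < j ∧ j ≤ k
        · obtain ⟨hij, hjk⟩ := hij
          have u1 : (G.filter (fun a => ca a = Sum.inl (i, j))).card ≤
              2 * ((Finset.univ.filter (fun a : Fin n => blk k r a = i)).card *
                (Finset.univ.filter (fun a : Fin n => blk k r a = j)).card) := by
            refine le_trans (Finset.card_le_card ?_) (card_pair_cells hij)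
            intro p hp
            simp only [G, Finset.mem_filter, Finset.mem_univ, true_and, ca] at hp ⊢
            obtain ⟨_, hp2⟩ := hp
            split_ifs at hp2 with hc
            simpa using hp2
          rw [card_blk_lt hr hn' (by omega)] at u1
          have u2 : n * (Finset.univ.filter (fun s : Fin n => scl k r s = (i, j))).card ≤
              (Finset.univ.filter (fun b => b ∉ B ∧ cb b = Sum.inl (i, j))).card := by
            have : ((Finset.univ.filter (fun s : Fin n => scl k r s = (i, j))) ×ˢ
              (Finset.univ : Finset (Fin n))) ⊆
                (Finset.univ.filter (fun b => b ∉ B ∧ cb b = Sum.inl (i, j))) := by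
              intro p hp
              simp only [Finset.mem_product, Finset.mem_filter, Finset.mem_univ, true_and,
                and_true] at hp
              simp only [Finset.mem_filter, Finset.mem_univ, true_and, hBmem, cb]
              have hne : ((i, j) : ℕ × ℕ) ≠ (k, k) := by simp; omega
              refine ⟨?_, ?_⟩
              · intro h; rw [h, hes] at hp; exact hne hp.symm
              · rw [if_neg, hp]
                rintro ⟨_, h⟩
                rw [hbig _ h] at hp; exact hne hp.symm
            have := Finset.card_le_card this
            rw [Finset.card_product] at this
            simpa [mul_comm] using this
          rcases hjk.lt_or_eq with hjk | rfl
          · rw [card_blk_lt hr hn' hjk] at u1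
            have hlt : j * (2 * r) + i < k * (2 * r) := by
              have : (j + 1) * (2 * r) ≤ k * (2 * r) := Nat.mul_le_mul_right _ hjk
              rw [add_mul] at this; omega
            have u3 : 1 ≤ (Finset.univ.filter (fun s : Fin n => scl k r s = (i, j))).card := by
              rw [Nat.one_le_iff_ne_zero, ← Nat.pos_iff_ne_zero, Finset.card_pos]
              refine ⟨⟨j * (2 * r) + i, by omega⟩, ?_⟩
              simp only [Finset.mem_filter, Finset.mem_univ, true_and]
              rw [scl_block hjk (by omega), if_pos hij]
            nlinarith
          · rw [card_blk_eq hr hn'] at u1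
            have u3 : 2 * r - j ≤
                (Finset.univ.filter (fun s : Fin n => scl j r s = (i, j))).card := by
              have hlt : i * (2 * r) + 2 * r ≤ j * (2 * r) := by
                have : (i + 1) * (2 * r) ≤ j * (2 * r) := Nat.mul_le_mul_right _ hij
                rw [add_mul] at this; omega
              have := Finset.card_le_card_of_injOn
                (s := (Finset.univ : Finset (Fin (2 * r - j))))
                (t := (Finset.univ.filter (fun s : Fin n => scl j r s = (i, j))))
                (fun u => ⟨i * (2 * r) + (j + u), by omega⟩) (by
                  intro u _
                  simp only [Finset.coe_filter, Finset.mem_univ, true_and, Set.mem_ofPred_eq]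
                  rw [scl_block hij (by omega), if_neg (by omega), if_neg (by omega)]) (by
                  intro u _ v _ huv
                  simp only [Fin.mk.injEq] at huv
                  ext; omega)
              simpa using this
            have hdk : j * (n - 2 * (r * r)) ≤ d (Sum.inl (i, j)) := by
              simp only [d]
              refine le_trans ?_ (Nat.le_add_left _ _)
              have := Finset.single_le_sum (s := Finset.range j) (f := fun x =>
                if (Sum.inl (i, j) : (ℕ × ℕ) ⊕ ℕ) = Sum.inl (x, j) then
                  j * (n - 2 * (r * r)) else 0) (fun _ _ => Nat.zero_le _)
                (Finset.mem_range.2 hij)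
              simpa using this
            have u4 : n * (2 * r - j) ≤ _ := (Nat.mul_le_mul_left n u3).trans u2
            refine u1.trans (le_trans ?_ (Nat.add_le_add u4 hdk))
            zify [hk, hn', h2r]
            nlinarith
        · have : (G.filter (fun a => ca a = Sum.inl (i, j))) = ∅ := by
            rw [Finset.filter_eq_empty_iff]
            intro p _ hp
            simp only [ca] at hp
            split_ifs at hp with hc
            simp only [Sum.inl.injEq, ccl] at hp
            have := blk_le k r p.1
            have := blk_le k r p.2
            split_ifs at hp with hc2
            · simp only [Prod.mk.injEq] at hp; omega
            · simp only [Prod.mk.injEq] at hp; omega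
          rw [this]; simp
    · by_cases hm : k * (2 * r) < m ∧ m < n
      · have v1 : (G.filter (fun a => ca a = Sum.inr m)).card ≤ 1 := by
          rw [Finset.card_le_one]
          have : ∀ p ∈ (G.filter (fun a => ca a = Sum.inr m)), p = (⟨m, hm.2⟩, ⟨m, hm.2⟩) := by
            intro p hp
            have hp := (Finset.mem_filter.1 hp).2
            simp only [ca] at hp
            split_ifs at hp with hc
            simp only [Sum.inr.injEq] at hp
            obtain ⟨p1, p2⟩ := p
            simp only at hc hp
            ext
            · exact hp
            · rw [← hc.1]; exact hp
          intro p hp q hq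
          rw [this p hp, this q hq]
        have v2 : 1 ≤ (Finset.univ.filter (fun b => b ∉ B ∧ cb b = Sum.inr m)).card := by
          rw [Nat.one_le_iff_ne_zero, ← Nat.pos_iff_ne_zero, Finset.card_pos]
          refine ⟨(⟨m, hm.2⟩, z), ?_⟩
          simp only [Finset.mem_filter, Finset.mem_univ, true_and, hBmem, cb, es, Fin.mk.injEq]
          refine ⟨by omega, ?_⟩
          rw [if_pos hm.1]
        omega
      · have : (G.filter (fun a => ca a = Sum.inr m)) = ∅ := by
          rw [Finset.filter_eq_empty_iff]
          intro p _ hp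
          simp only [ca] at hp
          split_ifs at hp with hc
          simp only [Sum.inr.injEq] at hp
          have := p.1.2
          omega
        rw [this]; simp
  obtain ⟨e, he⟩ := fill_lemma rfl G B ca cb d hd1 hd2
  refine ⟨fun a b => (e (a, b)).1, rs, es, ?_, ?_, ?_⟩
  · intro s
    have : (Finset.univ.filter (fun p : Fin n × Fin n => (e (p.1, p.2)).1 = s)).card
        = (({s} : Finset (Fin n)) ×ˢ (Finset.univ : Finset (Fin n))).card := by
      apply Finset.card_bij (fun p _ => e p)
      · intro p hp
        simpa only [Finset.mem_product, Finset.mem_filter, Finset.mem_singleton, Finset.mem_univ, and_true, true_and] using hp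
      · intro p _ q _ h
        exact e.injective h
      · intro q hq
        refine ⟨e.symm q, ?_, by simp⟩
        simpa only [Finset.mem_product, Finset.mem_filter, Finset.mem_singleton, Finset.mem_univ, and_true, true_and, Prod.mk.eta, Equiv.apply_symm_apply] using hq
    rw [this]; simp
  · intro a b ha hs
    have := he (a, b) (by simp [G, ha])
    rcases this with h | h
    · exact absurd ((hBmem _).1 h.2) hs
    · simp only [ca, cb] at h
      split_ifs at h with h1 h2 h2
      · simp only [Sum.inr.injEq] at h
        rw [hbig _ h1.2, ← h2.1]
        simp [ccl]
      · simpa using h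
  · intro m hm
    have hmr : m ≠ rs := by
      intro h; rw [h] at hm; simp only [rs] at hm; omega
    have := he (m, m) (by simp [G, hmr])
    have hca : ca (m, m) = Sum.inr (m : ℕ) := by simp [ca, hm]
    rw [hca] at this
    rcases this with h | h
    · exfalso; apply h.1; simp [d]
    · simp only [cb] at h
      split_ifs at h
      simp only [Sum.inr.injEq] at h
      exact Fin.ext h

theorem eventually_params (ε : ℝ) (hε : 0 < ε) : ∃ N : ℕ, ∀ n : ℕ, N ≤ n →
    12 ≤ Real.log n ∧ 100 * (Real.log n) ^ 2 ≤ Real.sqrt n ∧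
    10 * Real.log n ≤ ε * Real.sqrt n := by
  have h1 : Filter.Tendsto (fun n : ℕ => Real.log n) Filter.atTop Filter.atTop :=
    Real.tendsto_log_atTop.comp tendsto_natCast_atTop_atTop
  have hs : Filter.Tendsto (fun n : ℕ => Real.sqrt n) Filter.atTop Filter.atTop :=
    Real.tendsto_sqrt_atTop.comp tendsto_natCast_atTop_atTop
  have h2 := (Real.isLittleO_pow_log_id_atTop (n := 2)).comp_tendsto hs
  have h3 := (h2.def (by norm_num : (0 : ℝ) < 1 / 400))
  have h4 := (h2.def (by positivity : (0 : ℝ) < ε / 40))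
  have h5 := h1.eventually_ge_atTop 12
  have := h5.and (h3.and h4)
  rw [Filter.eventually_atTop] at this
  obtain ⟨N, hN⟩ := this
  refine ⟨N, fun n hn => ?_⟩
  obtain ⟨a1, a2, a3⟩ := hN n hn
  simp only [Function.comp, id, Real.norm_eq_abs, abs_pow, sq_abs,
    abs_of_nonneg (Real.sqrt_nonneg _)] at a2 a3
  rw [Real.log_sqrt (by positivity)] at a2 a3
  refine ⟨a1, by nlinarith, by nlinarith⟩

theorem main_params (ε : ℝ) (n : ℕ) (h1 : 12 ≤ Real.log n)
    (h2 : 100 * (Real.log n) ^ 2 ≤ Real.sqrt n) (h3 : 10 * Real.log n ≤ ε * Real.sqrt n) :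
    ∃ k r : ℕ, 0 < r ∧ k ≤ 2 * r ∧ k * (2 * r) < n ∧ 2 * (r * r) ≤ n ∧
      k * (k * (n - 2 * (r * r))) + k * r ≤ n ∧ Real.log n - 1 ≤ k ∧
      ((k * (2 * r) + 1 : ℕ) : ℝ) ≤ ε * n := by
  set L := Real.log n with hL
  set s := Real.sqrt n with hs
  have hss : s * s = n := Real.mul_self_sqrt (by positivity)
  have hs1 : 14400 ≤ s := by nlinarith
  refine ⟨⌊L⌋₊, Nat.sqrt (n / 2), ?_⟩
  set k := ⌊L⌋₊ with hk
  set r := Nat.sqrt (n / 2) with hr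
  have hkL : (k : ℝ) ≤ L := Nat.floor_le (by linarith)
  have hkL2 : L < k + 1 := Nat.lt_floor_add_one L
  have r1 : r * r ≤ n / 2 := Nat.sqrt_le _
  have r2 : n / 2 ≤ r * r + r + r := Nat.sqrt_le_add _
  have r3 : 2 * (r * r) ≤ n := by omega
  have r4 : n - 2 * (r * r) ≤ 4 * r + 1 := by omega
  have r5 : (r : ℝ) ≤ s := by
    have : (2 * (r * r) : ℝ) ≤ n := by exact_mod_cast r3
    nlinarith
  have r6 : s ≤ 2 * r := by
    by_contra hcon
    push Not at hcon
    have : (n : ℝ) ≤ 2 * (r * r) + (4 * r + 1) := by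
      have : n ≤ 2 * (r * r) + (4 * r + 1) := by omega
      exact_mod_cast this
    nlinarith
  have hk0 : (0 : ℝ) ≤ k := by positivity
  have hkk : (k : ℝ) * k ≤ L ^ 2 := by nlinarith
  have hr0 : (1 : ℝ) ≤ r := by linarith
  have hk1 : (1 : ℝ) ≤ k := by linarith
  have hLL : 12 * L ≤ L ^ 2 := by nlinarith
  refine ⟨?_, ?_, ?_, r3, ?_, by linarith, ?_⟩
  · exact_mod_cast (by linarith : (0 : ℝ) < r)
  · have : (k : ℝ) ≤ 2 * r := by nlinarith
    exact_mod_cast this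
  · have : (k : ℝ) * (2 * r) < n := by
      have : (k : ℝ) * r ≤ L * s := by gcongr
      nlinarith
    exact_mod_cast this
  · have e1 : k * (k * (n - 2 * (r * r))) + k * r ≤ k * (k * (4 * r + 1)) + k * r := by
      gcongr
    refine e1.trans ?_
    have : (k : ℝ) * (k * (4 * r + 1)) + k * r ≤ n := by
      have e2 : (k : ℝ) * k * (5 * s) ≤ L ^ 2 * (5 * s) := by gcongr
      have e3 : (k : ℝ) * k * (4 * r + 1) ≤ k * k * (5 * s) := by gcongr; linarith
      have e4 : (k : ℝ) * r ≤ L * s := by gcongr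
      nlinarith
    exact_mod_cast this
  · push_cast
    have e4 : (k : ℝ) * r ≤ L * s := by gcongr
    have e5 : 10 * L * s ≤ ε * s * s := by gcongr
    nlinarith

/-- For every `ε > 0` and all sufficiently large `n`, there exists an `n × n` array
filled with the symbols `1, …, n` in which each symbol occurs exactly `n` times, which has no
partial transversal of size larger than `n - (1/42)·ln n`, but which does have a partial
transversal of size at least `(1 - ε)·n`. -/
theorem stein_counterexample_with_large_transversal :
    ∀ ε : ℝ, 0 < ε →
      ∃ N : ℕ, ∀ n : ℕ, N ≤ n →
        ∃ S : Fin n → Fin n → Fin n,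
          (∀ s : Fin n,
            (Finset.univ.filter (fun p : Fin n × Fin n => S p.1 p.2 = s)).card = n) ∧
          (∀ T : Finset (Fin n × Fin n),
            (∀ p ∈ T, ∀ q ∈ T, p ≠ q → p.1 ≠ q.1 ∧ p.2 ≠ q.2 ∧ S p.1 p.2 ≠ S q.1 q.2) →
            (T.card : ℝ) ≤ (n : ℝ) - Real.log n / 42) ∧
          (∃ T : Finset (Fin n × Fin n),
            (∀ p ∈ T, ∀ q ∈ T, p ≠ q → p.1 ≠ q.1 ∧ p.2 ≠ q.2 ∧ S p.1 p.2 ≠ S q.1 q.2) ∧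
            (1 - ε) * (n : ℝ) ≤ (T.card : ℝ)) := by
  intro ε hε
  obtain ⟨N, hN⟩ := eventually_params ε hε
  refine ⟨N, fun n hn => ?_⟩
  obtain ⟨h1, h2, h3⟩ := hN n hn
  obtain ⟨k, r, hr, hk, hkn, h2r, hD, hlog, hdiag⟩ := main_params ε n h1 h2 h3
  obtain ⟨S, rs, es, hS1, hS2, hS3⟩ := construct hr hk hkn h2r hD
  refine ⟨S, hS1, ?_, ?_⟩
  · intro T hT
    have hub := upper_bound hr hkn.le hk S rs es hS2 T hT
    have hub' : (k : ℝ) + 4 * T.card ≤ 4 * n + 8 := by exact_mod_cast hub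
    linarith
  · refine ⟨(Finset.univ.filter (fun m : Fin n => k * (2 * r) < (m : ℕ))).image
      (fun m => (m, m)), ?_, ?_⟩
    · intro p hp q hq hpq
      obtain ⟨a, ha, rfl⟩ := Finset.mem_image.1 hp
      obtain ⟨b, hb, rfl⟩ := Finset.mem_image.1 hq
      have ha := (Finset.mem_filter.1 ha).2
      have hb := (Finset.mem_filter.1 hb).2
      have hab : a ≠ b := fun h => hpq (by rw [h])
      simp only
      rw [hS3 a ha, hS3 b hb]
      exact ⟨hab, hab, hab⟩
    · rw [Finset.card_image_of_injective _ (by intro x y h; exact (Prod.mk.inj h).1)]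
      have : (Finset.univ.filter (fun m : Fin n => k * (2 * r) < (m : ℕ))).card
          = n - (k * (2 * r) + 1) := by
        have := Fin.card_Ioi (⟨k * (2 * r), hkn⟩ : Fin n)
        have e : (Finset.univ.filter (fun m : Fin n => k * (2 * r) < (m : ℕ)))
            = Finset.Ioi (⟨k * (2 * r), hkn⟩ : Fin n) := by
          ext m; simp [Fin.lt_def]
        rw [e, this]; simp only; omega
      rw [this, Nat.cast_sub (by omega)]
      linarith
end

section
/- For all sufficiently large n, there exists an edge-colouring of the complete graph K_n on n vertices in which every colour is used on at most n/2 − 1 edges, and in which there is no rainbow path with more than n − (1/42)·ln n edges. (This disproves Hahn's conjecture that every edge-colouring of K_n with at most n/2 − 1 edges of each colour contains a rainbow path of length n − 1.) -/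
/-- The colour of the pair `(u, v)`, `u < v`. -/
def hcol (n m k h : ℕ) (e : ℕ × ℕ) : ℕ × ℕ × ℕ :=
  if e.2 / m < k then
    (if e.1 / m = e.2 / m then (0, e.1 / m / 2, 0) else (1, e.1 / m, e.2 / m))
  else if e.1 / m < k then
    (if ((e.1 % m) * (n - k * m) + (e.2 - k * m)) / h < 2 * m - k then
      (2, e.1 / m, ((e.1 % m) * (n - k * m) + (e.2 - k * m)) / h)
    else (3, 0, 0))
  else (4, e.1, e.2)

lemma hcol_zero {n m k h : ℕ} {e : ℕ × ℕ} {a b : ℕ} (H : hcol n m k h e = (0, a, b)) :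
    e.2 / m < k ∧ e.1 / m = e.2 / m ∧ e.1 / m / 2 = a := by
  unfold hcol at H
  split_ifs at H <;> simp_all

lemma hcol_one {n m k h : ℕ} {e : ℕ × ℕ} {a b : ℕ} (H : hcol n m k h e = (1, a, b)) :
    e.1 / m = a ∧ e.2 / m = b := by
  unfold hcol at H
  split_ifs at H <;> simp_all

lemma hcol_two {n m k h : ℕ} {e : ℕ × ℕ} {a b : ℕ} (H : hcol n m k h e = (2, a, b)) :
    ¬ e.2 / m < k ∧ e.1 / m = a ∧ ((e.1 % m) * (n - k * m) + (e.2 - k * m)) / h = b := by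
  unfold hcol at H
  split_ifs at H <;> simp_all

lemma hcol_three {n m k h : ℕ} {e : ℕ × ℕ} {a b : ℕ} (H : hcol n m k h e = (3, a, b)) :
    ¬ e.2 / m < k ∧ e.1 / m < k ∧
      2 * m - k ≤ ((e.1 % m) * (n - k * m) + (e.2 - k * m)) / h := by
  unfold hcol at H
  split_ifs at H <;> simp_all

lemma hcol_four {n m k h : ℕ} {e : ℕ × ℕ} {a b : ℕ} (H : hcol n m k h e = (4, a, b)) :
    e = (a, b) := by
  unfold hcol at H
  split_ifs at H <;> simp_all [Prod.ext_iff]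

lemma hcol_big {n m k h : ℕ} {e : ℕ × ℕ} {t a b : ℕ} (H : hcol n m k h e = (t + 5, a, b)) :
    False := by
  unfold hcol at H
  split_ifs at H <;> simp_all

lemma eq_of_div_mod {m a b : ℕ} (h1 : a / m = b / m) (h2 : a % m = b % m) : a = b := by
  rw [← Nat.div_add_mod a m, ← Nat.div_add_mod b m, h1, h2]

lemma pair_index {r r' s s' w : ℕ} (hs : s < w) (hs' : s' < w) (H : r * w + s = r' * w + s') :
    r = r' ∧ s = s' := by
  have hw : 0 < w := by omega
  have h1 : (r * w + s) / w = r := by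
    rw [mul_comm, Nat.mul_add_div hw, Nat.div_eq_of_lt hs, add_zero]
  have h2 : (r' * w + s') / w = r' := by
    rw [mul_comm, Nat.mul_add_div hw, Nat.div_eq_of_lt hs', add_zero]
  have : r = r' := by rw [← h1, ← h2, H]
  subst this
  exact ⟨rfl, by omega⟩

lemma hcol_card {n m k h : ℕ} (hm : 0 < m) (hmh : m * m ≤ h)
    (hex : k * (m * (n - k * m) - (2 * m - k) * h) ≤ h) (x : ℕ × ℕ × ℕ)
    (S : Finset (ℕ × ℕ)) (hS : ∀ e ∈ S, e.1 < e.2 ∧ e.2 < n ∧ hcol n m k h e = x) :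
    S.card ≤ h := by
  have hh : 0 < h := by nlinarith
  have hV0 : ∀ v, ¬ v / m < k → k * m ≤ v := by
    intro v hv
    rw [Nat.div_lt_iff_lt_mul hm] at hv
    omega
  obtain ⟨t, a, b⟩ := x
  match t, hS with
  | 0, hS =>
    refine le_trans ?_ hmh
    have : (Finset.range m ×ˢ Finset.range m).card = m * m := by simp
    rw [← this]
    apply Finset.card_le_card_of_injOn
      (fun e => if e.1 / m % 2 = 0 then (e.1 % m, e.2 % m) else (e.2 % m, e.1 % m))
    · intro e _
      have h1 := Nat.mod_lt e.1 hm
      have h2 := Nat.mod_lt e.2 hm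
      simp only
      split_ifs <;> simp [h1, h2]
    · intro e he e' he' H
      obtain ⟨l1, -, h1⟩ := hS e he
      obtain ⟨l2, -, h2⟩ := hS e' he'
      obtain ⟨-, h1, h1'⟩ := hcol_zero h1
      obtain ⟨-, h2, h2'⟩ := hcol_zero h2
      have d1 := Nat.div_add_mod e.1 m
      have d2 := Nat.div_add_mod e.2 m
      have d3 := Nat.div_add_mod e'.1 m
      have d4 := Nat.div_add_mod e'.2 m
      rw [← h1] at d2
      rw [← h2] at d4
      simp only at H
      split_ifs at H with c1 c2 c2
      · have : e.1 / m = e'.1 / m := by omega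
        simp only [Prod.mk.injEq] at H
        rw [← this] at d3 d4
        ext <;> omega
      · simp only [Prod.mk.injEq] at H
        omega
      · simp only [Prod.mk.injEq] at H
        omega
      · have : e.1 / m = e'.1 / m := by omega
        simp only [Prod.mk.injEq] at H
        rw [← this] at d3 d4
        ext <;> omega
  | 1, hS =>
    refine le_trans ?_ hmh
    have : (Finset.range m ×ˢ Finset.range m).card = m * m := by simp
    rw [← this]
    apply Finset.card_le_card_of_injOn (fun e => (e.1 % m, e.2 % m))
    · intro e _
      have h1 := Nat.mod_lt e.1 hm
      have h2 := Nat.mod_lt e.2 hm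
      simp [h1, h2]
    · intro e he e' he' H
      obtain ⟨-, -, h1⟩ := hS e he
      obtain ⟨-, -, h2⟩ := hS e' he'
      obtain ⟨h1, h1'⟩ := hcol_one h1
      obtain ⟨h2, h2'⟩ := hcol_one h2
      simp only [Prod.mk.injEq] at H
      ext
      · exact eq_of_div_mod (h1.trans h2.symm) H.1
      · exact eq_of_div_mod (h1'.trans h2'.symm) H.2
  | 2, hS =>
    have : (Finset.Ico (b * h) (b * h + h)).card = h := by simp
    rw [← this]
    apply Finset.card_le_card_of_injOn
      (fun e => (e.1 % m) * (n - k * m) + (e.2 - k * m))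
    · intro e he
      obtain ⟨-, -, h1⟩ := hS e he
      obtain ⟨-, -, h1⟩ := hcol_two h1
      have h2 := Nat.div_add_mod ((e.1 % m) * (n - k * m) + (e.2 - k * m)) h
      have h3 := Nat.mod_lt ((e.1 % m) * (n - k * m) + (e.2 - k * m)) hh
      rw [h1, mul_comm] at h2
      simp only [Finset.coe_Ico, Set.mem_Ico]
      omega
    · intro e he e' he' H
      obtain ⟨-, l1, h1⟩ := hS e he
      obtain ⟨-, l2, h2⟩ := hS e' he'
      obtain ⟨g1, h1, -⟩ := hcol_two h1
      obtain ⟨g2, h2, -⟩ := hcol_two h2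
      have g1 := hV0 _ g1
      have g2 := hV0 _ g2
      obtain ⟨H1, H2⟩ := pair_index (by omega) (by omega) H
      ext
      · exact eq_of_div_mod (h1.trans h2.symm) H1
      · omega
  | 3, hS =>
    refine le_trans ?_ hex
    have : (Finset.range k ×ˢ Finset.Ico ((2 * m - k) * h) (m * (n - k * m))).card =
      k * (m * (n - k * m) - (2 * m - k) * h) := by simp
    rw [← this]
    apply Finset.card_le_card_of_injOn
      (fun e => (e.1 / m, (e.1 % m) * (n - k * m) + (e.2 - k * m)))
    · intro e he
      obtain ⟨-, l1, h1⟩ := hS e he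
      obtain ⟨g1, h1, h1'⟩ := hcol_three h1
      have g1 := hV0 _ g1
      rw [Nat.le_div_iff_mul_le hh] at h1'
      have h2 := Nat.mod_lt e.1 hm
      have h3 : (e.1 % m + 1) * (n - k * m) ≤ m * (n - k * m) := Nat.mul_le_mul_right _ h2
      simp only [Finset.coe_product, Set.mem_prod, Finset.coe_range, Set.mem_Iio,
        Finset.coe_Ico, Set.mem_Ico]
      refine ⟨h1, h1', ?_⟩
      rw [add_mul] at h3
      omega
    · intro e he e' he' H
      obtain ⟨-, l1, h1⟩ := hS e he
      obtain ⟨-, l2, h2⟩ := hS e' he'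
      obtain ⟨g1, -, -⟩ := hcol_three h1
      obtain ⟨g2, -, -⟩ := hcol_three h2
      have g1 := hV0 _ g1
      have g2 := hV0 _ g2
      simp only [Prod.mk.injEq] at H
      obtain ⟨H1, H2⟩ := pair_index (by omega) (by omega) H.2
      ext
      · exact eq_of_div_mod H.1 H1
      · omega
  | 4, hS =>
    refine le_trans ?_ (show 1 ≤ h by omega)
    rw [Finset.card_le_one]
    intro e he e' he'
    rw [hcol_four (hS e he).2.2, hcol_four (hS e' he').2.2]
  | t + 5, hS =>
    have : S = ∅ := by
      rw [Finset.eq_empty_iff_forall_notMem]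
      intro e he
      exact hcol_big (hS e he).2.2
    simp [this]

/-- A block with no inner edge and no shared edge has degree sum at most `2 m - 1`. -/
lemma good_block {n m k h : ℕ} (hm : 0 < m) (hkm : k ≤ 2 * m)
    (E : Finset (ℕ × ℕ)) (hE : ∀ e ∈ E, e.1 < e.2 ∧ e.2 < n)
    (hinj : Set.InjOn (hcol n m k h) E) (i : ℕ) (hi : i < k)
    (h1 : ∀ e ∈ E, ¬ (e.1 / m = i ∧ e.2 / m = i))
    (h2 : ∀ e ∈ E, e.1 / m = i → hcol n m k h e ≠ (3, 0, 0)) :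
    ∑ v ∈ (Finset.range n).filter (fun v => v / m = i),
      (E.filter (fun e => e.1 = v ∨ e.2 = v)).card ≤ 2 * m - 1 := by
  rw [← Finset.card_sigma]
  set T : Finset (ℕ × ℕ × ℕ) :=
    ((Finset.range i).image (fun j => (1, j, i))) ∪
    ((Finset.Ico (i + 1) k).image (fun j => (1, i, j))) ∪
    ((Finset.range (2 * m - k)).image (fun j => (2, i, j))) with hT
  have hTc : T.card ≤ 2 * m - 1 := by
    have a1 : ((Finset.range i).image (fun j => ((1 : ℕ), j, i))).card ≤ i := by
      simpa using Finset.card_image_le (s := Finset.range i) (f := fun j => ((1 : ℕ), j, i))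
    have a2 : ((Finset.Ico (i + 1) k).image (fun j => ((1 : ℕ), i, j))).card ≤ k - (i + 1) := by
      simpa using
        Finset.card_image_le (s := Finset.Ico (i + 1) k) (f := fun j => ((1 : ℕ), i, j))
    have a3 : ((Finset.range (2 * m - k)).image (fun j => ((2 : ℕ), i, j))).card ≤
        2 * m - k := by
      simpa using
        Finset.card_image_le (s := Finset.range (2 * m - k)) (f := fun j => ((2 : ℕ), i, j))
    have a4 := Finset.card_union_le
      (((Finset.range i).image (fun j => ((1 : ℕ), j, i))) ∪
      ((Finset.Ico (i + 1) k).image (fun j => ((1 : ℕ), i, j))))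
      ((Finset.range (2 * m - k)).image (fun j => ((2 : ℕ), i, j)))
    have a5 := Finset.card_union_le ((Finset.range i).image (fun j => ((1 : ℕ), j, i)))
      ((Finset.Ico (i + 1) k).image (fun j => ((1 : ℕ), i, j)))
    rw [← hT] at a4
    omega
  refine le_trans ?_ hTc
  apply Finset.card_le_card_of_injOn (fun x => hcol n m k h x.2)
  · rintro ⟨v, e⟩ hx
    simp only [Finset.coe_sigma, Set.mem_sigma_iff, Finset.mem_coe, Finset.mem_filter,
      Finset.mem_range] at hx
    obtain ⟨⟨hv, hvi⟩, he, hev⟩ := hx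
    have hlt := (hE e he).1
    have hle : e.1 / m ≤ e.2 / m := Nat.div_le_div_right hlt.le
    have k1 := h1 e he
    have k2 := h2 e he
    have k0 : e.1 / m = i ∨ e.2 / m = i := by
      rcases hev with r | r
      · left; rw [r, hvi]
      · right; rw [r, hvi]
    simp only [hT, Finset.mem_coe, Finset.mem_union, Finset.mem_image, Finset.mem_range,
      Finset.mem_Ico]
    unfold hcol at k2 ⊢
    split_ifs with c1 c2 c2 c3
    · omega
    · left
      rcases k0 with r | r
      · right; exact ⟨e.2 / m, by omega, by rw [r]⟩
      · left; exact ⟨e.1 / m, by omega, by rw [r]⟩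
    · right
      have r : e.1 / m = i := by omega
      exact ⟨_, c3, by rw [r]⟩
    · exfalso
      have r : e.1 / m = i := by omega
      apply k2 r
      rw [if_neg c1, if_pos c2, if_neg c3]
    · omega
  · rintro ⟨v, e⟩ hx ⟨v', e'⟩ hx' H
    simp only [Finset.coe_sigma, Set.mem_sigma_iff, Finset.mem_coe, Finset.mem_filter,
      Finset.mem_range] at hx hx' H
    obtain ⟨⟨hv, hvi⟩, he, hev⟩ := hx
    obtain ⟨⟨hv', hvi'⟩, he', hev'⟩ := hx'
    have := hinj he he' H
    subst this
    have k1 := h1 e he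
    have : v = v' := by
      rcases hev with r | r <;> rcases hev' with r' | r' <;> subst r <;> subst r' <;> tauto
    subst this
    rfl

lemma core {n m q h : ℕ} (hm : 0 < m) (hkm : 2 * q ≤ 2 * m) (hn : 2 * q * m ≤ n)
    (E : Finset (ℕ × ℕ)) (hE : ∀ e ∈ E, e.1 < e.2 ∧ e.2 < n)
    (hinj : Set.InjOn (hcol n m (2 * q) h) E)
    (hdeg : ∀ v, (E.filter (fun e => e.1 = v ∨ e.2 = v)).card ≤ 2) :
    2 * E.card + q ≤ 2 * n + 1 := by
  classical
  set d : ℕ → ℕ := fun v => (E.filter (fun e => e.1 = v ∨ e.2 = v)).card with hd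
  have hsum : ∑ v ∈ Finset.range n, d v = 2 * E.card := by
    simp only [hd, Finset.card_filter]
    rw [Finset.sum_comm, mul_comm, ← smul_eq_mul, ← Finset.sum_const]
    apply Finset.sum_congr rfl
    intro e he
    obtain ⟨l1, l2⟩ := hE e he
    rw [← Finset.card_filter]
    have : (Finset.range n).filter (fun v => e.1 = v ∨ e.2 = v) = {e.1, e.2} := by
      ext v
      simp only [Finset.mem_filter, Finset.mem_range, Finset.mem_insert, Finset.mem_singleton]
      omega
    rw [this, Finset.card_pair (by omega)]
  set B1 := (Finset.range (2 * q)).filter (fun i => ∃ e ∈ E, e.1 / m = i ∧ e.2 / m = i) with hB1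
  set B2 := (Finset.range (2 * q)).filter
    (fun i => ∃ e ∈ E, e.1 / m = i ∧ hcol n m (2 * q) h e = (3, 0, 0)) with hB2
  have cB1 : B1.card ≤ q := by
    rw [← Finset.card_range q]
    apply Finset.card_le_card_of_injOn (fun i => i / 2)
    · intro i hi
      simp only [hB1, Finset.coe_filter, Finset.mem_range, Set.mem_ofPred_eq] at hi
      simp only [Finset.coe_range, Set.mem_Iio]
      omega
    · intro i hi j hj H
      simp only [hB1, Finset.coe_filter, Finset.mem_range, Set.mem_ofPred_eq] at hi hj H
      obtain ⟨hi, e, he, e1, e2⟩ := hi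
      obtain ⟨hj, f, hf, f1, f2⟩ := hj
      have := hinj he hf (by
        unfold hcol
        rw [e1, e2, f1, f2, if_pos hi, if_pos hj, if_pos rfl, if_pos rfl, H])
      rw [← e1, ← f1, this]
  have cB2 : B2.card ≤ 1 := by
    rw [Finset.card_le_one]
    intro i hi j hj
    simp only [hB2, Finset.mem_filter] at hi hj
    obtain ⟨hi, e, he, e1, e2⟩ := hi
    obtain ⟨hj, f, hf, f1, f2⟩ := hj
    have := hinj he hf (e2.trans f2.symm)
    rw [← e1, ← f1, this]
  set I := Finset.range (2 * q) \ (B1 ∪ B2) with hI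
  have cI : q ≤ I.card + 1 := by
    have a1 := Finset.le_card_sdiff (B1 ∪ B2) (Finset.range (2 * q))
    have a2 := Finset.card_union_le B1 B2
    rw [Finset.card_range, ← hI] at a1
    omega
  have hblock : ∀ i ∈ I,
      ∑ v ∈ (Finset.range n).filter (fun v => v / m = i), d v + 1 ≤ 2 * m := by
    intro i hi
    simp only [hI, hB1, hB2, Finset.mem_sdiff, Finset.mem_union, Finset.mem_filter,
      Finset.mem_range, not_or, not_and, not_exists] at hi
    obtain ⟨hi, b1, b2⟩ := hi
    have := good_block (h := h) hm hkm E hE hinj i hi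
      (fun e he c => b1 hi e he c.1 c.2) (fun e he c => b2 hi e he c)
    change ∑ v ∈ (Finset.range n).filter (fun v => v / m = i), d v ≤ 2 * m - 1 at this
    omega
  have hcardb : ∀ i ∈ I, ((Finset.range n).filter (fun v => v / m = i)).card = m := by
    intro i hi
    have hi : i < 2 * q := by
      have := (Finset.mem_sdiff.1 hi).1
      simpa using this
    have : (Finset.range n).filter (fun v => v / m = i) = Finset.Ico (i * m) (i * m + m) := by
      ext v
      simp only [Finset.mem_filter, Finset.mem_range, Finset.mem_Ico]
      rw [Nat.div_eq_iff hm]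
      have : (i + 1) * m ≤ 2 * q * m := Nat.mul_le_mul_right _ hi
      rw [add_mul] at this
      omega
    rw [this]
    simp
  -- split the sum
  have s1 : ∑ v ∈ Finset.range n, d v =
      ∑ v ∈ (Finset.range n).filter (fun v => v / m ∈ I), d v +
      ∑ v ∈ (Finset.range n).filter (fun v => ¬ v / m ∈ I), d v :=
    (Finset.sum_filter_add_sum_filter_not _ _ _).symm
  have fib : ∀ g : ℕ → ℕ, ∑ v ∈ (Finset.range n).filter (fun v => v / m ∈ I), g v =
      ∑ i ∈ I, ∑ v ∈ (Finset.range n).filter (fun v => v / m = i), g v := by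
    intro g
    rw [← Finset.sum_fiberwise_of_maps_to (s := (Finset.range n).filter (fun v => v / m ∈ I))
      (t := I) (g := fun v => v / m) (fun v hv => (Finset.mem_filter.1 hv).2)]
    apply Finset.sum_congr rfl
    intro i hi
    apply Finset.sum_congr _ (fun _ _ => rfl)
    ext v
    simp only [Finset.mem_filter]
    constructor
    · rintro ⟨⟨a, b⟩, c⟩; exact ⟨a, c⟩
    · rintro ⟨a, c⟩; exact ⟨⟨a, c ▸ hi⟩, c⟩
  have s2 : ∑ v ∈ (Finset.range n).filter (fun v => v / m ∈ I), d v + I.card ≤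
      ∑ v ∈ (Finset.range n).filter (fun v => v / m ∈ I), 2 := by
    rw [fib, fib, Finset.card_eq_sum_ones, ← Finset.sum_add_distrib]
    apply Finset.sum_le_sum
    intro i hi
    rw [Finset.sum_const, hcardb i hi, smul_eq_mul, mul_comm m 2]
    exact hblock i hi
  have s3 : ∑ v ∈ (Finset.range n).filter (fun v => ¬ v / m ∈ I), d v ≤
      ∑ v ∈ (Finset.range n).filter (fun v => ¬ v / m ∈ I), 2 :=
    Finset.sum_le_sum (fun v _ => hdeg v)
  have s4 : ∑ v ∈ (Finset.range n).filter (fun v => v / m ∈ I), 2 +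
      ∑ v ∈ (Finset.range n).filter (fun v => ¬ v / m ∈ I), 2 = 2 * n := by
    rw [Finset.sum_filter_add_sum_filter_not]
    simp [mul_comm]
  omega

/-- Degrees in a path are at most two. -/
lemma path_deg {V : Type*} [DecidableEq V] {G : SimpleGraph V} {u v : V} (p : G.Walk u v) :
    p.IsPath → (p.edges.countP (fun e => u ∈ e) ≤ 1) ∧
      ∀ x, p.edges.countP (fun e => x ∈ e) ≤ 2 := by
  induction p with
  | nil => simp
  | @cons u w v hadj p ih =>
    intro hp
    rw [SimpleGraph.Walk.cons_isPath_iff] at hp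
    obtain ⟨ih1, ih2⟩ := ih hp.1
    have h0 : p.edges.countP (fun e => u ∈ e) = 0 := by
      rw [List.countP_eq_zero]
      intro e he
      simp only [decide_eq_true_eq]
      intro hu
      exact hp.2 (SimpleGraph.Walk.mem_support_of_mem_edges he hu)
    constructor
    · rw [SimpleGraph.Walk.edges_cons, List.countP_cons, h0]
      split_ifs <;> omega
    · intro x
      rw [SimpleGraph.Walk.edges_cons, List.countP_cons]
      split_ifs with c
      · simp only [Sym2.mem_iff, decide_eq_true_eq] at c
        rcases c with c | c
        · subst c; omega
        · subst c; omega
      · exact ih2 x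

/-- The ordered pair of a `Sym2`. -/
def toPair {n : ℕ} (e : Sym2 (Fin n)) : ℕ × ℕ := (e.inf.val, e.sup.val)

lemma toPair_mk {n : ℕ} (a b : Fin n) : toPair s(a, b) = (min a.val b.val, max a.val b.val) := by
  unfold toPair
  rw [Sym2.inf_mk, Sym2.sup_mk]
  rcases le_total a b with h | h
  · have h' : a.val ≤ b.val := h
    simp [h, h']
  · have h' : b.val ≤ a.val := h
    simp [h, h']

lemma toPair_inj {n : ℕ} : Function.Injective (toPair (n := n)) := by
  intro e f
  induction e with | _ a b =>
  induction f with | _ c d =>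
  rw [toPair_mk, toPair_mk, Prod.mk.injEq, Sym2.eq_iff]
  intro h
  simp only [Fin.ext_iff]
  omega

lemma toPair_lt {n : ℕ} (e : Sym2 (Fin n)) (he : ¬ e.IsDiag) :
    (toPair e).1 < (toPair e).2 ∧ (toPair e).2 < n := by
  induction e with | _ a b =>
  rw [toPair_mk]
  simp only [Sym2.mk_isDiag_iff, Fin.ext_iff] at he
  simp only
  omega

lemma toPair_mem {n : ℕ} (e : Sym2 (Fin n)) (v : Fin n)
    (h : (toPair e).1 = v.val ∨ (toPair e).2 = v.val) : v ∈ e := by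
  induction e with | _ a b =>
  rw [toPair_mk] at h
  simp only [Sym2.mem_iff, Fin.ext_iff]
  simp only at h
  omega

lemma growth (q : ℕ) (hq : 60 ≤ q) : 392 * q ^ 4 + 4 ≤ 2 ^ (q - 2) := by
  obtain ⟨r, rfl⟩ := Nat.exists_eq_add_of_le hq
  induction r with
  | zero => norm_num
  | succ r ih =>
    have ih := ih (by omega)
    have e : 60 + (r + 1) - 2 = (60 + r - 2) + 1 := by omega
    rw [e, pow_succ 2]
    have : (60 + (r + 1)) ^ 4 ≤ 2 * (60 + r) ^ 4 := by
      ring_nf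
      nlinarith [sq_nonneg r, pow_nonneg (Nat.zero_le r) 3, pow_nonneg (Nat.zero_le r) 4]
    omega

/-- For all sufficiently large `n`, there is an edge-colouring of the complete
graph `K_n` (edges are the non-diagonal elements of `Sym2 (Fin n)`) in which every colour is used
on at most `n/2 - 1` edges, and in which there is no rainbow path with more than
`n - (1/42)·ln n` edges. -/
theorem hahn_conjecture_false :
    ∃ N : ℕ, ∀ n : ℕ, N ≤ n →
      ∃ c : Sym2 (Fin n) → ℕ,
        (∀ k : ℕ,
          ((Finset.univ.filter (fun e : Sym2 (Fin n) => ¬ e.IsDiag ∧ c e = k)).card : ℝ) ≤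
            (n : ℝ) / 2 - 1) ∧
        (∀ (u v : Fin n) (p : (⊤ : SimpleGraph (Fin n)).Walk u v),
          p.IsPath → (p.edges.map c).Nodup →
          (p.length : ℝ) ≤ (n : ℝ) - Real.log n / 42) := by
  classical
  refine ⟨2 ^ 60, fun n hN => ?_⟩
  have hn0 : n ≠ 0 := by
    rintro rfl
    norm_num at hN
  obtain ⟨q, hq⟩ : ∃ q, q = Nat.log 2 n + 2 := ⟨_, rfl⟩
  obtain ⟨h, hh⟩ : ∃ h, h = (n - 2) / 2 := ⟨_, rfl⟩
  obtain ⟨m, hm⟩ : ∃ m, m = Nat.sqrt h := ⟨_, rfl⟩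
  have hq60 : 60 ≤ q := by
    have : 60 ≤ Nat.log 2 n := Nat.le_log_of_pow_le (by norm_num) hN
    omega
  have hqn : 2 ^ (q - 2) ≤ n := by
    rw [hq, Nat.add_sub_cancel]
    exact Nat.pow_log_le_self 2 hn0
  have hqn2 : n < 2 ^ (q - 1) := by
    rw [hq]
    exact Nat.lt_pow_succ_log_self (by norm_num) n
  have hg := growth q hq60
  have hqm : 14 * q ^ 2 ≤ m := by
    rw [hm, Nat.le_sqrt]
    have : 14 * q ^ 2 * (14 * q ^ 2) = 196 * q ^ 4 := by ring
    rw [this]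
    omega
  have hmh : m * m ≤ h := by rw [hm]; exact Nat.sqrt_le h
  have hmh2 : h ≤ m * m + 2 * m := by
    have := Nat.sqrt_le_add h
    rw [← hm] at this
    omega
  have hm0 : 0 < m := by nlinarith
  have hqlm : q ≤ m := by nlinarith
  have hn4 : 4 ≤ n := by omega
  have hn2 : n ≤ 2 * h + 3 := by omega
  have hn3 : 2 * h + 2 ≤ n := by omega
  have hkmn : 2 * q * m ≤ n := by nlinarith
  have hex : 2 * q * (m * (n - 2 * q * m) - (2 * m - 2 * q) * h) ≤ h := by
    have a1 : m * (n - 2 * q * m) - (2 * m - 2 * q) * h ≤ 3 * m + 4 * q * m := by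
      rw [Nat.sub_le_iff_le_add]
      have b : 2 * q ≤ 2 * m := by omega
      zify [hkmn, b] at *
      nlinarith
    calc _ ≤ 2 * q * (3 * m + 4 * q * m) := Nat.mul_le_mul_left _ a1
      _ = (6 * q + 8 * q ^ 2) * m := by ring
      _ ≤ m * m := Nat.mul_le_mul_right _ (by nlinarith)
      _ ≤ h := hmh
  refine ⟨fun e => Encodable.encode (hcol n m (2 * q) h (toPair e)), ?_, ?_⟩
  · intro k
    have key : (Finset.univ.filter (fun e : Sym2 (Fin n) => ¬ e.IsDiag ∧
        Encodable.encode (hcol n m (2 * q) h (toPair e)) = k)).card ≤ h := by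
      set S := Finset.univ.filter (fun e : Sym2 (Fin n) => ¬ e.IsDiag ∧
        Encodable.encode (hcol n m (2 * q) h (toPair e)) = k) with hS
      rcases S.eq_empty_or_nonempty with h0 | ⟨e0, he0⟩
      · simp [h0]
      rw [← Finset.card_image_of_injective S toPair_inj]
      apply hcol_card hm0 hmh hex (hcol n m (2 * q) h (toPair e0))
      intro x hx
      obtain ⟨e, he, rfl⟩ := Finset.mem_image.1 hx
      simp only [hS, Finset.mem_filter, Finset.mem_univ, true_and] at he he0
      obtain ⟨l1, l2⟩ := toPair_lt e he.1
      exact ⟨l1, l2, Encodable.encode_injective (he.2.trans he0.2.symm)⟩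
    have k1 : ((Finset.univ.filter (fun e : Sym2 (Fin n) => ¬ e.IsDiag ∧
        Encodable.encode (hcol n m (2 * q) h (toPair e)) = k)).card : ℝ) ≤ h := by
      exact_mod_cast key
    have k2 : (2 * h + 2 : ℝ) ≤ n := by exact_mod_cast hn3
    linarith
  · intro u v p hp hnd
    have hed : p.edges.Nodup := List.Nodup.of_map _ hnd
    have hinj0 := List.inj_on_of_nodup_map hnd
    have hcore := core (n := n) (m := m) (q := q) (h := h) hm0 (by omega) hkmn
      (p.edges.toFinset.image toPair) (by
        intro x hx
        obtain ⟨e, he, rfl⟩ := Finset.mem_image.1 hx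
        apply toPair_lt
        exact SimpleGraph.not_isDiag_of_mem_edgeSet _
          (p.edges_subset_edgeSet (List.mem_toFinset.1 he))) (by
        intro x hx y hy H
        obtain ⟨e, he, rfl⟩ := Finset.mem_image.1 (Finset.mem_coe.1 hx)
        obtain ⟨f, hf, rfl⟩ := Finset.mem_image.1 (Finset.mem_coe.1 hy)
        have := hinj0 (List.mem_toFinset.1 he) (List.mem_toFinset.1 hf)
          (by simp only [H])
        rw [this]) (by
        intro w
        by_cases hw : w < n
        · refine le_trans ?_ ((path_deg p hp).2 ⟨w, hw⟩)
          rw [Finset.filter_image, Finset.card_image_of_injective _ toPair_inj,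
            List.countP_eq_length_filter, ← List.toFinset_card_of_nodup (hed.filter _)]
          apply Finset.card_le_card
          intro e he
          simp only [Finset.mem_filter, List.mem_toFinset] at he
          simp only [List.mem_toFinset, List.mem_filter, decide_eq_true_eq]
          exact ⟨he.1, toPair_mem e ⟨w, hw⟩ he.2⟩
        · rw [Finset.filter_eq_empty_iff.2]
          · simp
          · intro x hx
            obtain ⟨e, he, rfl⟩ := Finset.mem_image.1 hx
            have := toPair_lt e (SimpleGraph.not_isDiag_of_mem_edgeSet _
              (p.edges_subset_edgeSet (List.mem_toFinset.1 he)))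
            omega)
    rw [Finset.card_image_of_injective _ toPair_inj, List.toFinset_card_of_nodup hed,
      SimpleGraph.Walk.length_edges] at hcore
    have hc : (2 * p.length + q : ℝ) ≤ 2 * n + 1 := by exact_mod_cast hcore
    have hlog : Real.log n ≤ q - 1 := by
      have a1 : (n : ℝ) ≤ 2 ^ (q - 1) := by exact_mod_cast hqn2.le
      have a2 : Real.log n ≤ Real.log (2 ^ (q - 1)) :=
        Real.log_le_log (by exact_mod_cast Nat.pos_of_ne_zero hn0) a1
      rw [Real.log_pow, Nat.cast_sub (by omega)] at a2
      have a3 : Real.log 2 ≤ 1 := by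
        have := Real.log_two_lt_d9
        linarith
      have a4 : (60 : ℝ) ≤ q := by exact_mod_cast hq60
      push_cast at a2
      nlinarith
    have hlog0 : 0 ≤ Real.log n := Real.log_natCast_nonneg n
    linarith
end
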